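/- Let G be a one-dimensional definably connected torsion-free definable group. For each i ∈ {1,…,l} let A_i be a definable group admitting definable subgroups 1 = A⁰_i < A¹_i < ⋯ < A^{n_i}_i = A_i such that each quotient A^j_i/A^{j−1}_i is definably isomorphic to a one-dimensional definably connected torsion-free definable group with domain I_i ⊆ N, and suppose that for each i there is no definable bijection between G and I_i. If A := A₁ × ⋯ × A_l and (A, γ) is a definable G-module, then the action of G on A is trivial and every definable extension of G by A compatible with γ splits: it is definably equivalent to the direct product A × G. -/

import Mathlib

open Filter Set Topology

universe u

section OMinPreamble

variable {N : Type u}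

section Basic
variable [LinearOrder N]

/-- A finite union of singletons and open intervals (with possibly infinite endpoints). -/
def IsFinUnionPtsIntervals (A : Set N) : Prop :=
  ∃ (k : ℕ) (f : Fin k → Set N),
    (∀ i, (∃ a, f i = {a}) ∨ (∃ a b, f i = Set.Ioo a b) ∨ (∃ a, f i = Set.Ioi a) ∨
        (∃ b, f i = Set.Iio b) ∨ f i = Set.univ) ∧
    A = ⋃ i, f i

/-- An o-minimal structure on the ordered set `N`: an assignment, to each arity `m`,
of a collection of "definable" subsets of `N^m`, closed under the boolean and
first-order operations, containing the order and all points (parameters), and such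
that every definable subset of `N` is a finite union of points and open intervals. -/
structure Struc (N : Type u) [LinearOrder N] where
  Def : ∀ m : ℕ, Set (Fin m → N) → Prop
  def_inter : ∀ {m : ℕ} {A B : Set (Fin m → N)}, Def m A → Def m B → Def m (A ∩ B)
  def_compl : ∀ {m : ℕ} {A : Set (Fin m → N)}, Def m A → Def m Aᶜ
  def_univ : ∀ m : ℕ, Def m Set.univ
  def_reindex : ∀ {m k : ℕ} (g : Fin m → Fin k) {A : Set (Fin m → N)},
      Def m A → Def k {x | x ∘ g ∈ A}
  def_proj : ∀ {m : ℕ} {A : Set (Fin (m + 1) → N)},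
      Def (m + 1) A → Def m {x | ∃ t : N, Fin.snoc x t ∈ A}
  def_lt : Def 2 {x | x 0 < x 1}
  def_pt : ∀ a : N, Def 1 {x | x 0 = a}
  o_min : ∀ {A : Set (Fin 1 → N)}, Def 1 A →
      IsFinUnionPtsIntervals {t : N | (fun _ : Fin 1 => t) ∈ A}

/-- Index of the pair `(i,j)` in `Fin (n*m)`. -/
def finIdx {n m : ℕ} (i : Fin n) (j : Fin m) : Fin (n * m) :=
  ⟨i.1 * m + j.1, by
    have hi := i.isLt
    have hj := j.isLt
    calc i.1 * m + j.1 < i.1 * m + m := by omega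
      _ = (i.1 + 1) * m := by ring
      _ ≤ n * m := Nat.mul_le_mul hi (le_refl m)⟩

def pFst {a b : ℕ} (p : Fin (a * b)) : Fin a :=
  ⟨p.1 / b, by
    have h := p.isLt
    have hb : 0 < b := by
      rcases Nat.eq_zero_or_pos b with h0 | h0
      · subst h0; simp at h
      · exact h0
    exact (Nat.div_lt_iff_lt_mul hb).mpr h⟩

def pSnd {a b : ℕ} (p : Fin (a * b)) : Fin b :=
  ⟨p.1 % b, by
    have h := p.isLt
    have hb : 0 < b := by
      rcases Nat.eq_zero_or_pos b with h0 | h0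
      · subst h0; simp at h
      · exact h0
    exact Nat.mod_lt _ hb⟩

/-- Horner evaluation of the polynomial with coefficients `c` (constant term first)
at `x`, relative to abstract operations. -/
def polyEval {α : Type*} (add mul : α → α → α) (zero : α) {n : ℕ} (c : Fin n → α)
    (x : α) : α :=
  (List.ofFn c).foldr (fun a acc => add a (mul x acc)) zero

/-- `n`-th power relative to an abstract operation with identity `z`. -/
def opPow {α : Type*} (op : α → α → α) (z : α) (a : α) : ℕ → α
  | 0 => z
  | n + 1 => op a (opPow op z a n)

namespace Struc
variable (S : Struc N)

/-- The function `f`, restricted to the definable set `A ⊆ N^m` and with values in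
`N^n`, is definable: its graph is a definable set. -/
def DefFunOn {m n : ℕ} (A : Set (Fin m → N)) (f : (Fin m → N) → (Fin n → N)) : Prop :=
  S.Def (m + n) {z | (z ∘ Fin.castAdd n) ∈ A ∧ f (z ∘ Fin.castAdd n) = z ∘ Fin.natAdd m}

/-- A definable function of two tuple variables. -/
def DefFun2 {m n k : ℕ} (A : Set (Fin m → N)) (B : Set (Fin n → N))
    (f : (Fin m → N) → (Fin n → N) → (Fin k → N)) : Prop :=
  S.Def (m + n + k) {z |
    (z ∘ Fin.castAdd k ∘ Fin.castAdd n) ∈ A ∧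
    (z ∘ Fin.castAdd k ∘ Fin.natAdd m) ∈ B ∧
    f (z ∘ Fin.castAdd k ∘ Fin.castAdd n) (z ∘ Fin.castAdd k ∘ Fin.natAdd m) =
      z ∘ Fin.natAdd (m + n)}

/-- A definable unary function `N → N` on the set `J ⊆ N`. -/
def DefFun1 (J : Set N) (f : N → N) : Prop :=
  S.Def 2 {z | z 0 ∈ J ∧ f (z 0) = z 1}

/-- A definable curve in `N^k` defined on the set `J ⊆ N`. -/
def DefCurve {k : ℕ} (J : Set N) (σ : N → (Fin k → N)) : Prop :=
  S.DefFunOn {x : Fin 1 → N | x 0 ∈ J} (fun x => σ (x 0))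

/-- A definable function of `n` tuple variables from `A^n ⊆ (N^m)^n` to `N^k`. -/
def DefFunN {m k : ℕ} (n : ℕ) (A : Set (Fin m → N))
    (c : (Fin n → (Fin m → N)) → (Fin k → N)) : Prop :=
  S.Def (n * m + k) {z |
    (∀ i : Fin n, (fun j : Fin m => z (Fin.castAdd k (finIdx i j))) ∈ A) ∧
    c (fun i j => z (Fin.castAdd k (finIdx i j))) = fun j => z (Fin.natAdd (n * m) j)}

end Struc

/-- The filter of neighbourhoods of the "left end" of the set `J ⊆ N`. -/
def leftEndFilter (J : Set N) : Filter N := ⨅ x ∈ J, Filter.principal (J ∩ Set.Iio x)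

/-- The filter of neighbourhoods of the "right end" of the set `J ⊆ N`
(for `J` unbounded above this is "`→ +∞` inside `J`"). -/
def rightEndFilter (J : Set N) : Filter N := ⨅ x ∈ J, Filter.principal (J ∩ Set.Ioi x)

/-- `J` is an open interval, with possibly infinite endpoints. -/
def IsOpenIntervalSet (J : Set N) : Prop :=
  (∃ a b, a < b ∧ J = Set.Ioo a b) ∨ (∃ a, J = Set.Ioi a) ∨ (∃ b, J = Set.Iio b) ∨
    J = Set.univ

end Basic

section Groups
variable [LinearOrder N] [TopologicalSpace N]

/-- The o-minimal dimension of `A ⊆ N^m`: the largest `k` such that the image of `A`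
under some projection onto `k` coordinates has nonempty interior in `N^k`
(`N` carrying the order topology and `N^k` the product topology). -/
noncomputable def odim {m : ℕ} (A : Set (Fin m → N)) : ℕ :=
  sSup {k | ∃ p : Fin k → Fin m, Function.Injective p ∧
    (interior ((fun x : Fin m → N => x ∘ p) '' A)).Nonempty}

/-- A definable group: a definable subset of `N^m` with a group operation whose graph
is definable, together with its (unique) definable manifold topology, i.e. a group
topology which agrees with the ambient topology on a large definable subset. -/
structure DefGroup (S : Struc N) (m : ℕ) where
  carrier : Set (Fin m → N)
  carrier_def : S.Def m carrier
  mul : (Fin m → N) → (Fin m → N) → (Fin m → N)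
  one : Fin m → N
  inv : (Fin m → N) → (Fin m → N)
  one_mem : one ∈ carrier
  mul_mem : ∀ ⦃x y : Fin m → N⦄, x ∈ carrier → y ∈ carrier → mul x y ∈ carrier
  inv_mem : ∀ ⦃x : Fin m → N⦄, x ∈ carrier → inv x ∈ carrier
  mul_assoc' : ∀ ⦃x y z : Fin m → N⦄, x ∈ carrier → y ∈ carrier → z ∈ carrier →
      mul (mul x y) z = mul x (mul y z)
  one_mul' : ∀ ⦃x : Fin m → N⦄, x ∈ carrier → mul one x = x
  inv_mul' : ∀ ⦃x : Fin m → N⦄, x ∈ carrier → mul (inv x) x = one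
  mul_graph_def : S.DefFun2 carrier carrier mul
  inv_graph_def : S.DefFunOn carrier inv
  top : TopologicalSpace (Fin m → N)
  contMul : @ContinuousOn ((Fin m → N) × (Fin m → N)) (Fin m → N)
      (@instTopologicalSpaceProd _ _ top top) top (fun p => mul p.1 p.2)
      (carrier ×ˢ carrier)
  contInv : @ContinuousOn (Fin m → N) (Fin m → N) top top inv carrier
  pillay : ∃ V : Set (Fin m → N), V ⊆ carrier ∧ S.Def m V ∧
      (carrier \ V = ∅ ∨ odim (carrier \ V) < odim carrier) ∧
      (∃ O : Set (Fin m → N), IsOpen[top] O ∧ O ∩ carrier = V) ∧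
      ∀ x ∈ V, @nhdsWithin (Fin m → N) top x carrier = nhdsWithin x V

variable {S : Struc N}

/-- The elements of a definable group, as a type. -/
def DefGroup.Elt {m : ℕ} (G : DefGroup S m) : Type u := {x : Fin m → N // x ∈ G.carrier}

namespace DefGroup

instance {m : ℕ} {G : DefGroup S m} : Mul G.Elt :=
  ⟨fun a b => ⟨G.mul a.1 b.1, G.mul_mem a.2 b.2⟩⟩

instance {m : ℕ} {G : DefGroup S m} : One G.Elt := ⟨⟨G.one, G.one_mem⟩⟩

instance {m : ℕ} {G : DefGroup S m} : Inv G.Elt := ⟨fun a => ⟨G.inv a.1, G.inv_mem a.2⟩⟩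

instance instGroupElt {m : ℕ} {G : DefGroup S m} : Group G.Elt :=
  Group.ofLeftAxioms
    (fun a b c => Subtype.ext (G.mul_assoc' a.2 b.2 c.2))
    (fun a => Subtype.ext (G.one_mul' a.2))
    (fun a => Subtype.ext (G.inv_mul' a.2))

variable {m : ℕ} (G : DefGroup S m)

/-- `H` is a definable subgroup of `G`. -/
def IsDefSubgroup (H : Set (Fin m → N)) : Prop :=
  H ⊆ G.carrier ∧ S.Def m H ∧ G.one ∈ H ∧
    (∀ x ∈ H, ∀ y ∈ H, G.mul x y ∈ H) ∧ (∀ x ∈ H, G.inv x ∈ H)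

/-- `H` is a definable normal subgroup of `G`. -/
def IsNormalDefSubgroup (H : Set (Fin m → N)) : Prop :=
  G.IsDefSubgroup H ∧ ∀ g ∈ G.carrier, ∀ h ∈ H, G.mul (G.mul g h) (G.inv g) ∈ H

/-- The left coset `g·H`. -/
def lcoset (g : Fin m → N) (H : Set (Fin m → N)) : Set (Fin m → N) :=
  {y | ∃ h ∈ H, y = G.mul g h}

/-- `H` has finite index in `G`: finitely many left cosets cover `G`. -/
def FiniteIndex (H : Set (Fin m → N)) : Prop :=
  ∃ F : Finset (Fin m → N), ↑F ⊆ G.carrier ∧ G.carrier ⊆ ⋃ g ∈ F, G.lcoset g H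

/-- `G` is definably connected: it has no proper definable subgroup of finite index. -/
def DefinablyConnected : Prop :=
  ∀ H : Set (Fin m → N), G.IsDefSubgroup H → G.FiniteIndex H → H = G.carrier

def IsAbelian : Prop := ∀ x ∈ G.carrier, ∀ y ∈ G.carrier, G.mul x y = G.mul y x

/-- The center of `G`, as a definable subset. -/
def center : Set (Fin m → N) :=
  {x | x ∈ G.carrier ∧ ∀ y ∈ G.carrier, G.mul x y = G.mul y x}

def TorsionFree : Prop := ∀ x : G.Elt, x ≠ 1 → ∀ n : ℕ, 0 < n → x ^ n ≠ 1

/-- `G` is definably compact: every definable continuous embedding of an open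
interval into `G` has limits at both ends of the interval (with respect to the
group's definable manifold topology). -/
def DefinablyCompact : Prop :=
  ∀ J : Set N, IsOpenIntervalSet J → ∀ σ : N → (Fin m → N),
    S.DefCurve J σ → (∀ t ∈ J, σ t ∈ G.carrier) → Set.InjOn σ J →
    @ContinuousOn N (Fin m → N) _ G.top σ J →
    (∃ c ∈ G.carrier, Filter.Tendsto σ (leftEndFilter J) (@nhds _ G.top c)) ∧
    (∃ d ∈ G.carrier, Filter.Tendsto σ (rightEndFilter J) (@nhds _ G.top d))

/-- `G` is definably semisimple: it has no infinite proper abelian definable normal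
subgroup. -/
def DefinablySemisimple : Prop :=
  ¬ ∃ H : Set (Fin m → N), G.IsNormalDefSubgroup H ∧ H.Infinite ∧ H ≠ G.carrier ∧
      ∀ x ∈ H, ∀ y ∈ H, G.mul x y = G.mul y x

/-- The product of a list of elements of `G`. -/
def listProd : List (Fin m → N) → (Fin m → N)
  | [] => G.one
  | x :: xs => G.mul x (listProd xs)

end DefGroup

/-- A definable homomorphism between definable groups. -/
def IsDefHom {m n : ℕ} (G : DefGroup S m) (H : DefGroup S n)
    (f : (Fin m → N) → (Fin n → N)) : Prop :=
  (∀ x ∈ G.carrier, f x ∈ H.carrier) ∧ S.DefFunOn G.carrier f ∧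
  ∀ x ∈ G.carrier, ∀ y ∈ G.carrier, f (G.mul x y) = H.mul (f x) (f y)

/-- `π` realizes `Q` as the quotient of the subgroup `H` of `U` by the normal
subgroup `V ⊆ H`: a definable surjective homomorphism `H → Q` with fibers the
cosets of `V` (kernel exactly `V`). -/
def IsQuotMap {m k : ℕ} (U : DefGroup S m) (H V : Set (Fin m → N)) (Q : DefGroup S k)
    (π : (Fin m → N) → (Fin k → N)) : Prop :=
  (∀ x ∈ H, π x ∈ Q.carrier) ∧ S.DefFunOn H π ∧
  (∀ x ∈ H, ∀ y ∈ H, π (U.mul x y) = Q.mul (π x) (π y)) ∧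
  π '' H = Q.carrier ∧ ∀ x ∈ H, (π x = Q.one ↔ x ∈ V)

/-- A definable extension `1 → A → U → G → 1`. -/
def IsDefExtension {mA mU mG : ℕ} (A : DefGroup S mA) (U : DefGroup S mU)
    (G : DefGroup S mG) (i : (Fin mA → N) → (Fin mU → N))
    (j : (Fin mU → N) → (Fin mG → N)) : Prop :=
  IsDefHom A U i ∧ IsDefHom U G j ∧ Set.InjOn i A.carrier ∧
  j '' U.carrier = G.carrier ∧
  ∀ u ∈ U.carrier, (j u = G.one ↔ ∃ a ∈ A.carrier, u = i a)

/-- A definable `G`-module: a definable abelian group `A` together with a definable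
action of `G` on `A` by (definable) automorphisms. -/
structure DefModule {mG mA : ℕ} (G : DefGroup S mG) (A : DefGroup S mA) where
  abelian : A.IsAbelian
  act : (Fin mG → N) → (Fin mA → N) → (Fin mA → N)
  act_mem : ∀ ⦃x a⦄, x ∈ G.carrier → a ∈ A.carrier → act x a ∈ A.carrier
  act_one : ∀ ⦃a⦄, a ∈ A.carrier → act G.one a = a
  act_mul : ∀ ⦃x y⦄, x ∈ G.carrier → y ∈ G.carrier → ∀ ⦃a⦄, a ∈ A.carrier →
      act (G.mul x y) a = act x (act y a)
  act_hom : ∀ ⦃x⦄, x ∈ G.carrier → ∀ ⦃a b⦄, a ∈ A.carrier → b ∈ A.carrier →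
      act x (A.mul a b) = A.mul (act x a) (act x b)
  act_def : S.DefFun2 G.carrier A.carrier act

/-- The module `(A, γ)` is trivial. -/
def DefModule.IsTrivial {mG mA : ℕ} {G : DefGroup S mG} {A : DefGroup S mA}
    (γ : DefModule G A) : Prop :=
  ∀ x ∈ G.carrier, ∀ a ∈ A.carrier, γ.act x a = a

/-- The definable extension `1 → A → U → G → 1` is compatible with the `G`-module
`(A, γ)`: conjugation in `U` induces the action `γ` on `A`. -/
def ExtCompatible {mG mA mU : ℕ} {G : DefGroup S mG} {A : DefGroup S mA}
    (γ : DefModule G A) (U : DefGroup S mU) (i : (Fin mA → N) → (Fin mU → N))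
    (j : (Fin mU → N) → (Fin mG → N)) : Prop :=
  ∀ u ∈ U.carrier, ∀ a ∈ A.carrier, i (γ.act (j u) a) = U.mul (U.mul u (i a)) (U.inv u)

/-- Alternating "sum" `x₁ - (x₂ - (x₃ - ⋯))` in a (multiplicatively written abelian)
definable group. -/
def altSum {k : ℕ} (A : DefGroup S k) : List (Fin k → N) → (Fin k → N)
  | [] => A.one
  | x :: xs => A.mul x (A.inv (altSum A xs))

/-- The `i`-th term (`1 ≤ i ≤ n+1`) in the coboundary formula:
`c(g₁,…,g_i g_{i+1},…,g_{n+1})` for `1 ≤ i ≤ n`, and `c(g₁,…,g_n)` for `i = n+1`. -/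
def cobTerm {mG kA : ℕ} (G : DefGroup S mG) {n : ℕ}
    (c : (Fin n → (Fin mG → N)) → (Fin kA → N))
    (g : Fin (n + 1) → (Fin mG → N)) (i : ℕ) : Fin kA → N :=
  if i ≤ n then
    c (fun j : Fin n =>
      if j.1 + 1 < i then g (Fin.castSucc j)
      else if j.1 + 1 = i then G.mul (g (Fin.castSucc j)) (g j.succ)
      else g j.succ)
  else c (fun j : Fin n => g (Fin.castSucc j))

/-- The coboundary `δb` of the definable `n`-cochain `b`:
`δb(g₁,…,g_{n+1}) = γ(g₁)(b(g₂,…,g_{n+1})) + Σ_{i=1}^{n} (−1)^i b(…,g_i g_{i+1},…)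
+ (−1)^{n+1} b(g₁,…,g_n)` (written multiplicatively in the abelian group `A`). -/
def cob {mG kA : ℕ} {G : DefGroup S mG} {A : DefGroup S kA} (γ : DefModule G A)
    {n : ℕ} (b : (Fin n → (Fin mG → N)) → (Fin kA → N))
    (g : Fin (n + 1) → (Fin mG → N)) : Fin kA → N :=
  A.mul (γ.act (g 0) (b (Fin.tail g)))
    (A.inv (altSum A (List.ofFn fun i : Fin (n + 1) => cobTerm G b g (i.1 + 1))))

/-- There is no definable bijection between `X ⊆ N^m` and `Y ⊆ N^k`. -/
def NoDefBijection (S : Struc N) {m k : ℕ} (X : Set (Fin m → N))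
    (Y : Set (Fin k → N)) : Prop :=
  ¬ ∃ f : (Fin m → N) → (Fin k → N), S.DefFunOn X f ∧ (∀ x ∈ X, f x ∈ Y) ∧
      Set.InjOn f X ∧ f '' X = Y

/-- The subgroup `W` of `U` is definably isomorphic to a (finite) direct product of
copies of the one-dimensional group `(J, op)`. -/
def IsProdOfCopies {m : ℕ} (U : DefGroup S m) (W : Set (Fin m → N)) (J : Set N)
    (op : N → N → N) : Prop :=
  ∃ (d : ℕ) (φ : (Fin m → N) → (Fin d → N)),
    S.DefFunOn W φ ∧ Set.InjOn φ W ∧ φ '' W = {z | ∀ i, z i ∈ J} ∧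
    ∀ x ∈ W, ∀ y ∈ W, φ (U.mul x y) = fun i => op (φ x i) (φ y i)

/-- `V` is the internal direct product of the list `parts` of definable subgroups
of `U`: the parts commute pairwise and every element of `V` is uniquely a product
of elements of the parts. -/
def IsInternalDPList {m : ℕ} (U : DefGroup S m) (V : Set (Fin m → N))
    (parts : List (Set (Fin m → N))) : Prop :=
  (∀ P ∈ parts, U.IsDefSubgroup P) ∧
  List.Pairwise (fun P Q => ∀ x ∈ P, ∀ y ∈ Q, U.mul x y = U.mul y x) parts ∧
  (∀ v, v ∈ V ↔ ∃ f : Fin parts.length → (Fin m → N),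
      (∀ i, f i ∈ parts.get i) ∧ v = U.listProd (List.ofFn f)) ∧
  ∀ f g : Fin parts.length → (Fin m → N),
    (∀ i, f i ∈ parts.get i) → (∀ i, g i ∈ parts.get i) →
    U.listProd (List.ofFn f) = U.listProd (List.ofFn g) → f = g

/-- `K` is a definable subgroup of `U`, equipped with its group structure and with
the submanifold topology inherited from `U`. -/
def IsDefSubgroupGrp {m : ℕ} (U K : DefGroup S m) : Prop :=
  K.carrier ⊆ U.carrier ∧ K.one = U.one ∧
  (∀ x ∈ K.carrier, ∀ y ∈ K.carrier, K.mul x y = U.mul x y) ∧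
  (∀ x ∈ K.carrier, K.inv x = U.inv x) ∧
  ∀ x ∈ K.carrier, @nhdsWithin (Fin m → N) K.top x K.carrier
      = @nhdsWithin (Fin m → N) U.top x K.carrier

/-- The abelian definable group `U` has no definably compact parts: there is a chain
of definable subgroups each of whose successive quotients is a one-dimensional
definably connected torsion-free definable group. -/
def NoCompactParts {m : ℕ} (U : DefGroup S m) : Prop :=
  ∃ (n : ℕ) (ch : Fin (n + 1) → Set (Fin m → N)),
    ch 0 = {U.one} ∧ ch (Fin.last n) = U.carrier ∧
    (∀ j, U.IsDefSubgroup (ch j)) ∧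
    (∀ j : Fin n, ch j.castSucc ⊆ ch j.succ) ∧
    ∀ j : Fin n, ∃ (k : ℕ) (Q : DefGroup S k) (π : (Fin m → N) → (Fin k → N)),
      IsQuotMap U (ch j.succ) (ch j.castSucc) Q π ∧
      odim Q.carrier = 1 ∧ Q.DefinablyConnected ∧ Q.TorsionFree

/-- `H` is the definably connected component of the identity of `G`: the smallest
definable subgroup of finite index. -/
def IsIdentityComponent {m : ℕ} (G : DefGroup S m) (H : Set (Fin m → N)) : Prop :=
  G.IsDefSubgroup H ∧ G.FiniteIndex H ∧
    ∀ H' : Set (Fin m → N), G.IsDefSubgroup H' → G.FiniteIndex H' → H ⊆ H'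

/-- A definable (not necessarily unital or associative) ring: a definable abelian
group together with a definable bi-additive multiplication. -/
structure DefRing (S : Struc N) (m : ℕ) where
  grp : DefGroup S m
  comm : grp.IsAbelian
  rmul : (Fin m → N) → (Fin m → N) → (Fin m → N)
  rmul_mem : ∀ ⦃x y⦄, x ∈ grp.carrier → y ∈ grp.carrier → rmul x y ∈ grp.carrier
  left_distrib' : ∀ ⦃x y z⦄, x ∈ grp.carrier → y ∈ grp.carrier → z ∈ grp.carrier →
      rmul x (grp.mul y z) = grp.mul (rmul x y) (rmul x z)
  right_distrib' : ∀ ⦃x y z⦄, x ∈ grp.carrier → y ∈ grp.carrier → z ∈ grp.carrier →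
      rmul (grp.mul x y) z = grp.mul (rmul x z) (rmul y z)
  rmul_graph_def : S.DefFun2 grp.carrier grp.carrier rmul

/-- `H` is a definable left ideal of the definable ring `R`. -/
def DefRing.IsLeftIdeal {m : ℕ} (R : DefRing S m) (H : Set (Fin m → N)) : Prop :=
  R.grp.IsDefSubgroup H ∧ ∀ u ∈ R.grp.carrier, ∀ h ∈ H, R.rmul u h ∈ H

/-- `π` realizes `Q` as the quotient ring of `R` by the (two-sided) ideal `V`. -/
def IsRingQuotMap {m k : ℕ} (R : DefRing S m) (V : Set (Fin m → N)) (Q : DefRing S k)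
    (π : (Fin m → N) → (Fin k → N)) : Prop :=
  IsQuotMap R.grp R.grp.carrier V Q.grp π ∧
  ∀ x ∈ R.grp.carrier, ∀ y ∈ R.grp.carrier, π (R.rmul x y) = Q.rmul (π x) (π y)

/-- The two-sided annihilator of the definable ring `R`. -/
def ringAnn {m : ℕ} (R : DefRing S m) : Set (Fin m → N) :=
  {v | v ∈ R.grp.carrier ∧
    ∀ w ∈ R.grp.carrier, R.rmul v w = R.grp.one ∧ R.rmul w v = R.grp.one}

/-- Iterated ring product `((a·x₁)·x₂)⋯`. -/
def rFold {m : ℕ} (R : DefRing S m) : (Fin m → N) → List (Fin m → N) → (Fin m → N)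
  | a, [] => a
  | a, x :: xs => rFold R (R.rmul a x) xs

/-- An o-minimal expansion of an ordered group, definable in the ambient structure:
a definable subset `J ⊆ N` with a definable ordered abelian group structure
(the induced structure on `J` being the relevant o-minimal expansion). -/
structure OMinGrpExp (S : Struc N) where
  J : Set N
  Jdef : S.Def 1 {x | x 0 ∈ J}
  add : N → N → N
  zero : N
  neg : N → N
  zero_mem : zero ∈ J
  add_mem : ∀ ⦃a b⦄, a ∈ J → b ∈ J → add a b ∈ J
  neg_mem : ∀ ⦃a⦄, a ∈ J → neg a ∈ J
  add_assoc' : ∀ ⦃a b c⦄, a ∈ J → b ∈ J → c ∈ J → add (add a b) c = add a (add b c)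
  add_comm' : ∀ ⦃a b⦄, a ∈ J → b ∈ J → add a b = add b a
  zero_add' : ∀ ⦃a⦄, a ∈ J → add zero a = a
  neg_add' : ∀ ⦃a⦄, a ∈ J → add (neg a) a = zero
  add_lt' : ∀ ⦃a b c⦄, a ∈ J → b ∈ J → c ∈ J → b < c → add a b < add a c
  add_graph_def : S.Def 3 {z | z 0 ∈ J ∧ z 1 ∈ J ∧ add (z 0) (z 1) = z 2}

namespace OMinGrpExp
variable {S : Struc N} (E : OMinGrpExp S)

/-- A subset of `J^k` bounded in `J`. -/
def BoundedSet {k : ℕ} (B : Set (Fin k → N)) : Prop :=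
  ∃ lo ∈ E.J, ∃ hi ∈ E.J, ∀ x ∈ B, ∀ i, lo ≤ x i ∧ x i ≤ hi

/-- The induced structure on `J` is semi-bounded: every definable subset of `J^k`
belongs to every family of sets (closed under the first-order operations relative
to `J`) containing the ordered group structure, all bounded definable sets, and
all definable endomorphisms of `(J, 0, +)`. -/
def SemiBounded : Prop :=
  ∀ (D : ∀ k : ℕ, Set (Fin k → N) → Prop),
    (∀ {k : ℕ} {A B : Set (Fin k → N)}, D k A → D k B → D k (A ∩ B)) →
    (∀ {k : ℕ} {A : Set (Fin k → N)}, D k A → D k ({x | ∀ i, x i ∈ E.J} \ A)) →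
    (∀ k : ℕ, D k {x | ∀ i, x i ∈ E.J}) →
    (∀ {k l : ℕ} (g : Fin k → Fin l) {A : Set (Fin k → N)}, D k A →
        D l {x | (∀ i, x i ∈ E.J) ∧ x ∘ g ∈ A}) →
    (∀ {k : ℕ} {A : Set (Fin (k + 1) → N)}, D (k + 1) A →
        D k {x | (∀ i, x i ∈ E.J) ∧ ∃ t ∈ E.J, Fin.snoc x t ∈ A}) →
    (D 2 {x | (∀ i, x i ∈ E.J) ∧ x 0 < x 1}) →
    (∀ a ∈ E.J, D 1 {x | x 0 = a}) →
    (D 3 {z | (∀ i, z i ∈ E.J) ∧ E.add (z 0) (z 1) = z 2}) →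
    (∀ {k : ℕ} {B : Set (Fin k → N)}, S.Def k B → (∀ x ∈ B, ∀ i, x i ∈ E.J) →
        E.BoundedSet B → D k B) →
    (∀ f : N → N, S.DefFun1 E.J f → (∀ a ∈ E.J, f a ∈ E.J) →
        (∀ ⦃a b⦄, a ∈ E.J → b ∈ E.J → f (E.add a b) = E.add (f a) (f b)) →
        D 2 {z | z 0 ∈ E.J ∧ z 1 ∈ E.J ∧ f (z 0) = z 1}) →
    ∀ {k : ℕ} {A : Set (Fin k → N)}, S.Def k A → (∀ x ∈ A, ∀ i, x i ∈ E.J) → D k A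

end OMinGrpExp

/-- An o-minimal expansion of a real closed field, definable in the ambient
structure: a definable subset `J ⊆ N` with a definable real closed ordered field
structure. -/
structure OMinFieldExp (S : Struc N) where
  J : Set N
  Jdef : S.Def 1 {x | x 0 ∈ J}
  add : N → N → N
  mul : N → N → N
  zero : N
  one : N
  neg : N → N
  inv : N → N
  zero_mem : zero ∈ J
  one_mem : one ∈ J
  zero_ne_one : zero ≠ one
  add_mem : ∀ ⦃a b⦄, a ∈ J → b ∈ J → add a b ∈ J
  mul_mem : ∀ ⦃a b⦄, a ∈ J → b ∈ J → mul a b ∈ J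
  neg_mem : ∀ ⦃a⦄, a ∈ J → neg a ∈ J
  inv_mem : ∀ ⦃a⦄, a ∈ J → inv a ∈ J
  add_assoc' : ∀ ⦃a b c⦄, a ∈ J → b ∈ J → c ∈ J → add (add a b) c = add a (add b c)
  add_comm' : ∀ ⦃a b⦄, a ∈ J → b ∈ J → add a b = add b a
  zero_add' : ∀ ⦃a⦄, a ∈ J → add zero a = a
  neg_add' : ∀ ⦃a⦄, a ∈ J → add (neg a) a = zero
  mul_assoc' : ∀ ⦃a b c⦄, a ∈ J → b ∈ J → c ∈ J → mul (mul a b) c = mul a (mul b c)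
  mul_comm' : ∀ ⦃a b⦄, a ∈ J → b ∈ J → mul a b = mul b a
  one_mul' : ∀ ⦃a⦄, a ∈ J → mul one a = a
  mul_inv' : ∀ ⦃a⦄, a ∈ J → a ≠ zero → mul (inv a) a = one
  distrib' : ∀ ⦃a b c⦄, a ∈ J → b ∈ J → c ∈ J →
      mul a (add b c) = add (mul a b) (mul a c)
  add_lt' : ∀ ⦃a b c⦄, a ∈ J → b ∈ J → c ∈ J → b < c → add a b < add a c
  mul_pos' : ∀ ⦃a b⦄, a ∈ J → b ∈ J → zero < a → zero < b → zero < mul a b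
  sq_root : ∀ ⦃a⦄, a ∈ J → zero ≤ a → ∃ b ∈ J, mul b b = a
  odd_root : ∀ n : ℕ, Odd n → ∀ c : Fin (n + 1) → N, (∀ i, c i ∈ J) →
      c (Fin.last n) ≠ zero → ∃ x ∈ J, polyEval add mul zero c x = zero
  add_graph_def : S.Def 3 {z | z 0 ∈ J ∧ z 1 ∈ J ∧ add (z 0) (z 1) = z 2}
  mul_graph_def : S.Def 3 {z | z 0 ∈ J ∧ z 1 ∈ J ∧ mul (z 0) (z 1) = z 2}

/-- The linearly bounded one-dimensional torsion-free definable group of an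
o-minimal expansion of a real closed field: a definable ordered torsion-free group
structure on `J` with respect to which the induced structure is linearly bounded. -/
structure LinBddGrp {S : Struc N} (E : OMinFieldExp S) where
  op : N → N → N
  z : N
  opneg : N → N
  z_mem : z ∈ E.J
  op_mem : ∀ ⦃a b⦄, a ∈ E.J → b ∈ E.J → op a b ∈ E.J
  opneg_mem : ∀ ⦃a⦄, a ∈ E.J → opneg a ∈ E.J
  op_assoc : ∀ ⦃a b c⦄, a ∈ E.J → b ∈ E.J → c ∈ E.J → op (op a b) c = op a (op b c)
  op_comm : ∀ ⦃a b⦄, a ∈ E.J → b ∈ E.J → op a b = op b a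
  z_op : ∀ ⦃a⦄, a ∈ E.J → op z a = a
  opneg_op : ∀ ⦃a⦄, a ∈ E.J → op (opneg a) a = z
  op_lt : ∀ ⦃a b c⦄, a ∈ E.J → b ∈ E.J → c ∈ E.J → b < c → op a b < op a c
  op_graph_def : S.Def 3 {w | w 0 ∈ E.J ∧ w 1 ∈ E.J ∧ op (w 0) (w 1) = w 2}
  torsion_free : ∀ a ∈ E.J, a ≠ z → ∀ n : ℕ, 0 < n → opPow op z a n ≠ z
  lin_bdd : ∀ f : N → N, S.DefFun1 E.J f → (∀ a ∈ E.J, f a ∈ E.J) →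
      ∃ r : N → N, S.DefFun1 E.J r ∧ (∀ a ∈ E.J, r a ∈ E.J) ∧
        (∀ ⦃a b⦄, a ∈ E.J → b ∈ E.J → r (op a b) = op (r a) (r b)) ∧
        ∃ cst ∈ E.J, Filter.Tendsto (fun x => op (f x) (opneg (r x)))
            (rightEndFilter E.J) (nhds cst)

/-- Multiplication of `n × n` matrices with entries in the definable field `E`. -/
def matMul {S : Struc N} (E : OMinFieldExp S) (n : ℕ) (x y : Fin (n * n) → N) :
    Fin (n * n) → N :=
  fun p =>
    (List.ofFn (fun l : Fin n =>
        E.mul (x (finIdx (pFst p) l)) (y (finIdx l (pSnd p))))).foldr E.add E.zero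

/-- The identity `n × n` matrix with entries in the definable field `E`. -/
def matId {S : Struc N} (E : OMinFieldExp S) (n : ℕ) : Fin (n * n) → N :=
  fun p => if pFst p = pSnd p then E.one else E.zero

/-- The three kinds of division algebras over a real closed field. -/
inductive DivKind : Type
  | real : DivKind
  | cplx : DivKind
  | quat : DivKind

@[reducible] def dkDim : DivKind → ℕ
  | .real => 1
  | .cplx => 2
  | .quat => 4

/-- Multiplication in the division algebra of kind `d` (the field itself, the field
with `√-1` adjoined, or the quaternions), with coordinates in the definable field
`E`. -/
def dkMul {S : Struc N} (E : OMinFieldExp S) :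
    (d : DivKind) → (Fin (dkDim d) → N) → (Fin (dkDim d) → N) → (Fin (dkDim d) → N)
  | .real => fun x y _ => E.mul (x 0) (y 0)
  | .cplx => fun x y i =>
      if i.1 = 0 then E.add (E.mul (x 0) (y 0)) (E.neg (E.mul (x 1) (y 1)))
      else E.add (E.mul (x 0) (y 1)) (E.mul (x 1) (y 0))
  | .quat => fun x y i =>
      if i.1 = 0 then
        E.add (E.mul (x 0) (y 0)) (E.neg (E.add (E.mul (x 1) (y 1))
          (E.add (E.mul (x 2) (y 2)) (E.mul (x 3) (y 3)))))
      else if i.1 = 1 then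
        E.add (E.mul (x 0) (y 1)) (E.add (E.mul (x 1) (y 0))
          (E.add (E.mul (x 2) (y 3)) (E.neg (E.mul (x 3) (y 2)))))
      else if i.1 = 2 then
        E.add (E.mul (x 0) (y 2)) (E.add (E.neg (E.mul (x 1) (y 3)))
          (E.add (E.mul (x 2) (y 0)) (E.mul (x 3) (y 1))))
      else
        E.add (E.mul (x 0) (y 3)) (E.add (E.mul (x 1) (y 2))
          (E.add (E.neg (E.mul (x 2) (y 1))) (E.mul (x 3) (y 0))))

/-- Multiplication in the matrix algebra `M_k(D)` where `D` is the division algebra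
of kind `d` over the definable field `E`; elements are encoded as tuples in
`N^(k·k·dim D)`. -/
def matAlgMul {S : Struc N} (E : OMinFieldExp S) (d : DivKind) (k : ℕ)
    (x y : Fin (k * k * dkDim d) → N) : Fin (k * k * dkDim d) → N :=
  fun p =>
    ((List.ofFn (fun l : Fin k =>
        dkMul E d (fun cc => x (finIdx (finIdx (pFst (pFst p)) l) cc))
          (fun cc => y (finIdx (finIdx l (pSnd (pFst p))) cc)))).foldr
      (fun v w i => E.add (v i) (w i)) (fun _ => E.zero)) (pSnd p)

/-- `(F, +, ·, 0, 1, −, ⁻¹, <)` is a real closed ordered field structure on the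
subset `F ⊆ N^k`. -/
def IsRCFOn {k : ℕ} (F : Set (Fin k → N))
    (fadd fmul : (Fin k → N) → (Fin k → N) → (Fin k → N)) (fzero fone : Fin k → N)
    (fneg finv : (Fin k → N) → (Fin k → N))
    (flt : (Fin k → N) → (Fin k → N) → Prop) : Prop :=
  fzero ∈ F ∧ fone ∈ F ∧ fzero ≠ fone ∧
  (∀ x ∈ F, ∀ y ∈ F, fadd x y ∈ F ∧ fmul x y ∈ F) ∧
  (∀ x ∈ F, fneg x ∈ F ∧ finv x ∈ F) ∧
  (∀ x ∈ F, ∀ y ∈ F, ∀ z ∈ F, fadd (fadd x y) z = fadd x (fadd y z)) ∧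
  (∀ x ∈ F, ∀ y ∈ F, fadd x y = fadd y x) ∧
  (∀ x ∈ F, fadd fzero x = x) ∧
  (∀ x ∈ F, fadd (fneg x) x = fzero) ∧
  (∀ x ∈ F, ∀ y ∈ F, ∀ z ∈ F, fmul (fmul x y) z = fmul x (fmul y z)) ∧
  (∀ x ∈ F, ∀ y ∈ F, fmul x y = fmul y x) ∧
  (∀ x ∈ F, fmul fone x = x) ∧
  (∀ x ∈ F, x ≠ fzero → fmul (finv x) x = fone) ∧
  (∀ x ∈ F, ∀ y ∈ F, ∀ z ∈ F, fmul x (fadd y z) = fadd (fmul x y) (fmul x z)) ∧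
  (∀ x ∈ F, ∀ y ∈ F, flt x y ∨ x = y ∨ flt y x) ∧
  (∀ x ∈ F, ¬ flt x x) ∧
  (∀ x ∈ F, ∀ y ∈ F, ∀ z ∈ F, flt x y → flt y z → flt x z) ∧
  (∀ x ∈ F, ∀ y ∈ F, ∀ z ∈ F, flt y z → flt (fadd x y) (fadd x z)) ∧
  (∀ x ∈ F, ∀ y ∈ F, flt fzero x → flt fzero y → flt fzero (fmul x y)) ∧
  (∀ x ∈ F, (flt fzero x ∨ x = fzero) → ∃ y ∈ F, fmul y y = x) ∧
  (∀ n : ℕ, Odd n → ∀ c : Fin (n + 1) → (Fin k → N), (∀ i, c i ∈ F) →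
      c (Fin.last n) ≠ fzero → ∃ x ∈ F, polyEval fadd fmul fzero c x = fzero)

end Groups

end OMinPreamble

section Orthogonality

open Filter Set Topology
open scoped Pointwise

universe v w

set_option linter.unusedSectionVars false

section Framework

variable {N : Type u} [LinearOrder N]

namespace Struc
variable (S : Struc N)

/-- Definability of a predicate on `N^ι` for an arbitrary finite index type. -/
def Df {ι : Type} (P : (ι → N) → Prop) : Prop :=
  ∃ (n : ℕ) (e : ι ≃ Fin n), S.Def n {x | P (x ∘ e)}

variable {S} {ι κ : Type}

theorem Df.reindex [Finite κ] (g : ι → κ) {P : (ι → N) → Prop} (h : S.Df P) :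
    S.Df (fun x : κ → N => P (x ∘ g)) := by
  obtain ⟨n, e, h⟩ := h
  obtain ⟨m, ⟨e'⟩⟩ := Finite.exists_equiv_fin κ
  refine ⟨m, e', ?_⟩
  have := S.def_reindex (fun i => e' (g (e.symm i))) h
  convert this using 3
  simp only [mem_ofPred_eq]
  congr! 1
  funext i
  simp

theorem Df.and [Finite ι] {P Q : (ι → N) → Prop} (h : S.Df P) (h' : S.Df Q) :
    S.Df (fun x => P x ∧ Q x) := by
  obtain ⟨n, e, h⟩ := h
  obtain ⟨n', e', h'⟩ := h'
  obtain rfl : n = n' := by simpa using Fintype.card_congr (e.symm.trans e')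
  refine ⟨n, e, ?_⟩
  have := S.def_inter h (S.def_reindex (e ∘ e'.symm) h')
  convert this using 1
  ext x
  simp [Function.comp_assoc]

theorem Df.not {P : (ι → N) → Prop} (h : S.Df P) : S.Df (fun x => ¬ P x) := by
  obtain ⟨n, e, h⟩ := h
  exact ⟨n, e, S.def_compl h⟩

theorem Df.or [Finite ι] {P Q : (ι → N) → Prop} (h : S.Df P) (h' : S.Df Q) :
    S.Df (fun x => P x ∨ Q x) := by
  have := (h.not.and h'.not).not
  convert this using 2 with x
  tauto

variable (S) in
theorem Df.const [Finite ι] (p : Prop) : S.Df (fun _ : ι → N => p) := by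
  obtain ⟨n, ⟨e⟩⟩ := Finite.exists_equiv_fin ι
  by_cases hp : p
  · exact ⟨n, e, by simpa [hp] using S.def_univ n⟩
  · exact ⟨n, e, by simpa [hp] using S.def_compl (S.def_univ n)⟩

variable (S) in
theorem Df.lt [Finite ι] (i j : ι) : S.Df (fun x : ι → N => x i < x j) :=
  Df.reindex (P := fun x : Fin 2 → N => x 0 < x 1) ![i, j] ⟨2, Equiv.refl _, S.def_lt⟩

variable (S) in
theorem Df.eq_const [Finite ι] (i : ι) (a : N) : S.Df (fun x : ι → N => x i = a) :=
  Df.reindex (P := fun x : Fin 1 → N => x 0 = a) ![i] ⟨1, Equiv.refl _, S.def_pt a⟩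

variable (S) in
theorem Df.eq [Finite ι] (i j : ι) : S.Df (fun x : ι → N => x i = x j) := by
  have := ((Df.lt S i j).or (Df.lt S j i)).not
  convert this using 2 with x
  simp [le_antisymm_iff]

theorem Df.finite_all [Finite ι] {α : Type*} [Finite α] {P : α → (ι → N) → Prop}
    (h : ∀ a, S.Df (P a)) : S.Df (fun x => ∀ a, P a x) := by
  have : ∀ s : Finset α, S.Df (fun x => ∀ a ∈ s, P a x) := by
    classical
    intro s
    induction s using Finset.induction_on with
    | empty => simpa using Df.const S True
    | insert a s _ ih => simpa using (h a).and ih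
  have h1 := Fintype.ofFinite α
  simpa using this Finset.univ

theorem Df.ex [Finite ι] {P : (Option ι → N) → Prop} (h : S.Df P) :
    S.Df (fun x : ι → N => ∃ t, P (fun o => o.elim t x)) := by
  obtain ⟨n, ⟨e⟩⟩ := Finite.exists_equiv_fin ι
  obtain ⟨m, e', h⟩ := h
  have hm : m = n + 1 := by
    have := Fintype.ofFinite ι
    have h1 := Fintype.card_congr e
    have h2 := Fintype.card_congr e'
    simp at h1 h2
    omega
  subst hm
  refine ⟨n, e, ?_⟩
  let g : Fin (n+1) → Fin (n+1) := fun k => (e'.symm k).elim (Fin.last n) (fun i => (e i).castSucc)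
  have := S.def_proj (S.def_reindex g h)
  convert this using 5 with x t
  refine iff_of_eq (congrArg P ?_)
  funext o
  cases o <;> simp [g]

theorem Df.ex_pi [Finite ι] [hκ : Finite κ] {P : (ι ⊕ κ → N) → Prop} (h : S.Df P) :
    S.Df (fun x : ι → N => ∃ y : κ → N, P (Sum.elim x y)) := by
  revert P
  have key : ∀ (n : ℕ) (P : (ι ⊕ Fin n → N) → Prop), S.Df P →
      S.Df (fun x : ι → N => ∃ y : Fin n → N, P (Sum.elim x y)) := by
    intro n
    induction n with
    | zero =>
      intro P h
      have := h.reindex (κ := ι) (Sum.elim id (fun i => i.elim0))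
      convert this using 2 with x
      constructor
      · rintro ⟨y, hy⟩
        convert hy using 1
        funext z
        rcases z with z | z
        · rfl
        · exact z.elim0
      · intro hy
        refine ⟨fun i => i.elim0, ?_⟩
        convert hy using 1
        funext z
        rcases z with z | z
        · rfl
        · exact z.elim0
    | succ n ih =>
      intro P h
      let g : ι ⊕ Fin (n+1) → Option (ι ⊕ Fin n) :=
        Sum.elim (fun i => some (.inl i)) (Fin.lastCases none (fun i => some (.inr i)))
      have := ih _ (Df.ex (h.reindex g))
      convert this using 2 with x
      have e : ∀ (y : Fin n → N) (t : N),
          (fun o : Option (ι ⊕ Fin n) => o.elim t (Sum.elim x y)) ∘ g =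
            Sum.elim x (Fin.snoc y t) := by
        intro y t
        funext z
        rcases z with z | z
        · rfl
        · refine Fin.lastCases ?_ (fun i => ?_) z <;> simp [g]
      simp only [e]
      constructor
      · rintro ⟨y, hy⟩
        exact ⟨Fin.init y, y (Fin.last n), by simpa using hy⟩
      · rintro ⟨y, t, hy⟩
        exact ⟨_, hy⟩
  intro P h
  obtain ⟨n, ⟨e⟩⟩ := Finite.exists_equiv_fin κ
  have := key n _ (h.reindex (Sum.map id e))
  convert this using 2 with x
  constructor
  · rintro ⟨y, hy⟩
    refine ⟨y ∘ e.symm, ?_⟩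
    convert hy using 1
    funext z
    rcases z with z | z <;> simp
  · rintro ⟨y, hy⟩
    refine ⟨y ∘ e, ?_⟩
    convert hy using 1
    funext z
    rcases z with z | z <;> simp

variable (S) in
/-- Definability of a map `N^ι → N`. -/
def DfFun (c : (ι → N) → N) : Prop := S.Df (fun x : Option ι → N => c (x ∘ some) = x none)

theorem Df.subst [Finite ι] [Finite κ] {P : (ι → N) → Prop} (h : S.Df P)
    {g : (κ → N) → ι → N} (hg : ∀ i, S.DfFun (fun x => g x i)) : S.Df (fun x => P (g x)) := by
  have h1 : S.Df (fun z : κ ⊕ ι → N => (∀ i, g (z ∘ Sum.inl) i = z (Sum.inr i)) ∧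
      P (z ∘ Sum.inr)) := by
    refine Df.and (Df.finite_all fun i => ?_) (h.reindex _)
    exact (hg i).reindex (fun o : Option κ => o.elim (Sum.inr i) Sum.inl)
  have := h1.ex_pi
  convert this using 2 with x
  constructor
  · intro hx
    exact ⟨g x, fun i => rfl, hx⟩
  · rintro ⟨y, hy, hP⟩
    have : g x = y := funext hy
    exact this ▸ hP

variable (S) in
theorem DfFun.proj [Finite ι] (i : ι) : S.DfFun (fun x : ι → N => x i) :=
  Df.eq S (some i) none

variable (S) in
theorem DfFun.const [Finite ι] (a : N) : S.DfFun (fun _ : ι → N => a) := by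
  have := Df.eq_const S (none : Option ι) a
  simpa [DfFun, eq_comm] using this

theorem DfFun.subst [Finite ι] [Finite κ] {c : (ι → N) → N} (h : S.DfFun c)
    {g : (κ → N) → ι → N} (hg : ∀ i, S.DfFun (fun x => g x i)) : S.DfFun (fun x => c (g x)) := by
  refine Df.subst (κ := Option κ) h (g := fun x o => o.elim (x none) (fun i => g (x ∘ some) i)) ?_
  rintro (_ | i)
  · exact DfFun.proj S _
  · exact (hg i).reindex (fun o : Option κ => o.elim none (fun k => some (some k)))

end Struc

/-- A space with a notion of definable maps from powers of `N`. -/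
class DSpace (S : Struc N) (X : Type v) where
  plot : ∀ {ι : Type} [Finite ι], ((ι → N) → X) → Prop
  plot_comp : ∀ {ι κ : Type} [Finite ι] [Finite κ] {c : (ι → N) → X} {g : (κ → N) → ι → N},
    plot c → (∀ i, S.DfFun (fun x => g x i)) → plot (fun x => c (g x))
  plot_const : ∀ {ι : Type} [Finite ι] (a : X), plot (fun _ : ι → N => a)

/-- Definable maps between spaces. -/
@[fun_prop]
structure DFn (S : Struc N) {X : Type v} {Y : Type w} [DSpace S X] [DSpace S Y] (f : X → Y) :
    Prop where
  plot : ∀ {ι : Type} [Finite ι] (c : (ι → N) → X), DSpace.plot S c →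
    DSpace.plot S (fun x => f (c x))

variable {S : Struc N}

instance DSpace.instBase : DSpace S N where
  plot c := S.DfFun c
  plot_comp h hg := h.subst hg
  plot_const a := Struc.DfFun.const S a

instance DSpace.instProp : DSpace S Prop where
  plot c := S.Df c
  plot_comp h hg := h.subst hg
  plot_const a := Struc.Df.const S a

instance DSpace.instProd {X : Type v} {Y : Type w} [DSpace S X] [DSpace S Y] :
    DSpace S (X × Y) where
  plot c := DSpace.plot S (fun x => (c x).1) ∧ DSpace.plot S (fun x => (c x).2)
  plot_comp h hg := ⟨DSpace.plot_comp h.1 hg, DSpace.plot_comp h.2 hg⟩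
  plot_const a := ⟨DSpace.plot_const a.1, DSpace.plot_const a.2⟩

instance DSpace.instPi {α : Type w} {X : α → Type v} [∀ a, DSpace S (X a)] : DSpace S (∀ a, X a) where
  plot c := ∀ a, DSpace.plot S (fun x => c x a)
  plot_comp h hg a := DSpace.plot_comp (h a) hg
  plot_const f a := DSpace.plot_const (f a)

instance DSpace.instSubtype {X : Type v} [DSpace S X] {p : X → Prop} :
    DSpace S {x : X // p x} where
  plot c := DSpace.plot S (fun x => (c x).1)
  plot_comp h hg := DSpace.plot_comp (c := fun _ => Subtype.val _) h hg
  plot_const a := DSpace.plot_const a.1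

namespace DFn
variable {X : Type*} {Y : Type*} {Z : Type*} [DSpace S X] [DSpace S Y] [DSpace S Z]

@[fun_prop]
theorem id : DFn S (fun x : X => x) := ⟨fun _ h => h⟩

@[fun_prop]
theorem const (y : Y) : DFn S (fun _ : X => y) := ⟨fun _ _ => DSpace.plot_const y⟩

@[fun_prop]
theorem comp {g : Y → Z} {f : X → Y} (hg : DFn S g) (hf : DFn S f) : DFn S (fun x => g (f x)) :=
  ⟨fun c h => hg.plot _ (hf.plot c h)⟩

@[fun_prop]
theorem prodMk {f : X → Y} {g : X → Z} (hf : DFn S f) (hg : DFn S g) :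
    DFn S (fun x => (f x, g x)) := ⟨fun c h => ⟨hf.plot c h, hg.plot c h⟩⟩

@[fun_prop]
theorem fst {f : X → Y × Z} (hf : DFn S f) : DFn S (fun x => (f x).1) := ⟨fun c h => (hf.plot c h).1⟩

@[fun_prop]
theorem snd {f : X → Y × Z} (hf : DFn S f) : DFn S (fun x => (f x).2) := ⟨fun c h => (hf.plot c h).2⟩

@[fun_prop]
theorem val {p : Y → Prop} {f : X → {y // p y}} (hf : DFn S f) : DFn S (fun x => (f x).1) :=
  ⟨fun c h => hf.plot c h⟩

theorem subtypeMk {p : Y → Prop} {f : X → Y} (hf : DFn S f) (h : ∀ x, p (f x)) :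
    DFn S (fun x => (⟨f x, h x⟩ : {y // p y})) := ⟨fun c h => hf.plot c h⟩

@[fun_prop]
theorem apply {α : Type*} {W : α → Type*} [∀ a, DSpace S (W a)] (a : α) :
    DFn S (fun x : ∀ a, W a => x a) := ⟨fun _ h => h a⟩

@[fun_prop]
theorem pi {α : Type*} {W : α → Type*} [∀ a, DSpace S (W a)] {f : X → ∀ a, W a}
    (h : ∀ a, DFn S (fun x => f x a)) : DFn S (fun x a => f x a) := ⟨fun c hc a => (h a).plot c hc⟩

variable {P Q : X → Prop}

@[fun_prop]
theorem and (hP : DFn S P) (hQ : DFn S Q) : DFn S (fun x => P x ∧ Q x) :=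
  ⟨fun c h => Struc.Df.and (hP.plot c h) (hQ.plot c h)⟩

@[fun_prop]
theorem or (hP : DFn S P) (hQ : DFn S Q) : DFn S (fun x => P x ∨ Q x) :=
  ⟨fun c h => Struc.Df.or (hP.plot c h) (hQ.plot c h)⟩

@[fun_prop]
theorem not (hP : DFn S P) : DFn S (fun x => ¬ P x) :=
  ⟨fun c h => Struc.Df.not (hP.plot c h)⟩

theorem congr (hP : DFn S P) (h : ∀ x, Q x ↔ P x) : DFn S Q := by
  rwa [show Q = P from funext fun x => propext (h x)]

@[fun_prop]
theorem imp (hP : DFn S P) (hQ : DFn S Q) : DFn S (fun x => P x → Q x) :=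
  (hP.not.or hQ).congr fun x => by tauto

@[fun_prop]
theorem iff (hP : DFn S P) (hQ : DFn S Q) : DFn S (fun x => P x ↔ Q x) :=
  ((hP.imp hQ).and (hQ.imp hP)).congr fun x => by tauto

end DFn


theorem DSpace.plot_iff {ι : Type} [Finite ι] {X : Type*} [DSpace S X] {c : (ι → N) → X} :
    DSpace.plot S c ↔ DFn S c :=
  ⟨fun h => ⟨fun _ hg => DSpace.plot_comp h hg⟩,
    fun h => h.plot _ (fun i => Struc.DfFun.proj S i)⟩

/-- Spaces definably isomorphic to (nonempty) definable subsets of some `N^ι`. -/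
class DSet (S : Struc N) (X : Type v) [DSpace S X] : Prop where
  code : ∃ (ι : Type) (_ : Finite ι) (v : X → ι → N) (ρ : (ι → N) → X),
    DFn S v ∧ DFn S ρ ∧ ∀ x, ρ (v x) = x

section Closure
variable {X : Type*} {Y : Type*} {Z : Type*} [DSpace S X] [DSpace S Y] [DSpace S Z]

namespace DFn

theorem finite_all {α : Type*} [Finite α] {P : α → X → Prop} (h : ∀ a, DFn S (P a)) :
    DFn S (fun x => ∀ a, P a x) :=
  ⟨fun c hc => Struc.Df.finite_all fun a => (h a).plot c hc⟩

theorem ex_pi {ι : Type} [Finite ι] {P : X → (ι → N) → Prop}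
    (h : DFn S (fun p : X × (ι → N) => P p.1 p.2)) : DFn S (fun x => ∃ y, P x y) := by
  refine ⟨fun {κ} _ c hc => ?_⟩
  have := h.plot (fun z : κ ⊕ ι → N => (c (z ∘ Sum.inl), z ∘ Sum.inr))
    ⟨DSpace.plot_comp hc (fun i => Struc.DfFun.proj S _), fun i => Struc.DfFun.proj S _⟩
  exact Struc.Df.ex_pi this

@[fun_prop]
theorem ex [DSet S Y] {P : X → Y → Prop} (h : DFn S (fun p : X × Y => P p.1 p.2)) :
    DFn S (fun x => ∃ y, P x y) := by
  obtain ⟨ι, _, v, ρ, hv, hρ, e⟩ := DSet.code (S := S) (X := Y)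
  refine (ex_pi (P := fun x w => P x (ρ w))
    (h.comp (f := fun p : X × (ι → N) => (p.1, ρ p.2)) (by fun_prop))).congr fun x => ?_
  exact ⟨fun ⟨y, hy⟩ => ⟨v y, by rwa [e]⟩, fun ⟨w, hw⟩ => ⟨_, hw⟩⟩

@[fun_prop]
theorem all [DSet S Y] {P : X → Y → Prop} (h : DFn S (fun p : X × Y => P p.1 p.2)) :
    DFn S (fun x => ∀ y, P x y) :=
  (ex (P := fun x y => ¬ P x y) h.not).not.congr fun x => by simp

theorem eqN {f g : X → N} (hf : DFn S f) (hg : DFn S g) : DFn S (fun x => f x = g x) := by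
  refine ⟨fun {κ} _ c hc => ?_⟩
  exact Struc.Df.subst (Struc.Df.eq S (0 : Fin 2) 1) (g := fun z => ![f (c z), g (c z)])
    (fun i => by
      fin_cases i
      · exact hf.plot c hc
      · exact hg.plot c hc)

@[fun_prop]
theorem eq [DSet S Y] {f g : X → Y} (hf : DFn S f) (hg : DFn S g) :
    DFn S (fun x => f x = g x) := by
  obtain ⟨ι, _, v, ρ, hv, hρ, e⟩ := DSet.code (S := S) (X := Y)
  refine (finite_all (P := fun i x => v (f x) i = v (g x) i)
    fun i => eqN (by fun_prop) (by fun_prop)).congr fun x => ?_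
  rw [← funext_iff]
  exact ⟨fun h => by rw [h], fun h => by rw [← e (f x), h, e]⟩

theorem ltN {f g : X → N} (hf : DFn S f) (hg : DFn S g) : DFn S (fun x => f x < g x) := by
  refine ⟨fun {κ} _ c hc => ?_⟩
  exact Struc.Df.subst (Struc.Df.lt S (0 : Fin 2) 1) (g := fun z => ![f (c z), g (c z)])
    (fun i => by
      fin_cases i
      · exact hf.plot c hc
      · exact hg.plot c hc)

theorem of_graphN {f : X → N} (h : DFn S (fun p : X × N => f p.1 = p.2)) : DFn S f := by
  refine ⟨fun {κ} _ c hc => ?_⟩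
  exact h.plot (fun z : Option κ → N => (c (z ∘ some), z none))
    ⟨DSpace.plot_comp hc (fun i => Struc.DfFun.proj S _), Struc.DfFun.proj S _⟩

theorem of_graph [DSet S Y] {f : X → Y} (h : DFn S (fun p : X × Y => f p.1 = p.2)) :
    DFn S f := by
  obtain ⟨ι, _, v, ρ, hv, hρ, e⟩ := DSet.code (S := S) (X := Y)
  have key : DFn S (fun x => v (f x)) := by
    refine pi fun i => of_graphN ?_
    have h' : DFn S (fun q : (X × N) × Y => f q.1.1 = q.2) :=
      h.comp (f := fun q : (X × N) × Y => (q.1.1, q.2)) (by fun_prop)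
    have h2 : DFn S (fun q : (X × N) × Y => v q.2 i = q.1.2) := eqN (by fun_prop) (by fun_prop)
    refine (ex (P := fun (p : X × N) y => f p.1 = y ∧ v y i = p.2) (h'.and h2)).congr fun p => ?_
    simp
  have := hρ.comp key
  simpa only [e] using this

theorem of_graph_rel [DSet S Y] {f : X → Y} {R : X → Y → Prop}
    (h : DFn S (fun p : X × Y => R p.1 p.2)) (hR : ∀ x y, f x = y ↔ R x y) : DFn S f :=
  of_graph (h.congr fun _ => hR _ _)

/-- Definable choice of a unique witness. -/
theorem exists_unique_choice [DSet S Y] {R : X → Y → Prop}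
    (h : DFn S (fun p : X × Y => R p.1 p.2)) (hu : ∀ x, ∃! y, R x y) :
    ∃ f : X → Y, DFn S f ∧ ∀ x, R x (f x) := by
  choose f hf using fun x => (hu x).exists
  exact ⟨f, of_graph_rel h fun x y => ⟨fun e => e ▸ hf x, fun hy => (hu x).unique (hf x) hy⟩, hf⟩

theorem ite [DSet S Y] {P : X → Prop} [DecidablePred P] {f g : X → Y} (hP : DFn S P)
    (hf : DFn S f) (hg : DFn S g) : DFn S (fun x => if P x then f x else g x) := by
  refine of_graph_rel (R := fun x y => (P x → f x = y) ∧ (¬ P x → g x = y)) (by fun_prop) ?_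
  intro x y
  by_cases h : P x <;> simp [h]

end DFn

instance DSet.instBase [Nonempty N] : DSet S N :=
  ⟨⟨Unit, inferInstance, fun x _ => x, fun z => z (), by fun_prop, by fun_prop, fun _ => rfl⟩⟩

instance DSet.instProd [DSet S X] [DSet S Y] : DSet S (X × Y) := by
  obtain ⟨ι, _, v, ρ, hv, hρ, e⟩ := DSet.code (S := S) (X := X)
  obtain ⟨ι', _, v', ρ', hv', hρ', e'⟩ := DSet.code (S := S) (X := Y)
  refine ⟨⟨ι ⊕ ι', inferInstance, fun p => Sum.elim (v p.1) (v' p.2),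
    fun z => (ρ (fun i => z (.inl i)), ρ' (fun i => z (.inr i))), ?_, ?_, ?_⟩⟩
  · refine DFn.pi ?_
    rintro (i | i)
    · show DFn S (fun x : X × Y => v x.1 i)
      fun_prop
    · show DFn S (fun x : X × Y => v' x.2 i)
      fun_prop
  · fun_prop
  · rintro ⟨x, y⟩
    simp [e, e']

instance DSet.instPi {α : Type} [Finite α] [DSet S X] : DSet S (α → X) := by
  obtain ⟨ι, _, v, ρ, hv, hρ, e⟩ := DSet.code (S := S) (X := X)
  refine ⟨⟨α × ι, inferInstance, fun p i => v (p i.1) i.2, fun z a => ρ (fun i => z (a, i)),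
    ?_, ?_, ?_⟩⟩
  · fun_prop
  · fun_prop
  · intro x
    simp [e]

theorem DSet.subtype [DSet S X] {p : X → Prop} (hp : DFn S p) (x₀ : {x // p x}) :
    DSet S {x // p x} := by
  classical
  obtain ⟨ι, _, v, ρ, hv, hρ, e⟩ := DSet.code (S := S) (X := X)
  refine ⟨⟨ι, inferInstance, fun x => v x.1,
    fun z => ⟨if p (ρ z) then ρ z else x₀.1, ?_⟩, by fun_prop, ?_, ?_⟩⟩
  · split_ifs with h
    exacts [h, x₀.2]
  · exact DFn.subtypeMk (DFn.ite (by fun_prop) hρ (by fun_prop)) _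
  · intro x
    ext
    simp [e, x.2]

end Closure

/-- Linearly ordered definable sets all of whose definable subsets are, away from a finite
set, locally constant. -/
class OMin (S : Struc N) (X : Type v) [LinearOrder X] [DSpace S X] : Prop extends DSet S X where
  lt_def : DFn S (fun p : X × X => p.1 < p.2)
  omin : ∀ {P : X → Prop}, DFn S P → ∃ F : Finset X, ∀ x y, x < y →
    (∀ f ∈ F, f < x ∨ y < f) → (P x ↔ P y)

section Closure
variable {X : Type*} {Y : Type*} [DSpace S X] [DSpace S Y] [LinearOrder Y] [OMin S Y]

@[fun_prop]
theorem DFn.lt {f g : X → Y} (hf : DFn S f) (hg : DFn S g) : DFn S (fun x => f x < g x) :=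
  OMin.lt_def.comp (f := fun x => (f x, g x)) (by fun_prop)

@[fun_prop]
theorem DFn.le {f g : X → Y} (hf : DFn S f) (hg : DFn S g) : DFn S (fun x => f x ≤ g x) :=
  (hg.lt hf).not.congr fun x => by simp

end Closure

instance DSpace.instOrderDual {X : Type*} [h : DSpace S X] : DSpace S Xᵒᵈ := h

@[fun_prop]
theorem DFn.toDual {X Y : Type*} [DSpace S X] [DSpace S Y] {f : X → Y} (hf : DFn S f) :
    DFn S (fun x => OrderDual.toDual (f x)) := hf

@[fun_prop]
theorem DFn.ofDual {X Y : Type*} [DSpace S X] [DSpace S Y] {f : X → Yᵒᵈ} (hf : DFn S f) :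
    DFn S (fun x => OrderDual.ofDual (f x)) := hf

instance OMin.instOrderDual {X : Type*} [LinearOrder X] [DSpace S X] [h : OMin S X] :
    OMin S Xᵒᵈ where
  code := h.code
  lt_def := h.lt_def.comp (f := fun p : X × X => (p.2, p.1)) (by fun_prop)
  omin {P} hP := by
    obtain ⟨F, hF⟩ := h.omin (P := P) hP
    exact ⟨F, fun x y hxy hf => (hF y x hxy fun f hf' => (hf f hf').symm).symm⟩

instance OMin.instBase [Nonempty N] : OMin S N where
  lt_def := DFn.ltN (by fun_prop) (by fun_prop)
  omin {P} hP := by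
    classical
    have h0 := hP.plot (fun z : Fin 1 → N => z 0) (Struc.DfFun.proj S 0)
    obtain ⟨n, e, h1⟩ := h0
    obtain rfl : n = 1 := by simpa using (Fintype.card_congr e).symm
    obtain ⟨k, f, hf, h2⟩ := S.o_min h1
    have h3 : ∀ t, P t ↔ ∃ i, t ∈ f i := fun t => by
      have := congrArg (t ∈ ·) h2
      simpa [DSpace.plot] using this
    have key : ∀ i, ∃ F : Finset N, ∀ x y, x < y → (∀ f ∈ F, f < x ∨ y < f) →
        (x ∈ f i ↔ y ∈ f i) := by
      intro i
      rcases hf i with ⟨a, h⟩ | ⟨a, b, h⟩ | ⟨a, h⟩ | ⟨a, h⟩ | h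
      · refine ⟨{a}, fun x y hxy hF => ?_⟩
        have := hF a (by simp)
        simp only [h, mem_singleton_iff]
        constructor <;> rintro rfl <;> simp_all [lt_asymm]
      · refine ⟨{a, b}, fun x y hxy hF => ?_⟩
        have ha := hF a (by simp)
        have hb := hF b (by simp)
        simp only [h, mem_Ioo]
        grind
      · refine ⟨{a}, fun x y hxy hF => ?_⟩
        have ha := hF a (by simp)
        simp only [h, mem_Ioi]
        grind
      · refine ⟨{a}, fun x y hxy hF => ?_⟩
        have ha := hF a (by simp)
        simp only [h, mem_Iio]
        grind
      · exact ⟨∅, by simp [h]⟩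
    choose F hF using key
    refine ⟨Finset.univ.biUnion F, fun x y hxy h => ?_⟩
    simp only [h3]
    exact exists_congr fun i => hF i x y hxy fun f hf => h f (by simp; exact ⟨i, hf⟩)

end Framework

section Ends

variable {N : Type u} [LinearOrder N] {S : Struc N}

/-- Filters which decide every definable set and behave definably in families. -/
structure DUF (S : Struc N) {X : Type v} [DSpace S X] (F : Filter X) : Prop where
  neBot : F.NeBot
  ultra : ∀ {P : X → Prop}, DFn S P → (∀ᶠ t in F, P t) ∨ ∀ᶠ t in F, ¬ P t
  fam' : ∀ {ι : Type} [Finite ι] {P : (ι → N) → X → Prop},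
    DFn S (fun p : (ι → N) × X => P p.1 p.2) → DFn S (fun z => ∀ᶠ t in F, P z t)

namespace DUF
variable {X : Type v} {Y : Type w} [DSpace S X] [DSpace S Y] {F : Filter X}

@[fun_prop]
theorem fam (hF : DUF S F) {Z : Type*} [DSpace S Z] {P : Z → X → Prop}
    (h : DFn S (fun p : Z × X => P p.1 p.2)) : DFn S (fun z => ∀ᶠ t in F, P z t) := by
  refine ⟨fun {κ} _ c hc => ?_⟩
  have hc := DSpace.plot_iff.1 hc
  exact DSpace.plot_iff.2 (hF.fam' (P := fun z t => P (c z) t)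
    (h.comp (f := fun p : (κ → N) × X => (c p.1, p.2)) (by fun_prop)))

theorem map (hF : DUF S F) {f : X → Y} (hf : DFn S f) : DUF S (F.map f) where
  neBot := hF.neBot.map f
  ultra hP := hF.ultra (hP.comp hf)
  fam' {_ _ P} hP := by
    simp only [eventually_map]
    exact hF.fam (P := fun z t => P z (f t))
      (hP.comp (f := fun p : _ × X => (p.1, f p.2)) (by fun_prop))

theorem not_eventually (hF : DUF S F) {P : X → Prop} (hP : DFn S P) :
    (¬ ∀ᶠ t in F, P t) ↔ ∀ᶠ t in F, ¬ P t := by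
  have := hF.neBot
  refine ⟨fun h => (hF.ultra hP).resolve_left h, fun h h' => ?_⟩
  obtain ⟨t, h1, h2⟩ := (h.and h').exists
  exact h1 h2

theorem eventually_or (hF : DUF S F) {P Q : X → Prop} (hP : DFn S P)
    (h : ∀ᶠ t in F, P t ∨ Q t) : (∀ᶠ t in F, P t) ∨ ∀ᶠ t in F, Q t := by
  rcases hF.ultra hP with h' | h'
  · exact .inl h'
  · right
    filter_upwards [h, h'] with t h1 h2
    exact h1.resolve_left h2

theorem congr_filter (hF : DUF S F) {G : Filter X} (h : F = G) : DUF S G := h ▸ hF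

end DUF

section Order
variable {X : Type v} [LinearOrder X]

/-- The germs to the right of a point. -/
def rgt [NoMaxOrder X] (x : X) : Filter X where
  sets := {s | ∃ y > x, ∀ t, x < t → t < y → t ∈ s}
  univ_sets := by
    obtain ⟨y, hy⟩ := exists_gt x
    exact ⟨y, hy, fun _ _ _ => mem_univ _⟩
  sets_of_superset := fun ⟨y, hy, h⟩ hs => ⟨y, hy, fun t h1 h2 => hs (h t h1 h2)⟩
  inter_sets := fun ⟨y, hy, h⟩ ⟨z, hz, h'⟩ => ⟨min y z, lt_min hy hz, fun t h1 h2 =>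
    ⟨h t h1 (h2.trans_le (min_le_left _ _)), h' t h1 (h2.trans_le (min_le_right _ _))⟩⟩

/-- The germs to the left of a point. -/
def lft [NoMinOrder X] (x : X) : Filter X where
  sets := {s | ∃ y < x, ∀ t, y < t → t < x → t ∈ s}
  univ_sets := by
    obtain ⟨y, hy⟩ := exists_lt x
    exact ⟨y, hy, fun _ _ _ => mem_univ _⟩
  sets_of_superset := fun ⟨y, hy, h⟩ hs => ⟨y, hy, fun t h1 h2 => hs (h t h1 h2)⟩
  inter_sets := fun ⟨y, hy, h⟩ ⟨z, hz, h'⟩ => ⟨max y z, max_lt hy hz, fun t h1 h2 =>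
    ⟨h t ((le_max_left _ _).trans_lt h1) h2, h' t ((le_max_right _ _).trans_lt h1) h2⟩⟩

theorem eventually_rgt [NoMaxOrder X] {x : X} {P : X → Prop} :
    (∀ᶠ t in rgt x, P t) ↔ ∃ y > x, ∀ t, x < t → t < y → P t := Iff.rfl

theorem eventually_lft [NoMinOrder X] {x : X} {P : X → Prop} :
    (∀ᶠ t in lft x, P t) ↔ ∃ y < x, ∀ t, y < t → t < x → P t := Iff.rfl

theorem eventually_atTop_lt [NoMaxOrder X] [Nonempty X] {P : X → Prop} :
    (∀ᶠ t in atTop, P t) ↔ ∃ y, ∀ t, y < t → P t := by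
  rw [eventually_atTop]
  constructor
  · rintro ⟨y, h⟩
    exact ⟨y, fun t ht => h t ht.le⟩
  · rintro ⟨y, h⟩
    obtain ⟨z, hz⟩ := exists_gt y
    exact ⟨z, fun t ht => h t (hz.trans_le ht)⟩

theorem Finset.exists_gt_forall_le [NoMaxOrder X] (F : Finset X) (x : X) :
    ∃ y > x, ∀ f ∈ F, x < f → y ≤ f := by
  induction F using Finset.induction_on with
  | empty =>
    obtain ⟨y, hy⟩ := exists_gt x
    exact ⟨y, hy, by simp⟩
  | insert a F _ ih =>
    obtain ⟨y, hy, h⟩ := ih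
    by_cases ha : x < a
    · refine ⟨min y a, lt_min hy ha, fun f hf hx => ?_⟩
      rcases Finset.mem_insert.1 hf with rfl | hf
      · exact min_le_right _ _
      · exact (min_le_left _ _).trans (h f hf hx)
    · refine ⟨y, hy, fun f hf hx => ?_⟩
      rcases Finset.mem_insert.1 hf with rfl | hf
      · exact absurd hx ha
      · exact h f hf hx

variable [DSpace S X] [OMin S X]

namespace DUF

theorem rgt [NoMaxOrder X] [DenselyOrdered X] (x : X) : DUF S (rgt x) where
  neBot := by
    refine ⟨fun h => ?_⟩
    have : ∀ᶠ t in _root_.rgt x, False := by rw [h]; exact eventually_bot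
    obtain ⟨y, hy, h⟩ := eventually_rgt.1 this
    obtain ⟨t, h1, h2⟩ := exists_between hy
    exact h t h1 h2
  ultra {P} hP := by
    classical
    obtain ⟨F, hF⟩ := OMin.omin hP
    obtain ⟨y, hy, h⟩ := F.exists_gt_forall_le x
    have key : ∀ t u, x < t → t < u → u < y → (P t ↔ P u) := fun t u h1 h2 h3 =>
      hF t u h2 fun f hf => (le_or_gt f x).imp (fun h => h.trans_lt h1)
        fun hx => h3.trans_le (h f hf hx)
    obtain ⟨z, h1, h2⟩ := exists_between hy
    by_cases hz : P z
    · exact .inl ⟨z, h1, fun t h3 h4 => (key t z h3 h4 h2).2 hz⟩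
    · exact .inr ⟨z, h1, fun t h3 h4 ht => hz ((key t z h3 h4 h2).1 ht)⟩
  fam' {_ _ P} hP := by
    simp only [eventually_rgt]
    have : DFn S (fun q : ((_ × X) × X) => P q.1.1 q.2) :=
      hP.comp (f := fun q : ((_ × X) × X) => (q.1.1, q.2)) (by fun_prop)
    fun_prop

theorem lft [NoMinOrder X] [DenselyOrdered X] (x : X) : DUF S (lft x) := by
  have : _root_.rgt (X := Xᵒᵈ) (OrderDual.toDual x) = _root_.lft x := by
    ext s
    exact exists_congr fun y => and_congr Iff.rfl (forall_congr' fun t => Iff.intro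
      (fun h h1 h2 => h h2 h1) (fun h h1 h2 => h h2 h1))
  exact (rgt (S := S) (X := Xᵒᵈ) (OrderDual.toDual x)).congr_filter this

theorem top [NoMaxOrder X] [Nonempty X] : DUF S (atTop : Filter X) where
  neBot := inferInstance
  ultra {P} hP := by
    classical
    obtain ⟨F, hF⟩ := OMin.omin hP
    obtain ⟨y, h⟩ : ∃ y, ∀ f ∈ F, f ≤ y := by
      obtain ⟨y, hy⟩ := F.bddAbove
      exact ⟨y, fun f hf => hy hf⟩
    obtain ⟨z, hz⟩ := exists_gt y
    simp only [eventually_atTop_lt]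
    have key : ∀ t, z < t → (P z ↔ P t) := fun t ht =>
      hF z t ht fun f hf => .inl ((h f hf).trans_lt hz)
    by_cases hz : P z
    · exact .inl ⟨z, fun t ht => (key t ht).1 hz⟩
    · exact .inr ⟨z, fun t ht h => hz ((key t ht).2 h)⟩
  fam' {_ _ P} hP := by
    simp only [eventually_atTop_lt]
    have : DFn S (fun q : ((_ × X) × X) => P q.1.1 q.2) :=
      hP.comp (f := fun q : ((_ × X) × X) => (q.1.1, q.2)) (by fun_prop)
    fun_prop

theorem bot [NoMinOrder X] [Nonempty X] : DUF S (atBot : Filter X) :=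
  top (S := S) (X := Xᵒᵈ)

end DUF

namespace OMin

theorem exists_isLUB [NoMaxOrder X] [DenselyOrdered X] {P : X → Prop} (hP : DFn S P) {a b : X}
    (ha : P a) (hb : ∀ x, P x → x ≤ b) : ∃ y, IsLUB {x | P x} y := by
  classical
  let Q : X → Prop := fun x => ∃ y, x ≤ y ∧ P y
  have hQ : DFn S Q := by fun_prop
  have hQd : ∀ x y, x ≤ y → Q y → Q x := fun x y h ⟨z, h1, h2⟩ => ⟨z, h.trans h1, h2⟩
  obtain ⟨F, hF⟩ := OMin.omin hQ
  obtain ⟨b', hb'⟩ := exists_gt b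
  have hQb : ¬ Q b' := fun ⟨z, h1, h2⟩ => (hb'.trans_le h1).not_ge (hb z h2)
  obtain ⟨c, hc, hcm⟩ := ((insert a F).filter Q).exists_max_image id
    ⟨a, by simp only [Finset.mem_filter, Finset.mem_insert_self, true_and]; exact ⟨a, le_rfl, ha⟩⟩
  obtain ⟨d, hd, hdm⟩ := ((insert b' F).filter (¬ Q ·)).exists_min_image id ⟨b', by simp [hQb]⟩
  simp only [Finset.mem_filter, Finset.mem_insert, id] at hc hd hcm hdm
  have hcd : c < d := lt_of_not_ge fun h => hd.2 (hQd _ _ h hc.2)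
  have key : ∀ x y, c < x → x < y → y < d → (Q x ↔ Q y) := fun x y h1 h2 h3 =>
    hF x y h2 fun f hf => by
      by_cases h : Q f
      · exact .inl ((hcm f ⟨.inr hf, h⟩).trans_lt h1)
      · exact .inr (h3.trans_le (hdm f ⟨.inr hf, h⟩))
  obtain ⟨e, h1, h2⟩ := exists_between hcd
  by_cases he : Q e
  · refine ⟨d, fun x hx => le_of_not_gt fun h => hd.2 ⟨x, h.le, hx⟩, fun u hu => ?_⟩
    by_contra! h
    obtain ⟨z, h3, h4⟩ := exists_between (max_lt h h2)
    have hz : Q z := (key e z h1 ((le_max_right _ _).trans_lt h3) h4).1 he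
    obtain ⟨w, h5, h6⟩ := hz
    exact (((le_max_left _ _).trans_lt h3).trans_le h5).not_ge (hu h6)
  · refine ⟨c, fun x hx => le_of_not_gt fun h => he ?_, fun u hu => ?_⟩
    · rcases lt_or_ge x e with h3 | h3
      · exact (key x e h h3 h2).1 ⟨x, le_rfl, hx⟩
      · exact ⟨x, h3, hx⟩
    · obtain ⟨y, h3, h4⟩ := hc.2
      exact h3.trans (hu h4)

theorem exists_isGLB [NoMinOrder X] [DenselyOrdered X] {P : X → Prop} (hP : DFn S P) {a b : X}
    (ha : P a) (hb : ∀ x, P x → b ≤ x) : ∃ y, IsGLB {x | P x} y :=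
  exists_isLUB (S := S) (X := Xᵒᵈ) (P := P) hP ha hb

theorem exists_Ioo_of_infinite [NoMaxOrder X] {P : X → Prop}
    (hP : DFn S P) (h : {x | P x}.Infinite) : ∃ a b, a < b ∧ ∀ t, a < t → t < b → P t := by
  obtain ⟨F, hF⟩ := OMin.omin hP
  obtain ⟨x, hx, hxF⟩ := h.exists_notMem_finset F
  obtain ⟨y, hy, h⟩ := F.exists_gt_forall_le x
  refine ⟨x, y, hy, fun t h1 h2 => (hF x t h1 fun f hf => ?_).1 hx⟩
  rcases lt_trichotomy f x with h3 | rfl | h3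
  · exact .inl h3
  · exact absurd hf hxF
  · exact .inr (h2.trans_le (h f hf h3))

theorem finite_not [NoMaxOrder X] {P : X → Prop} (hP : DFn S P)
    (h : ∀ a b, a < b → ∃ t, a < t ∧ t < b ∧ P t) : {x | ¬ P x}.Finite := by
  by_contra hc
  obtain ⟨a, b, hab, h1⟩ := exists_Ioo_of_infinite hP.not hc
  obtain ⟨t, h2, h3, h4⟩ := h a b hab
  exact h1 t h2 h3 h4

end OMin

theorem Set.infinite_of_Ioo_subset {X : Type*} [LinearOrder X] [DenselyOrdered X] {s : Set X} {a b : X} (hab : a < b)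
    (h : ∀ t, a < t → t < b → t ∈ s) : s.Infinite :=
  (Set.Ioo_infinite hab).mono fun t ht => h t ht.1 ht.2

/-- `f` tends to `y` along `F`, in the sense of the order. -/
def LimAt {T : Type*} (F : Filter T) (f : T → X) (y : X) : Prop :=
  (∀ a < y, ∀ᶠ t in F, a < f t) ∧ ∀ b > y, ∀ᶠ t in F, f t < b

namespace LimAt
variable {T : Type*} {F : Filter T} {f g : T → X} {y z : X}

theorem unique [F.NeBot] [DenselyOrdered X] (h : LimAt F f y) (h' : LimAt F f z) : y = z := by
  have key : ∀ {y z : X}, LimAt F f y → LimAt F f z → ¬ y < z := fun {y z} h h' hlt => by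
    obtain ⟨c, h1, h2⟩ := exists_between hlt
    obtain ⟨t, h3, h4⟩ := ((h.2 c h1).and (h'.1 c h2)).exists
    exact lt_asymm h3 h4
  exact le_antisymm (le_of_not_gt (key h' h)) (le_of_not_gt (key h h'))

theorem congr' (h : LimAt F f y) (e : ∀ᶠ t in F, f t = g t) : LimAt F g y :=
  ⟨fun a ha => by filter_upwards [h.1 a ha, e] with t h1 h2 using h2 ▸ h1,
   fun a ha => by filter_upwards [h.2 a ha, e] with t h1 h2 using h2 ▸ h1⟩

theorem const (y : X) : LimAt F (fun _ => y) y :=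
  ⟨fun _ h => Eventually.of_forall fun _ => h, fun _ h => Eventually.of_forall fun _ => h⟩

end LimAt

section Limits
variable {T : Type*} [DSpace S T] {F : Filter T} {f : T → X}

theorem DUF.exists_limAt [NoMaxOrder X] [DenselyOrdered X] (hF : DUF S F) (hf : DFn S f)
    {lo hi : X} (h1 : ∀ᶠ t in F, lo < f t) (h2 : ∀ᶠ t in F, f t ≤ hi) : ∃ y, LimAt F f y := by
  have := hF.neBot
  have hP : DFn S (fun u : X => ∀ᶠ t in F, u < f t) := hF.fam (by fun_prop)
  obtain ⟨y, hy⟩ := OMin.exists_isLUB hP h1 (b := hi) (fun u hu => by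
    obtain ⟨t, h3, h4⟩ := (hu.and h2).exists
    exact h3.le.trans h4)
  refine ⟨y, fun a ha => ?_, fun b hb => ?_⟩
  · obtain ⟨c, hc, hac⟩ := (lt_isLUB_iff hy).1 ha
    filter_upwards [hc] with t ht using hac.trans ht
  · obtain ⟨c, h3, h4⟩ := exists_between hb
    have h5 : ¬ ∀ᶠ t in F, c < f t := fun h => h3.not_ge (hy.1 h)
    filter_upwards [(hF.not_eventually (by fun_prop)).1 h5] with t ht
    exact (not_lt.1 ht).trans_lt h4

theorem DUF.lim_cases [NoMaxOrder X] [NoMinOrder X] [DenselyOrdered X] (hF : DUF S F)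
    (hf : DFn S f) : (∃ y, LimAt F f y) ∨ (∀ b, ∀ᶠ t in F, b < f t) ∨ ∀ b, ∀ᶠ t in F, f t < b := by
  by_cases h1 : ∀ b, ∀ᶠ t in F, b < f t
  · exact .inr (.inl h1)
  by_cases h2 : ∀ b, ∀ᶠ t in F, f t < b
  · exact .inr (.inr h2)
  simp only [not_forall] at h1 h2
  obtain ⟨hi, h1⟩ := h1
  obtain ⟨lo, h2⟩ := h2
  obtain ⟨lo', hlo⟩ := exists_lt lo
  left
  refine hF.exists_limAt hf (hi := hi) (lo := lo') ?_ ?_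
  · filter_upwards [(hF.not_eventually (by fun_prop)).1 h2] with t ht
    exact hlo.trans_le (not_lt.1 ht)
  · filter_upwards [(hF.not_eventually (by fun_prop)).1 h1] with t ht
    exact not_lt.1 ht

theorem DUF.limAt_def {Z : Type*} [DSpace S Z] (hF : DUF S F) {f : Z → T → X} {y : Z → X}
    (hf : DFn S (fun p : Z × T => f p.1 p.2)) (hy : DFn S y) :
    DFn S (fun z => LimAt F (f z) (y z)) := by
  unfold LimAt
  have h : DFn S (fun p : (Z × X) × T => f p.1.1 p.2) :=
    hf.comp (f := fun p : (Z × X) × T => (p.1.1, p.2)) (by fun_prop)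
  have h1 := hF.fam (P := fun (p : Z × X) t => p.2 < f p.1 t) (by fun_prop)
  have h2 := hF.fam (P := fun (p : Z × X) t => f p.1 t < p.2) (by fun_prop)
  fun_prop

end Limits
end Order
end Ends

section Monotonicity

variable {N : Type u} [LinearOrder N] {S : Struc N}
variable {X : Type v} [LinearOrder X] [DenselyOrdered X] [NoMinOrder X] [NoMaxOrder X]
  [DSpace S X] [OMin S X]
variable {Y : Type w} [LinearOrder Y] [DenselyOrdered Y] [NoMinOrder Y] [NoMaxOrder Y]
  [DSpace S Y] [OMin S Y]

namespace OMin

/-- Definable induction along a closed interval. -/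
theorem Icc_induction {Q : X → Prop} (hQ : DFn S Q) {x y : X} (hx : Q x)
    (hr : ∀ z, x ≤ z → z < y → Q z → ∀ᶠ s in rgt z, Q s)
    (hl : ∀ z, x < z → z ≤ y → (∀ w, x ≤ w → w < z → Q w) → Q z) :
    ∀ z, x ≤ z → z ≤ y → Q z := by
  by_contra! hc
  obtain ⟨z, hxz, hzy, hz⟩ := hc
  obtain ⟨g, hg⟩ := exists_isGLB (S := S) (P := fun z => x ≤ z ∧ z ≤ y ∧ ¬ Q z) (by fun_prop)
    ⟨hxz, hzy, hz⟩ (b := x) (fun w hw => hw.1)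
  have hxg : x ≤ g := hg.2 fun w hw => hw.1
  have hgz : g ≤ z := hg.1 ⟨hxz, hzy, hz⟩
  have h1 : ∀ w, x ≤ w → w < g → Q w := fun w h2 h3 => by
    by_contra h4
    exact h3.not_ge (hg.1 ⟨h2, (h3.le.trans hgz).trans hzy, h4⟩)
  have h2 : Q g := by
    rcases hxg.eq_or_lt with rfl | h
    · exact hx
    · exact hl g h (hgz.trans hzy) h1
  have hgz' : g < z := hgz.lt_of_ne fun e => hz (e ▸ h2)
  obtain ⟨u, hu, h3⟩ := eventually_rgt.1 (hr g hxg (hgz'.trans_le hzy) h2)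
  refine hu.not_ge (hg.2 fun w hw => le_of_not_gt fun hwu => hw.2.2 ?_)
  rcases (hg.1 hw).eq_or_lt with h4 | h4
  · exact h4 ▸ h2
  · exact h3 w h4 hwu

theorem exists_Ioo_sub {P : X → Prop} (hP : DFn S P) {a b : X}
    (h : {x | a < x ∧ x < b ∧ P x}.Infinite) :
    ∃ a' b', a ≤ a' ∧ a' < b' ∧ b' ≤ b ∧ ∀ t, a' < t → t < b' → P t := by
  obtain ⟨c, d, hcd, h1⟩ := exists_Ioo_of_infinite (S := S) (by fun_prop) h
  refine ⟨c, d, ?_, hcd, ?_, fun t h2 h3 => (h1 t h2 h3).2.2⟩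
  · by_contra! h2
    obtain ⟨t, h3, h4⟩ := exists_between (lt_min hcd h2)
    exact lt_asymm (h1 t h3 (h4.trans_le (min_le_left _ _))).1 (h4.trans_le (min_le_right _ _))
  · by_contra! h2
    obtain ⟨t, h3, h4⟩ := exists_between (max_lt hcd h2)
    exact lt_asymm (h1 t ((le_max_left _ _).trans_lt h3) h4).2.1 ((le_max_right _ _).trans_lt h3)

theorem exists_Ioo_of_rgt {P : X → Prop} {a b : X} (hab : a < b) (h : ∀ᶠ t in rgt a, P t) :
    ∃ b', a < b' ∧ b' ≤ b ∧ ∀ t, a < t → t < b' → P t := by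
  obtain ⟨y, hy, h⟩ := eventually_rgt.1 h
  exact ⟨min y b, lt_min hy hab, min_le_right _ _, fun t h1 h2 =>
    h t h1 (h2.trans_le (min_le_left _ _))⟩

end OMin

open OMin

namespace DFn
variable {f : X → Y}

theorem strictMonoOn_of_local (hf : DFn S f) {J : Set X} (hJ : J.OrdConnected)
    (h : ∀ t ∈ J, (∀ᶠ s in rgt t, f t < f s) ∧ ∀ᶠ s in lft t, f s < f t) :
    StrictMonoOn f J := by
  intro x hx y hy hxy
  have := Icc_induction (S := S) (Q := fun w => w = x ∨ f x < f w) (x := x) (y := y)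
    (by fun_prop) (.inl rfl) ?_ ?_ y hxy.le le_rfl
  · exact this.resolve_left hxy.ne'
  · rintro z h1 h2 hz
    have hzJ : z ∈ J := hJ.out hx hy ⟨h1, h2.le⟩
    filter_upwards [(h z hzJ).1] with s hs
    right
    rcases hz with rfl | hz
    · exact hs
    · exact hz.trans hs
  · intro z h1 h2 hz
    have hzJ : z ∈ J := hJ.out hx hy ⟨h1.le, h2⟩
    obtain ⟨l, hl, h3⟩ := eventually_lft.1 (h z hzJ).2
    obtain ⟨s, h4, h5⟩ := exists_between (max_lt hl h1)
    right
    have h6 := h3 s ((le_max_left _ _).trans_lt h4) h5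
    rcases hz s ((le_max_right _ _).trans h4.le) h5 with rfl | h7
    · exact h6
    · exact h7.trans h6

theorem constOn_of_local (hf : DFn S f) {J : Set X} (hJ : J.OrdConnected)
    (h : ∀ t ∈ J, (∀ᶠ s in rgt t, f s = f t) ∧ ∀ᶠ s in lft t, f s = f t) :
    ∀ x ∈ J, ∀ y ∈ J, f x = f y := by
  have key : ∀ x ∈ J, ∀ y ∈ J, x ≤ y → f x = f y := by
    intro x hx y hy hxy
    refine Icc_induction (S := S) (Q := fun w => f x = f w) (x := x) (y := y)
      (by fun_prop) rfl ?_ ?_ y hxy le_rfl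
    · intro z h1 h2 hz
      filter_upwards [(h z (hJ.out hx hy ⟨h1, h2.le⟩)).1] with s hs
      rw [hz, hs]
    · intro z h1 h2 hz
      obtain ⟨l, hl, h3⟩ := eventually_lft.1 (h z (hJ.out hx hy ⟨h1.le, h2⟩)).2
      obtain ⟨s, h4, h5⟩ := exists_between (max_lt hl h1)
      rw [hz s ((le_max_right _ _).trans h4.le) h5, h3 s ((le_max_left _ _).trans_lt h4) h5]
  intro x hx y hy
  rcases le_total x y with h1 | h1
  · exact key x hx y hy h1
  · exact (key y hy x hx h1).symm

theorem exists_const_or_injOn (hf : DFn S f) {a b : X} (hab : a < b) :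
    ∃ a' b', a ≤ a' ∧ a' < b' ∧ b' ≤ b ∧
      ((∀ x ∈ Ioo a' b', ∀ y ∈ Ioo a' b', f x = f y) ∨ InjOn f (Ioo a' b')) := by
  by_cases hfin : ∀ y, {x | a < x ∧ x < b ∧ f x = y}.Finite
  · have hM : {x | a < x ∧ x < b ∧ ∀ x', a < x' → x' < x → f x' ≠ f x}.Infinite := by
      intro hM
      refine Set.Ioo_infinite hab ((hM.biUnion fun m _ => hfin (f m)).subset fun x hx => ?_)
      obtain ⟨m, hm, hmin⟩ := (hfin (f x)).exists_minimal ⟨x, hx.1, hx.2, rfl⟩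
      simp only [mem_iUnion]
      refine ⟨m, ⟨hm.1, hm.2.1, fun x' h1 h2 h3 => ?_⟩, hx.1, hx.2, hm.2.2.symm⟩
      exact h2.not_ge (hmin ⟨h1, h2.trans hm.2.1, h3.trans hm.2.2⟩ h2.le)
    obtain ⟨a', b', h1, h2, h3, h4⟩ := exists_Ioo_sub (S := S) (by fun_prop) hM
    refine ⟨a', b', h1, h2, h3, .inr ?_⟩
    have key : ∀ x ∈ Ioo a' b', ∀ y ∈ Ioo a' b', f x = f y → ¬ x < y := fun x hx y hy h hxy =>
      h4 y hy.1 hy.2 x (h1.trans_lt hx.1) hxy h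
    intro x hx y hy h
    exact le_antisymm (le_of_not_gt (key y hy x hx h.symm)) (le_of_not_gt (key x hx y hy h))
  · push Not at hfin
    obtain ⟨y, hy⟩ := hfin
    obtain ⟨a', b', h1, h2, h3, h4⟩ := exists_Ioo_sub (S := S) (by fun_prop) hy
    exact ⟨a', b', h1, h2, h3, .inl fun x hx x' hx' => by
      rw [h4 x hx.1 hx.2, h4 x' hx'.1 hx'.2]⟩

theorem exists_jump_of_localMin (hf : DFn S f) {a b : X} (hab : a < b)
    (hinj : InjOn f (Ioo a b))
    (hmin : ∀ t, a < t → t < b → (∀ᶠ s in rgt t, f t < f s) ∧ ∀ᶠ s in lft t, f t < f s) :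
    ∃ d, a ≤ d ∧ d < b ∧ ∀ v, d < v → v < b →
      ∃ v₁ v₂, v₁ < v ∧ v < v₂ ∧ ∀ s t, v₁ < s → s < v → v < t → t < v₂ → f t < f s := by
  have hB : ∀ᶠ x in lft b, ¬ ∀ y, x < y → y < b → f x < f y := by
    refine ((DUF.lft (S := S) b).ultra (P := fun x => ∀ y, x < y → y < b → f x < f y)
      (by fun_prop)).resolve_left fun h => ?_
    obtain ⟨c, hc, h⟩ := eventually_lft.1 h
    obtain ⟨x, h1, h2⟩ := exists_between (max_lt hc hab)
    obtain ⟨l, hl, h3⟩ := eventually_lft.1 (hmin x ((le_max_right _ _).trans_lt h1) h2).2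
    obtain ⟨s, h4, h5⟩ := exists_between (max_lt hl ((le_max_left c a).trans_lt h1))
    exact lt_asymm (h3 s ((le_max_left _ _).trans_lt h4) h5)
      (h s ((le_max_right _ _).trans_lt h4) (h5.trans h2) x h5 h2)
  obtain ⟨c₀, hc₀, hB⟩ := eventually_lft.1 hB
  obtain ⟨c, hc, hcb⟩ : ∃ c, max c₀ a ≤ c ∧ c < b := ⟨_, le_rfl, max_lt hc₀ hab⟩
  have hca : a ≤ c := (le_max_right _ _).trans hc
  replace hB : ∀ x, c < x → x < b → ∃ y, x < y ∧ y < b ∧ f y < f x := by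
    intro x h1 h2
    have := hB x (((le_max_left _ _).trans hc).trans_lt h1) h2
    push Not at this
    obtain ⟨y, h3, h4, h5⟩ := this
    refine ⟨y, h3, h4, h5.lt_of_ne fun e => h3.ne' ?_⟩
    exact hinj ⟨hca.trans_lt (h1.trans h3), h4⟩ ⟨hca.trans_lt h1, h2⟩ e
  have hdrop : ∀ x, c < x → x < b → ∃ e, x ≤ e ∧ e < b ∧ ∀ y, e < y → y < b → f y < f x := by
    intro x h1 h2
    suffices h : ∀ᶠ y in lft b, f y < f x by
      obtain ⟨e, he, h⟩ := eventually_lft.1 h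
      exact ⟨max e x, le_max_right _ _, max_lt he h2, fun y h3 h4 =>
        h y ((le_max_left _ _).trans_lt h3) h4⟩
    refine ((DUF.lft (S := S) b).ultra (by fun_prop)).resolve_right fun h => ?_
    obtain ⟨e, he, h⟩ := eventually_lft.1 h
    obtain ⟨y, h3, h4, h5⟩ := hB x h1 h2
    obtain ⟨z, hz⟩ := exists_isLUB (S := S) (P := fun y => x < y ∧ y < b ∧ f y < f x)
      (by fun_prop) ⟨h3, h4, h5⟩ (b := e)
      (fun y hy => le_of_not_gt fun h' => h y h' hy.2.1 hy.2.2)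
    have hxz : x < z := h3.trans_le (hz.1 ⟨h3, h4, h5⟩)
    have hzb : z < b :=
      (hz.2 fun y hy => le_of_not_gt fun h' => h y h' hy.2.1 hy.2.2).trans_lt he
    have hz' : ∀ y, z < y → y < b → f x ≤ f y := fun y h6 h7 => le_of_not_gt fun h8 =>
      h6.not_ge (hz.1 ⟨hxz.trans h6, h7, h8⟩)
    rcases lt_or_ge (f z) (f x) with h6 | h6
    · obtain ⟨y, h7, h8, h9⟩ := hB z (h1.trans hxz) hzb
      exact (h9.trans h6).not_ge (hz' y h7 h8)
    · obtain ⟨l, hl, h7⟩ := eventually_lft.1 (hmin z (hca.trans_lt (h1.trans hxz)) hzb).2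
      refine hl.not_ge (hz.2 fun y hy => le_of_not_gt fun h8 => ?_)
      rcases (hz.1 hy).eq_or_lt with rfl | h9
      · exact h6.not_gt hy.2.2
      · exact lt_asymm ((h6.trans_lt (h7 y h8 h9))) hy.2.2
  have hjump : ∀ x, c < x → x < b → ∃ v, x < v ∧ v < b ∧
      ∃ v₁ v₂, v₁ < v ∧ v < v₂ ∧ ∀ s t, v₁ < s → s < v → v < t → t < v₂ → f t < f s := by
    intro x h1 h2
    obtain ⟨e, h3, h4, h5⟩ := hdrop x h1 h2
    obtain ⟨z, hz⟩ := exists_isLUB (S := S) (P := fun y => x ≤ y ∧ y < b ∧ ¬ f y < f x)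
      (by fun_prop) ⟨le_rfl, h2, lt_irrefl _⟩ (b := e)
      (fun y hy => le_of_not_gt fun h' => hy.2.2 (h5 y h' hy.2.1))
    have hzb : z < b :=
      (hz.2 fun y hy => le_of_not_gt fun h' => hy.2.2 (h5 y h' hy.2.1)).trans_lt h4
    have hz' : ∀ y, z < y → y < b → f y < f x := fun y h6 h7 => by
      by_contra h8
      exact h6.not_ge (hz.1 ⟨(hz.1 ⟨le_rfl, h2, lt_irrefl _⟩).trans h6.le, h7, h8⟩)
    have hxz : x < z := by
      obtain ⟨u, hu, h6⟩ := eventually_rgt.1 (hmin x (hca.trans_lt h1) h2).1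
      obtain ⟨s, h7, h8⟩ := exists_between (lt_min hu h2)
      exact h7.trans_le (hz.1 ⟨h7.le, h8.trans_le (min_le_right _ _),
        (h6 s h7 (h8.trans_le (min_le_left _ _))).not_gt⟩)
    refine ⟨z, hxz, hzb, ?_⟩
    rcases (DUF.lft (S := S) z).ultra (P := fun s => f s < f x) (by fun_prop) with h6 | h6
    · exfalso
      obtain ⟨l, hl, h7⟩ := eventually_lft.1 (h6.and (hmin z (hca.trans_lt (h1.trans hxz)) hzb).2)
      refine hl.not_ge (hz.2 fun y hy => le_of_not_gt fun h8 => ?_)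
      rcases (hz.1 hy).eq_or_lt with rfl | h9
      · obtain ⟨s, h10, h11⟩ := exists_between hl
        exact hy.2.2 ((h7 s h10 h11).2.trans (h7 s h10 h11).1)
      · exact hy.2.2 (h7 y h8 h9).1
    · obtain ⟨l, hl, h7⟩ := eventually_lft.1 h6
      exact ⟨l, b, hl, hzb, fun s t h8 h9 h10 h11 =>
        (hz' t h10 h11).trans_le (not_lt.1 (h7 s h8 h9))⟩
  rcases (DUF.lft (S := S) b).ultra (P := fun v => ∃ v₁ v₂, v₁ < v ∧ v < v₂ ∧
      ∀ s t, v₁ < s → s < v → v < t → t < v₂ → f t < f s) (by fun_prop) with h | h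
  · obtain ⟨d, hd, h⟩ := eventually_lft.1 h
    exact ⟨max d a, le_max_right _ _, max_lt hd hab, fun v h1 h2 =>
      h v ((le_max_left _ _).trans_lt h1) h2⟩
  · exfalso
    obtain ⟨d, hd, h⟩ := eventually_lft.1 h
    obtain ⟨x, h1, h2⟩ := exists_between (max_lt hd hcb)
    obtain ⟨v, h3, h4, h5⟩ := hjump x ((le_max_right _ _).trans_lt h1) h2
    exact h v (((le_max_left _ _).trans_lt h1).trans h3) h4 h5

theorem not_localMin (hf : DFn S f) {a b : X} (hab : a < b) (hinj : InjOn f (Ioo a b))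
    (hmin : ∀ t, a < t → t < b → (∀ᶠ s in rgt t, f t < f s) ∧ ∀ᶠ s in lft t, f t < f s) :
    False := by
  obtain ⟨d, h1, h2, h3⟩ := hf.exists_jump_of_localMin hab hinj hmin
  have hi : InjOn (fun t : Xᵒᵈ => f (OrderDual.ofDual t))
      (Ioo (OrderDual.toDual b) (OrderDual.toDual d)) := fun s hs t ht h =>
    hinj
      (x₁ := OrderDual.ofDual s) (x₂ := OrderDual.ofDual t) ⟨h1.trans_lt hs.2, hs.1⟩ ⟨h1.trans_lt ht.2, ht.1⟩ h
  obtain ⟨d', h4, h5, h6⟩ := exists_jump_of_localMin (S := S) (X := Xᵒᵈ)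
    (f := fun t : Xᵒᵈ => f (OrderDual.ofDual t)) (a := OrderDual.toDual b)
    (b := OrderDual.toDual d) (hf.comp (by fun_prop)) h2 hi (fun t h4 h5 => by
      have := hmin (OrderDual.ofDual t) (lt_of_le_of_lt h1 h5) h4
      refine ⟨?_, ?_⟩
      · obtain ⟨y, hy, h⟩ := eventually_lft.1 this.2
        exact ⟨OrderDual.toDual y, hy, fun t h1 h2 => h t h2 h1⟩
      · obtain ⟨y, hy, h⟩ := eventually_rgt.1 this.1
        exact ⟨OrderDual.toDual y, hy, fun t h1 h2 => h t h2 h1⟩)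
  have h4' : OrderDual.ofDual d' ≤ b := h4
  have h5' : d < OrderDual.ofDual d' := h5
  obtain ⟨v, h7, h8⟩ := exists_between h5'
  obtain ⟨v₁, v₂, h9, h10, h11⟩ := h3 v h7 (h8.trans_le h4')
  obtain ⟨w₁, w₂, h12, h13, h14⟩ := h6 (OrderDual.toDual v) h8 h7
  have h12' : v < OrderDual.ofDual w₁ := h12
  have h13' : OrderDual.ofDual w₂ < v := h13
  obtain ⟨s, hs, hs'⟩ := exists_between (max_lt h9 h13')
  obtain ⟨t, ht, ht'⟩ := exists_between (lt_min h10 h12')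
  exact lt_asymm (h11 s t ((le_max_left _ _).trans_lt hs) hs' ht (ht'.trans_le (min_le_left _ _)))
    (h14 (OrderDual.toDual t) (OrderDual.toDual s) (ht'.trans_le (min_le_right _ _)) ht hs'
      ((le_max_right v₁ (OrderDual.ofDual w₂)).trans_lt hs))

end DFn
end Monotonicity

section Monotonicity

variable {N : Type u} [LinearOrder N] {S : Struc N}
variable {X : Type v} [LinearOrder X] [DenselyOrdered X] [NoMinOrder X] [NoMaxOrder X]
  [DSpace S X] [OMin S X]
variable {Y : Type w} [LinearOrder Y] [DenselyOrdered Y] [NoMinOrder Y] [NoMaxOrder Y]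
  [DSpace S Y] [OMin S Y]

open OMin

namespace DFn
variable {f : X → Y}

theorem exists_strictMono_of_injOn (hf : DFn S f) {a b : X} (hab : a < b)
    (hinj : InjOn f (Ioo a b)) : ∃ a' b', a ≤ a' ∧ a' < b' ∧ b' ≤ b ∧
      (StrictMonoOn f (Ioo a' b') ∨ StrictAntiOn f (Ioo a' b')) := by
  have hfd : DFn S (fun t : X => OrderDual.toDual (f t)) := hf.toDual
  suffices h : ∃ b', a < b' ∧ b' ≤ b ∧
      (StrictMonoOn f (Ioo a b') ∨ StrictAntiOn f (Ioo a b')) by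
    obtain ⟨b', h⟩ := h
    exact ⟨a, b', le_rfl, h⟩
  have hlr : DFn S (fun t => ∀ᶠ s in rgt t, f t < f s) := by
    simp only [eventually_rgt]; fun_prop
  have hll : DFn S (fun t => ∀ᶠ s in lft t, f t < f s) := by
    simp only [eventually_lft]; fun_prop
  have hnr : ∀ t ∈ Ioo a b, (¬ ∀ᶠ s in rgt t, f t < f s) → ∀ᶠ s in rgt t, f s < f t := by
    intro t ht h
    have h1 := ((DUF.rgt (S := S) t).not_eventually (by fun_prop)).1 h
    obtain ⟨y, hy, h2⟩ := eventually_rgt.1 h1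
    refine eventually_rgt.2 ⟨min y b, lt_min hy ht.2, fun s h3 h4 => ?_⟩
    refine (not_lt.1 (h2 s h3 (h4.trans_le (min_le_left _ _)))).lt_of_ne fun e => h3.ne' ?_
    exact hinj ⟨ht.1.trans h3, h4.trans_le (min_le_right _ _)⟩ ht e
  have hnl : ∀ t ∈ Ioo a b, (¬ ∀ᶠ s in lft t, f t < f s) → ∀ᶠ s in lft t, f s < f t := by
    intro t ht h
    have h1 := ((DUF.lft (S := S) t).not_eventually (by fun_prop)).1 h
    obtain ⟨y, hy, h2⟩ := eventually_lft.1 h1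
    refine eventually_lft.2 ⟨max y a, max_lt hy ht.1, fun s h3 h4 => ?_⟩
    refine (not_lt.1 (h2 s ((le_max_left _ _).trans_lt h3) h4)).lt_of_ne fun e => h4.ne ?_
    exact hinj ⟨(le_max_right _ _).trans_lt h3, h4.trans ht.2⟩ ht e
  rcases (DUF.rgt (S := S) a).ultra hlr with h1 | h1 <;>
  rcases (DUF.rgt (S := S) a).ultra hll with h2 | h2 <;>
  obtain ⟨c, hc, hcb, h⟩ := exists_Ioo_of_rgt hab (h1.and h2)
  · exact (hf.not_localMin hc (hinj.mono (Ioo_subset_Ioo_right hcb)) h).elim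
  · exact ⟨c, hc, hcb, .inl (hf.strictMonoOn_of_local ordConnected_Ioo fun t ht =>
      ⟨(h t ht.1 ht.2).1, hnl t ⟨ht.1, ht.2.trans_le hcb⟩ (h t ht.1 ht.2).2⟩)⟩
  · exact ⟨c, hc, hcb, .inr (hfd.strictMonoOn_of_local ordConnected_Ioo fun t ht =>
      ⟨hnr t ⟨ht.1, ht.2.trans_le hcb⟩ (h t ht.1 ht.2).1, (h t ht.1 ht.2).2⟩)⟩
  · exact (hfd.not_localMin hc (hinj.mono (Ioo_subset_Ioo_right hcb)) fun t h3 h4 =>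
      ⟨hnr t ⟨h3, h4.trans_le hcb⟩ (h t h3 h4).1, hnl t ⟨h3, h4.trans_le hcb⟩ (h t h3 h4).2⟩).elim

/-- The trichotomy in the monotonicity theorem. -/
def Mono3 (f : X → Y) (J : Set X) : Prop :=
  (∀ x ∈ J, ∀ y ∈ J, f x = f y) ∨ StrictMonoOn f J ∨ StrictAntiOn f J

theorem exists_mono3 (hf : DFn S f) {a b : X} (hab : a < b) :
    ∃ a' b', a ≤ a' ∧ a' < b' ∧ b' ≤ b ∧ Mono3 f (Ioo a' b') := by
  obtain ⟨a', b', h1, h2, h3, h | h⟩ := hf.exists_const_or_injOn hab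
  · exact ⟨a', b', h1, h2, h3, .inl h⟩
  · obtain ⟨a'', b'', h4, h5, h6, h⟩ := hf.exists_strictMono_of_injOn h2 h
    exact ⟨a'', b'', h1.trans h4, h5, h6.trans h3, .inr h⟩

/-- Continuity at a point, for the order topologies. -/
def ContAt (f : X → Y) (x : X) : Prop := LimAt (rgt x) f (f x) ∧ LimAt (lft x) f (f x)

theorem exists_contAt_of_strictMono (hf : DFn S f) {a b : X} (hab : a < b)
    (h : StrictMonoOn f (Ioo a b)) :
    ∃ a' b', a ≤ a' ∧ a' < b' ∧ b' ≤ b ∧ ∀ x ∈ Ioo a' b', ContAt f x := by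
  obtain ⟨u, v, huv, h1⟩ := exists_Ioo_of_infinite (S := S)
    (P := fun y : Y => ∃ x, a < x ∧ x < b ∧ f x = y) (by fun_prop)
    (((Set.Ioo_infinite hab).image h.injOn).mono (by
      rintro _ ⟨x, hx, rfl⟩
      exact ⟨x, hx.1, hx.2, rfl⟩))
  obtain ⟨p, hp, hpv⟩ := exists_between huv
  obtain ⟨q, hpq, hq⟩ := exists_between hpv
  obtain ⟨x₁, h2, h3, rfl⟩ := h1 p hp hpv
  obtain ⟨x₂, h4, h5, rfl⟩ := h1 q (hp.trans hpq) hq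
  have h12 : x₁ < x₂ := (h.lt_iff_lt ⟨h2, h3⟩ ⟨h4, h5⟩).1 hpq
  refine ⟨x₁, x₂, h2.le, h12, h5.le, fun x hx => ?_⟩
  have hx' : x ∈ Ioo a b := ⟨h2.trans hx.1, hx.2.trans h5⟩
  have hl : f x₁ < f x := h ⟨h2, h3⟩ hx' hx.1
  have hr : f x < f x₂ := h hx' ⟨h4, h5⟩ hx.2
  refine ⟨⟨fun u' hu' => ?_, fun v' hv' => ?_⟩, ⟨fun u' hu' => ?_, fun v' hv' => ?_⟩⟩
  · exact eventually_rgt.2 ⟨b, hx'.2, fun t h6 h7 => hu'.trans (h hx' ⟨hx'.1.trans h6, h7⟩ h6)⟩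
  · obtain ⟨w, h6, h7⟩ := exists_between (lt_min hv' hr)
    obtain ⟨r, h8, h9, rfl⟩ := h1 w ((hp.trans hl).trans h6)
      ((h7.trans_le (min_le_right _ _)).trans hq)
    have h10 := (h.lt_iff_lt hx' ⟨h8, h9⟩).1 h6
    exact eventually_rgt.2 ⟨r, h10, fun t h11 h12 =>
      (h ⟨hx'.1.trans h11, h12.trans h9⟩ ⟨h8, h9⟩ h12).trans (h7.trans_le (min_le_left _ _))⟩
  · obtain ⟨w, h6, h7⟩ := exists_between (max_lt hu' hl)
    obtain ⟨r, h8, h9, rfl⟩ := h1 w (hp.trans ((le_max_right _ _).trans_lt h6))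
      ((h7.trans hr).trans hq)
    have h10 := (h.lt_iff_lt ⟨h8, h9⟩ hx').1 h7
    exact eventually_lft.2 ⟨r, h10, fun t h11 h12 =>
      ((le_max_left _ _).trans_lt h6).trans (h ⟨h8, h9⟩ ⟨h8.trans h11, h12.trans hx'.2⟩ h11)⟩
  · exact eventually_lft.2 ⟨a, hx'.1, fun t h6 h7 => (h ⟨h6, h7.trans hx'.2⟩ hx' h7).trans hv'⟩

theorem contAt_def (hf : DFn S f) : DFn S (ContAt f) := by
  unfold ContAt LimAt
  simp only [eventually_rgt, eventually_lft]
  fun_prop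

theorem finite_not_contAt (hf : DFn S f) : {x | ¬ ContAt f x}.Finite := by
  refine OMin.finite_not (S := S) hf.contAt_def fun a b hab => ?_
  obtain ⟨a', b', h1, h2, h3, h⟩ := hf.exists_mono3 hab
  suffices h : ∃ a'' b'', a' ≤ a'' ∧ a'' < b'' ∧ b'' ≤ b' ∧ ∀ x ∈ Ioo a'' b'', ContAt f x by
    obtain ⟨c, d, h4, h5, h6, h⟩ := h
    obtain ⟨t, h7, h8⟩ := exists_between h5
    exact ⟨t, (h1.trans h4).trans_lt h7, h8.trans_le (h6.trans h3), h t ⟨h7, h8⟩⟩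
  rcases h with h | h | h
  · refine ⟨a', b', le_rfl, h2, le_rfl, fun x hx => ⟨?_, ?_⟩⟩
    · exact (LimAt.const (f x)).congr'
        (eventually_rgt.2 ⟨b', hx.2, fun t h4 h5 => h x hx t ⟨hx.1.trans h4, h5⟩⟩)
    · exact (LimAt.const (f x)).congr'
        (eventually_lft.2 ⟨a', hx.1, fun t h4 h5 => h x hx t ⟨h4, h5.trans hx.2⟩⟩)
  · exact hf.exists_contAt_of_strictMono h2 h
  · obtain ⟨c, d, h4, h5, h6, h⟩ := DFn.exists_contAt_of_strictMono (S := S) hf.toDual h2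
      (f := fun x => OrderDual.toDual (f x)) h
    exact ⟨c, d, h4, h5, h6, fun x hx =>
      ⟨⟨(h x hx).1.2, (h x hx).1.1⟩, ⟨(h x hx).2.2, (h x hx).2.1⟩⟩⟩

theorem monotonicity (hf : DFn S f) : ∃ F : Finset X, ∀ J : Set X, J.OrdConnected →
    (∀ x ∈ F, x ∉ J) → Mono3 f J := by
  classical
  have hC : DFn S (fun t => (∀ᶠ s in rgt t, f s = f t) ∧ ∀ᶠ s in lft t, f s = f t) := by
    simp only [eventually_rgt, eventually_lft]; fun_prop
  have hI : DFn S (fun t => (∀ᶠ s in rgt t, f t < f s) ∧ ∀ᶠ s in lft t, f s < f t) := by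
    simp only [eventually_rgt, eventually_lft]; fun_prop
  have hD : DFn S (fun t => (∀ᶠ s in rgt t, f s < f t) ∧ ∀ᶠ s in lft t, f t < f s) := by
    simp only [eventually_rgt, eventually_lft]; fun_prop
  obtain ⟨F₁, h₁⟩ := OMin.omin hC
  obtain ⟨F₂, h₂⟩ := OMin.omin hI
  obtain ⟨F₃, h₃⟩ := OMin.omin hD
  have hfin := OMin.finite_not (S := S) ((hC.or hI).or hD) fun a b hab => by
    obtain ⟨a', b', h1, h2, h3, h⟩ := hf.exists_mono3 hab
    obtain ⟨t, ht⟩ := exists_between h2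
    refine ⟨t, h1.trans_lt ht.1, ht.2.trans_le h3, ?_⟩
    rcases h with h | h | h
    · exact .inl <| .inl
        ⟨eventually_rgt.2 ⟨b', ht.2, fun s h4 h5 => h s ⟨ht.1.trans h4, h5⟩ t ht⟩,
         eventually_lft.2 ⟨a', ht.1, fun s h4 h5 => h s ⟨h4, h5.trans ht.2⟩ t ht⟩⟩
    · exact .inl <| .inr
        ⟨eventually_rgt.2 ⟨b', ht.2, fun s h4 h5 => h ht ⟨ht.1.trans h4, h5⟩ h4⟩,
         eventually_lft.2 ⟨a', ht.1, fun s h4 h5 => h ⟨h4, h5.trans ht.2⟩ ht h5⟩⟩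
    · exact .inr
        ⟨eventually_rgt.2 ⟨b', ht.2, fun s h4 h5 => h ht ⟨ht.1.trans h4, h5⟩ h4⟩,
         eventually_lft.2 ⟨a', ht.1, fun s h4 h5 => h ⟨h4, h5.trans ht.2⟩ ht h5⟩⟩
  refine ⟨F₁ ∪ F₂ ∪ F₃ ∪ hfin.toFinset, fun J hJ hF => ?_⟩
  have key : ∀ {Q : X → Prop} {F' : Finset X},
      (∀ x y, x < y → (∀ f ∈ F', f < x ∨ y < f) → (Q x ↔ Q y)) → (∀ x ∈ F', x ∉ J) →
      ∀ x ∈ J, ∀ y ∈ J, Q x → Q y := by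
    intro Q F' h hF' x hx y hy hQ
    have aux : ∀ x ∈ J, ∀ y ∈ J, x < y → (Q x ↔ Q y) := fun x hx y hy hxy =>
      h x y hxy fun f hf => by
        by_contra! hc
        exact hF' f hf (hJ.out hx hy hc)
    rcases lt_trichotomy x y with h1 | rfl | h1
    · exact (aux x hx y hy h1).1 hQ
    · exact hQ
    · exact (aux y hy x hx h1).2 hQ
  simp only [Finset.mem_union, Finite.mem_toFinset] at hF
  rcases J.eq_empty_or_nonempty with rfl | ⟨x, hx⟩
  · exact .inl (by simp)
  by_contra hc
  refine hF x (.inr ?_) hx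
  rw [Set.mem_ofPred_eq]
  rintro ((h | h) | h) <;> refine hc ?_
  · exact .inl (hf.constOn_of_local hJ fun t ht =>
      key h₁ (fun x hx => hF x (by tauto)) x hx t ht h)
  · exact .inr <| .inl (hf.strictMonoOn_of_local hJ fun t ht =>
      key h₂ (fun x hx => hF x (by tauto)) x hx t ht h)
  · exact .inr <| .inr (DFn.strictMonoOn_of_local (S := S) hf.toDual hJ
      (f := fun x => OrderDual.toDual (f x)) fun t ht =>
      key h₃ (fun x hx => hF x (by tauto)) x hx t ht h)

theorem mono3_top [Nonempty X] (hf : DFn S f) : ∃ a, Mono3 f (Ioi a) := by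
  obtain ⟨F, h⟩ := hf.monotonicity
  obtain ⟨a, ha⟩ := F.exists_le
  exact ⟨a, h _ ordConnected_Ioi fun x hx hx' => (ha x hx).not_gt hx'⟩

end DFn
end Monotonicity

section Planar

variable {N : Type u} [LinearOrder N] {S : Struc N}

theorem DFn.exists_partial_choice {T : Type*} {Y : Type*} [DSpace S T] [DSpace S Y] [DSet S Y]
    [Nonempty Y] {R : T → Y → Prop} (hR : DFn S (fun p : T × Y => R p.1 p.2))
    (h : ∀ t y y', R t y → R t y' → y = y') :
    ∃ f : T → Y, DFn S f ∧ ∀ t, (∃ y, R t y) → R t (f t) := by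
  obtain ⟨y₀⟩ := ‹Nonempty Y›
  have hR' : DFn S (fun p : T × Y => R p.1 p.2 ∨ (¬ ∃ y, R p.1 y) ∧ p.2 = y₀) := by
    have : DFn S (fun p : (T × Y) × Y => R p.1.1 p.2) :=
      hR.comp (f := fun p : (T × Y) × Y => (p.1.1, p.2)) (by fun_prop)
    fun_prop
  obtain ⟨f, hf, h'⟩ := DFn.exists_unique_choice
    (R := fun t y => R t y ∨ (¬ ∃ y, R t y) ∧ y = y₀) hR' (fun t => by
    by_cases hy : ∃ y, R t y
    · obtain ⟨y, hy⟩ := hy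
      refine ⟨y, .inl hy, fun z hz => ?_⟩
      rcases hz with hz | hz
      · exact h _ _ _ hz hy
      · exact (hz.1 ⟨y, hy⟩).elim
    · refine ⟨y₀, .inr ⟨hy, rfl⟩, fun z hz => ?_⟩
      rcases hz with hz | hz
      · exact (hy ⟨z, hz⟩).elim
      · exact hz.2)
  exact ⟨f, hf, fun t ht => (h' t).resolve_right fun h => h.1 ht⟩

variable {X : Type v} [LinearOrder X] [DenselyOrdered X] [NoMinOrder X] [NoMaxOrder X]
  [DSpace S X] [OMin S X]
variable {Y : Type w} [LinearOrder Y] [DenselyOrdered Y] [NoMinOrder Y] [NoMaxOrder Y]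
  [DSpace S Y] [OMin S Y]

open OMin

namespace DFn

theorem exists_min_choice {T : Type*} [DSpace S T] [Nonempty Y] {R : T → Y → Prop}
    (hR : DFn S (fun p : T × Y => R p.1 p.2)) (hfin : ∀ t, {y | R t y}.Finite) :
    ∃ f : T → Y, DFn S f ∧ ∀ t, (∃ y, R t y) → R t (f t) ∧ ∀ y, R t y → f t ≤ y := by
  have h1 : DFn S (fun p : (T × Y) × Y => R p.1.1 p.2) :=
      hR.comp (f := fun p : (T × Y) × Y => (p.1.1, p.2)) (by fun_prop)
  obtain ⟨f, hf, h⟩ := DFn.exists_partial_choice (S := S)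
    (R := fun t y => R t y ∧ ∀ z, R t z → y ≤ z) (by fun_prop)
    (fun t y y' h h' => le_antisymm (h.2 _ h'.1) (h'.2 _ h.1))
  refine ⟨f, hf, fun t ⟨y, hy⟩ => h t ?_⟩
  obtain ⟨m, hm, hmin⟩ := Set.exists_min_image _ (fun y => y) (hfin t) ⟨y, hy⟩
  exact ⟨m, hm, hmin⟩

theorem exists_max_choice {T : Type*} [DSpace S T] [Nonempty Y] {R : T → Y → Prop}
    (hR : DFn S (fun p : T × Y => R p.1 p.2)) (hfin : ∀ t, {y | R t y}.Finite) :
    ∃ f : T → Y, DFn S f ∧ ∀ t, (∃ y, R t y) → R t (f t) ∧ ∀ y, R t y → y ≤ f t :=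
  DFn.exists_min_choice (Y := Yᵒᵈ) hR hfin

theorem exists_Ioo_contAt {f : X → Y} (hf : DFn S f) {a b : X} (hab : a < b) :
    ∃ a' b', a ≤ a' ∧ a' < b' ∧ b' ≤ b ∧ ∀ t, a' < t → t < b' → ContAt f t := by
  refine OMin.exists_Ioo_sub (S := S) hf.contAt_def ?_
  have := (Set.Ioo_infinite hab).sdiff hf.finite_not_contAt
  exact this.mono fun t ht => ⟨ht.1.1, ht.1.2, not_not.1 ht.2⟩

theorem exists_box_of_gt {R : X × Y → Prop} (hR : DFn S R) {a b : X}
    (hab : a < b) {e₀ : Y} (h : ∀ t, a < t → t < b → {y | e₀ < y ∧ R (t, y)}.Infinite) :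
    ∃ a' b' c d, a ≤ a' ∧ a' < b' ∧ b' ≤ b ∧ c < d ∧
      ∀ t y, a' < t → t < b' → c < y → y < d → R (t, y) := by
  have hN : Nonempty Y := ⟨e₀⟩
  obtain ⟨α, hα, h1⟩ := DFn.exists_partial_choice (S := S)
    (R := fun t s => e₀ ≤ s ∧ (∃ s', s < s' ∧ ∀ y, s < y → y < s' → R (t, y)) ∧
      ∀ r, e₀ ≤ r → (∃ s', r < s' ∧ ∀ y, r < y → y < s' → R (t, y)) → s ≤ r) (by fun_prop)
    (fun t y y' h h' => le_antisymm (h.2.2 _ h'.1 h'.2.1) (h'.2.2 _ h.1 h.2.1))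
  replace h1 : ∀ t, a < t → t < b → ∃ s', α t < s' ∧ ∀ y, α t < y → y < s' → R (t, y) := by
    intro t h2 h3
    refine (h1 t ?_).2.1
    obtain ⟨c, d, hcd, h4⟩ := exists_Ioo_of_infinite (S := S) (by fun_prop) (h t h2 h3)
    have hec : e₀ ≤ c := by
      by_contra! hc
      obtain ⟨y, h5, h6⟩ := exists_between (lt_min hcd hc)
      exact lt_asymm (h4 y h5 (h6.trans_le (min_le_left _ _))).1 (h6.trans_le (min_le_right _ _))
    obtain ⟨g, hg⟩ := exists_isGLB (S := S)
      (P := fun s => e₀ ≤ s ∧ ∃ s', s < s' ∧ ∀ y, s < y → y < s' → R (t, y)) (by fun_prop)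
      ⟨hec, d, hcd, fun y h5 h6 => (h4 y h5 h6).2⟩ (b := e₀) (fun y hy => hy.1)
    have heg : e₀ ≤ g := hg.2 fun y hy => hy.1
    refine ⟨g, heg, ?_, fun r h5 h6 => hg.1 ⟨h5, h6⟩⟩
    rcases (DUF.rgt (S := S) g).ultra (P := fun y => R (t, y)) (by fun_prop) with h5 | h5
    · exact eventually_rgt.1 h5
    · obtain ⟨y, hy, h5⟩ := eventually_rgt.1 h5
      obtain ⟨s, ⟨h6, s', h7, h8⟩, h9, h10⟩ := hg.exists_between hy
      obtain ⟨r, hr, hr'⟩ := exists_between (lt_min h7 h10)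
      exact (h5 r (h9.trans_lt hr) (hr'.trans_le (min_le_right _ _))
        (h8 r hr (hr'.trans_le (min_le_left _ _)))).elim
  obtain ⟨a₁, b₁, h2, h3, h4, h5⟩ := hα.exists_Ioo_contAt hab
  obtain ⟨t₀, h6, h7⟩ := exists_between h3
  obtain ⟨z₀, hz₀⟩ := exists_gt (α t₀)
  obtain ⟨b₂, h8, h9, h10⟩ := exists_Ioo_of_rgt h7 ((h5 t₀ h6 h7).1.2 z₀ hz₀)
  obtain ⟨β, hβ, h11⟩ := DFn.exists_partial_choice (S := S)
    (R := fun t s => (α t < s ∧ s ≤ z₀ ∧ ∀ y, α t < y → y < s → R (t, y)) ∧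
      ∀ r, α t < r → r ≤ z₀ → (∀ y, α t < y → y < r → R (t, y)) → r ≤ s) (by fun_prop)
    (fun t y y' h h' => le_antisymm (h'.2 _ h.1.1 h.1.2.1 h.1.2.2) (h.2 _ h'.1.1 h'.1.2.1 h'.1.2.2))
  replace h11 : ∀ t, t₀ < t → t < b₂ → α t < β t ∧ ∀ y, α t < y → y < β t → R (t, y) := by
    intro t h12 h13
    suffices h : _ by exact ⟨(h11 t h).1.1, (h11 t h).1.2.2⟩
    obtain ⟨s', h14, h15⟩ := h1 t (h2.trans_lt (h6.trans h12)) (h13.trans_le (h9.trans h4))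
    have h16 := h10 t h12 h13
    have hm : α t < min s' z₀ ∧ min s' z₀ ≤ z₀ ∧ ∀ y, α t < y → y < min s' z₀ → R (t, y) :=
      ⟨lt_min h14 h16, min_le_right _ _, fun y h17 h18 => h15 y h17 (h18.trans_le (min_le_left _ _))⟩
    obtain ⟨g, hg⟩ := exists_isLUB (S := S)
      (P := fun r => α t < r ∧ r ≤ z₀ ∧ ∀ y, α t < y → y < r → R (t, y)) (by fun_prop)
      hm (b := z₀) (fun y hy => hy.2.1)
    refine ⟨g, ⟨hm.1.trans_le (hg.1 hm), hg.2 fun y hy => hy.2.1, fun y h17 h18 => ?_⟩,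
      fun r h17 h18 h19 => hg.1 ⟨h17, h18, h19⟩⟩
    obtain ⟨s, h19, h20, h21⟩ := hg.exists_between h18
    exact h19.2.2 y h17 h20
  obtain ⟨a₃, b₃, h12, h13, h14, h15⟩ := hβ.exists_Ioo_contAt h8
  obtain ⟨t₁, h16, h17⟩ := exists_between h13
  have h18 := (h11 t₁ (h12.trans_lt h16) (h17.trans_le h14)).1
  obtain ⟨c, hc, hc'⟩ := exists_between h18
  obtain ⟨d, hd, hd'⟩ := exists_between hc'
  have h19 := h5 t₁ (h6.trans (h12.trans_lt h16)) (h17.trans_le (h14.trans h9))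
  obtain ⟨b₄, h20, h21, h22⟩ := exists_Ioo_of_rgt h17
    ((h19.1.2 c hc).and ((h15 t₁ h16 h17).1.1 d hd'))
  refine ⟨t₁, b₄, c, d, h2.trans (h6.trans (h12.trans_lt h16)).le, h20,
    h21.trans (h14.trans (h9.trans h4)), hd, fun t y h23 h24 h25 h26 => ?_⟩
  exact (h11 t ((h12.trans_lt h16).trans h23) (h24.trans_le (h21.trans h14))).2 y
    ((h22 t h23 h24).1.trans h25) (h26.trans (h22 t h23 h24).2)

theorem exists_box {R : X × Y → Prop} (hR : DFn S R) {a b : X}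
    (hab : a < b) (h : ∀ t, a < t → t < b → {y | R (t, y)}.Infinite) :
    ∃ a' b' c d, a ≤ a' ∧ a' < b' ∧ b' ≤ b ∧ c < d ∧
      ∀ t y, a' < t → t < b' → c < y → y < d → R (t, y) := by
  obtain ⟨t₀, h1, h2⟩ := exists_between hab
  obtain ⟨e₀, -⟩ := (h t₀ h1 h2).nonempty
  have hinf : ∀ {t}, (∃ u v, e₀ ≤ u ∧ u < v ∧ ∀ y, u < y → y < v → R (t, y)) →
      {y | e₀ < y ∧ R (t, y)}.Infinite := by
    rintro t ⟨u, v, h1, h2, h3⟩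
    exact Set.infinite_of_Ioo_subset h2 fun y h4 h5 => ⟨h1.trans_lt h4, h3 y h4 h5⟩
  rcases (DUF.rgt (S := S) a).ultra
    (P := fun t => ∃ u v, e₀ ≤ u ∧ u < v ∧ ∀ y, u < y → y < v → R (t, y)) (by fun_prop) with h3 | h3
  · obtain ⟨b', h4, h5, h6⟩ := exists_Ioo_of_rgt hab h3
    obtain ⟨a₁, b₁, c, d, h7, h8, h9, h10⟩ :=
      exists_box_of_gt hR h4 (e₀ := e₀) fun t h7 h8 => hinf (h6 t h7 h8)
    exact ⟨a₁, b₁, c, d, h7, h8, h9.trans h5, h10⟩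
  · obtain ⟨b', h4, h5, h6⟩ := exists_Ioo_of_rgt hab h3
    obtain ⟨a₁, b₁, c, d, h7, h8, h9, h10, h11⟩ :=
      exists_box_of_gt (Y := Yᵒᵈ) (R := fun p => R (p.1, OrderDual.ofDual p.2)) (by fun_prop) h4
        (e₀ := OrderDual.toDual e₀) fun t h7 h8 => by
        intro hfin
        obtain ⟨u, v, huv, h9⟩ := exists_Ioo_of_infinite (S := S)
          (P := fun y => R (t, y)) (by fun_prop) (h t h7 (h8.trans_le h5))
        refine h6 t h7 h8 ?_
        rcases le_or_gt v e₀ with hv | hv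
        · exact (Set.infinite_of_Ioo_subset huv (s := {y | y < e₀ ∧ R (t, y)})
            (fun y h10 h11 => ⟨h11.trans_le hv, h9 y h10 h11⟩) hfin).elim
        · exact ⟨max e₀ u, v, le_max_left _ _, max_lt hv huv,
            fun y h10 h11 => h9 y ((le_max_right _ _).trans_lt h10) h11⟩
    exact ⟨a₁, b₁, OrderDual.ofDual d, OrderDual.ofDual c, h7, h8, h9.trans h5, h10,
      fun t y h12 h13 h14 h15 => h11 t (OrderDual.toDual y) h12 h13 h15 h14⟩

theorem exists_local_choice {R : X × Y → Prop} (hR : DFn S R) {a b : X}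
    (hab : a < b) (h : ∀ t, a < t → t < b → ∃ y, R (t, y)) :
    ∃ f : X → Y, DFn S f ∧ ∃ a' b', a ≤ a' ∧ a' < b' ∧ b' ≤ b ∧
      ∀ t, a' < t → t < b' → R (t, f t) := by
  obtain ⟨t₀, h1, h2⟩ := exists_between hab
  obtain ⟨e₀, -⟩ := h t₀ h1 h2
  have : Nonempty Y := ⟨e₀⟩
  rcases (DUF.rgt (S := S) a).ultra
    (P := fun t => ∃ u v, u < v ∧ ∀ y, u < y → y < v → R (t, y)) (by fun_prop) with h3 | h3 <;>
  obtain ⟨b', h4, h5, h6⟩ := exists_Ioo_of_rgt hab h3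
  · obtain ⟨a₁, b₁, c, d, h7, h8, h9, h10, h11⟩ := exists_box hR h4 fun t h7 h8 => by
      obtain ⟨u, v, huv, h9⟩ := h6 t h7 h8
      exact Set.infinite_of_Ioo_subset huv h9
    obtain ⟨y, hy, hy'⟩ := exists_between h10
    exact ⟨fun _ => y, by fun_prop, a₁, b₁, h7, h8, h9.trans h5, fun t h12 h13 => h11 t y h12 h13 hy hy'⟩
  · obtain ⟨f, hf, h7⟩ := DFn.exists_min_choice (S := S)
      (R := fun t y => (∀ u v, u < v → ∃ y, u < y ∧ y < v ∧ ¬ R (t, y)) ∧ R (t, y))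
      (by fun_prop) (fun t => by
        by_contra hc
        obtain ⟨u, v, huv, h⟩ := exists_Ioo_of_infinite (S := S) (by fun_prop) hc
        obtain ⟨y, h1, h2⟩ := exists_between huv
        obtain ⟨z, h3, h4, h5⟩ := (h y h1 h2).1 u v huv
        exact h5 (h z h3 h4).2)
    refine ⟨f, hf, a, b', le_rfl, h4, h5, fun t h8 h9 => ?_⟩
    obtain ⟨y, hy⟩ := h t h8 (h9.trans_le h5)
    have h10 := h6 t h8 h9
    push Not at h10
    exact (h7 t ⟨y, h10, hy⟩).1.2

end DFn
end Planar

section UniformFiniteness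

variable {N : Type u} [LinearOrder N] {S : Struc N}
variable {X : Type v} [LinearOrder X] [DenselyOrdered X] [NoMinOrder X] [NoMaxOrder X]
  [DSpace S X] [OMin S X]
variable {Y : Type w} [LinearOrder Y] [DenselyOrdered Y] [NoMinOrder Y] [NoMaxOrder Y]
  [DSpace S Y] [OMin S Y]

open OMin

/-- Near `y`, the fibres of `A` along `F` look like the fibre `B`. -/
def NiceAt {T : Type*} (F : Filter T) (A : T × Y → Prop) (B : Y → Prop) (y : Y) : Prop :=
  ∃ u v, u < y ∧ y < v ∧ ∀ u' v', u ≤ u' → u' < y → y < v' → v' ≤ v → ∀ᶠ t in F,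
    (B y → ∃ z, u' < z ∧ z < v' ∧ A (t, z) ∧ ∀ z', u' < z' → z' < v' → A (t, z') → z' = z) ∧
    (¬ B y → ∀ z, u' < z → z < v' → ¬ A (t, z))

theorem Finset.exists_disjoint_Ioo (B : Finset Y) (u v : Y → Y)
    (huv : ∀ y ∈ B, u y < y ∧ y < v y) : ∃ u' v' : Y → Y,
    (∀ y ∈ B, u y ≤ u' y ∧ u' y < y ∧ y < v' y ∧ v' y ≤ v y) ∧
    ∀ y ∈ B, ∀ z ∈ B, ∀ x, u' y < x → x < v' y → u' z < x → x < v' z → y = z := by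
  let _ : TopologicalSpace Y := Preorder.topology Y
  have : OrderTopology Y := ⟨rfl⟩
  obtain ⟨U, hU, hd⟩ := B.finite_toSet.t2_separation
  have : ∀ y ∈ B, ∃ p : Y × Y, u y ≤ p.1 ∧ p.1 < y ∧ y < p.2 ∧ p.2 ≤ v y ∧ Set.Ioo p.1 p.2 ⊆ U y := by
    intro y hy
    obtain ⟨l, r, hl, hr⟩ := mem_nhds_iff_exists_Ioo_subset.1 ((hU y).2.mem_nhds (hU y).1)
    exact ⟨(max (u y) l, min (v y) r), le_max_left _ _, max_lt (huv y hy).1 hl.1,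
      lt_min (huv y hy).2 hl.2, min_le_left _ _,
      (Set.Ioo_subset_Ioo (le_max_right _ _) (min_le_right _ _)).trans hr⟩
  choose! p hp using this
  refine ⟨fun y => (p y).1, fun y => (p y).2, fun y hy =>
    ⟨(hp y hy).1, (hp y hy).2.1, (hp y hy).2.2.1, (hp y hy).2.2.2.1⟩, ?_⟩
  intro y hy z hz x h1 h2 h3 h4
  by_contra hne
  exact Set.disjoint_left.1 (hd hy hz hne) ((hp y hy).2.2.2.2 ⟨h1, h2⟩)
    ((hp z hz).2.2.2.2 ⟨h3, h4⟩)

theorem DUF.eventually_ncard_eq {T : Type*} [DSpace S T] {F : Filter T} (hF : DUF S F)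
    {A : T × Y → Prop} (hA : DFn S A) (hfin : ∀ t, {y | A (t, y)}.Finite) (B : Finset Y)
    (hb : ∃ u v, ∀ᶠ t in F, ∀ y, A (t, y) → u < y ∧ y < v)
    (hn : ∀ y, NiceAt F A (· ∈ B) y) : ∀ᶠ t in F, {y | A (t, y)}.ncard = B.card := by
  have := hF.neBot
  choose u v huv using hn
  obtain ⟨u', v', h1, h2⟩ := B.exists_disjoint_Ioo u v fun y _ => ⟨(huv y).1, (huv y).2.1⟩
  have h3 : ∀ᶠ t in F, ∀ y ∈ B, ∃ z, u' y < z ∧ z < v' y ∧ A (t, z) ∧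
      ∀ z', u' y < z' → z' < v' y → A (t, z') → z' = z := by
    refine (Filter.eventually_all_finset B).2 fun y hy => ?_
    obtain ⟨h4, h5, h6, h7⟩ := h1 y hy
    filter_upwards [(huv y).2.2 _ _ h4 h5 h6 h7] with t ht using ht.1 hy
  have hdef : ∀ B' : Finset Y, DFn S (fun p : T × Y => ∀ y ∈ B', ¬ (u' y < p.2 ∧ p.2 < v' y)) := by
    intro B'
    have := DFn.finite_all (S := S) (α := B')
      (P := fun y (p : T × Y) => ¬ (u' y.1 < p.2 ∧ p.2 < v' y.1)) (fun y => by fun_prop)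
    exact this.congr fun p => ⟨fun h y => h y.1 y.2, fun h y hy => h ⟨y, hy⟩⟩
  have hB := hdef B
  have h4 : ∀ᶠ t in F, ∀ z, A (t, z) → ∃ y ∈ B, u' y < z ∧ z < v' y := by
    have hQ : DFn S (fun t => ∃ z, A (t, z) ∧ ∀ y ∈ B, ¬ (u' y < z ∧ z < v' y)) := by
      refine DFn.ex (P := fun t z => A (t, z) ∧ ∀ y ∈ B, ¬ (u' y < z ∧ z < v' y)) ?_
      exact DFn.and (by fun_prop) hB
    rcases hF.ultra hQ with h | h
    · exfalso
      have : Nonempty Y := by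
        obtain ⟨t, y, -⟩ := h.exists
        exact ⟨y⟩
      obtain ⟨g, hg, hg'⟩ := DFn.exists_min_choice (S := S)
        (R := fun t z => A (t, z) ∧ ∀ y ∈ B, ¬ (u' y < z ∧ z < v' y)) (DFn.and (by fun_prop) hB)
        (fun t => (hfin t).subset fun y hy => hy.1)
      obtain ⟨lo, hi, hb⟩ := hb
      obtain ⟨y, hy⟩ := hF.exists_limAt hg (lo := lo) (hi := hi)
        (by filter_upwards [h, hb] with t h5 h6 using (h6 _ (hg' t h5).1.1).1)
        (by filter_upwards [h, hb] with t h5 h6 using (h6 _ (hg' t h5).1.1).2.le)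
      by_cases hyB : y ∈ B
      · obtain ⟨h4, h5, h6, h7⟩ := h1 y hyB
        obtain ⟨t, ht⟩ := (h.and ((hy.1 _ h5).and (hy.2 _ h6))).exists
        exact (hg' t ht.1).1.2 y hyB ht.2
      · obtain ⟨h5, h6, h7⟩ := huv y
        obtain ⟨t, ht⟩ := (h.and (((hy.1 _ h5).and (hy.2 _ h6)).and
          (h7 _ _ le_rfl h5 h6 le_rfl))).exists
        exact ht.2.2.2 hyB _ ht.2.1.1 ht.2.1.2 (hg' t ht.1).1.1
    · filter_upwards [h] with t ht z hz
      by_contra! hc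
      exact ht ⟨z, hz, fun y hy h => (hc y hy h.1).not_gt h.2⟩
  filter_upwards [h3, h4] with t h5 h6
  choose! g hg using h5
  rw [← Set.ncard_coe_finset B]
  symm
  refine Set.ncard_congr (fun y _ => g y) (fun y hy => (hg y hy).2.2.1) ?_ ?_
  · intro y z hy hz h
    exact h2 y hy z hz (g y) (hg y hy).1 (hg y hy).2.1 (h ▸ (hg z hz).1) (h ▸ (hg z hz).2.1)
  · intro z hz
    obtain ⟨y, hy, h7, h8⟩ := h6 z hz
    exact ⟨y, hy, ((hg y hy).2.2.2 z h7 h8 hz).symm⟩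

theorem DFn.finite_not_nice {A : X × Y → Prop} (hA : DFn S A) (hfin : ∀ t, {y | A (t, y)}.Finite) :
    {t | ¬ ∀ y, NiceAt (rgt t) A (fun y => A (t, y)) y ∧
      NiceAt (lft t) A (fun y => A (t, y)) y}.Finite := by
  have hdef : DFn S (fun p : X × Y => NiceAt (rgt p.1) A (fun y => A (p.1, y)) p.2 ∧
      NiceAt (lft p.1) A (fun y => A (p.1, y)) p.2) := by
    unfold NiceAt
    simp only [eventually_rgt, eventually_lft]
    fun_prop
  have hdef' : DFn S (fun t : X => ∀ y, NiceAt (rgt t) A (fun y => A (t, y)) y ∧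
      NiceAt (lft t) A (fun y => A (t, y)) y) := by fun_prop
  by_contra hc
  obtain ⟨a, b, hab, h1⟩ := exists_Ioo_of_infinite (S := S) hdef'.not hc
  simp only [not_forall] at h1
  obtain ⟨β, hβ, a₁, b₁, h2, h3, h4, h5⟩ := DFn.exists_local_choice hdef.not hab h1
  have : Nonempty Y := ⟨β a⟩
  obtain ⟨l, hl, hl'⟩ := DFn.exists_max_choice (S := S) (R := fun t y => A (t, y) ∧ y < β t)
    (by fun_prop) (fun t => (hfin t).subset fun y hy => hy.1)
  obtain ⟨r, hr, hr'⟩ := DFn.exists_min_choice (S := S) (R := fun t y => A (t, y) ∧ β t < y)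
    (by fun_prop) (fun t => (hfin t).subset fun y hy => hy.1)
  obtain ⟨a₂, b₂, h6, h7, h8, hβc⟩ := hβ.exists_Ioo_contAt h3
  obtain ⟨a₃, b₃, h9, h10, h11, hlc⟩ := hl.exists_Ioo_contAt h7
  obtain ⟨a₄, b₄, h12, h13, h14, hrc⟩ := hr.exists_Ioo_contAt h10
  have hdec : ∀ {P : X → Prop}, DFn S P → ∀ {c}, a₄ < c →
      ∃ c', a₄ < c' ∧ c' ≤ c ∧ ((∀ t, a₄ < t → t < c' → P t) ∨ ∀ t, a₄ < t → t < c' → ¬ P t) := by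
    intro P hP c hc
    rcases (DUF.rgt (S := S) a₄).ultra hP with h | h
    · obtain ⟨c', h1, h2, h3⟩ := exists_Ioo_of_rgt hc h
      exact ⟨c', h1, h2, .inl h3⟩
    · obtain ⟨c', h1, h2, h3⟩ := exists_Ioo_of_rgt hc h
      exact ⟨c', h1, h2, .inr h3⟩
  obtain ⟨c₁, hc₁, hc₁', hA'⟩ := hdec (P := fun t => A (t, β t)) (by fun_prop) h13
  obtain ⟨c₂, hc₂, hc₂', hL⟩ := hdec (P := fun t => ∃ y, A (t, y) ∧ y < β t) (by fun_prop) hc₁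
  obtain ⟨c₃, hc₃, hc₃', hR⟩ := hdec (P := fun t => ∃ y, A (t, y) ∧ β t < y) (by fun_prop) hc₂
  obtain ⟨t, ht, ht'⟩ := exists_between hc₃
  have hβt := hβc t (h9.trans_lt (h12.trans_lt ht))
    (ht'.trans_le (hc₃'.trans (hc₂'.trans (hc₁'.trans (h14.trans h11)))))
  have hlt := hlc t (h12.trans_lt ht) (ht'.trans_le (hc₃'.trans (hc₂'.trans (hc₁'.trans h14))))
  have hrt := hrc t ht (ht'.trans_le (hc₃'.trans (hc₂'.trans hc₁')))
  have main : ∀ {F : Filter X}, (∀ᶠ s in F, a₄ < s ∧ s < c₃) → LimAt F β (β t) →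
      LimAt F l (l t) → LimAt F r (r t) → NiceAt F A (fun y => A (t, y)) (β t) := by
    intro F hF h1 h2 h3
    have hu : ∃ u, u < β t ∧ ∀ᶠ s in F, ∀ y, A (s, y) → y < β s → y < u := by
      rcases hL with hL | hL
      · obtain ⟨u, h4, h5⟩ := exists_between (hl' t (hL t ht (ht'.trans_le hc₃'))).1.2
        refine ⟨u, h5, ?_⟩
        filter_upwards [hF, h2.2 u h4] with s hs h6 y h7 h8
        exact ((hl' s ⟨y, h7, h8⟩).2 y ⟨h7, h8⟩).trans_lt h6
      · obtain ⟨u, hu⟩ := exists_lt (β t)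
        refine ⟨u, hu, ?_⟩
        filter_upwards [hF] with s hs y h7 h8
        exact (hL s hs.1 (hs.2.trans_le hc₃') ⟨y, h7, h8⟩).elim
    have hv : ∃ v, β t < v ∧ ∀ᶠ s in F, ∀ y, A (s, y) → β s < y → v < y := by
      rcases hR with hR | hR
      · obtain ⟨u, h4, h5⟩ := exists_between (hr' t (hR t ht ht')).1.2
        refine ⟨u, h4, ?_⟩
        filter_upwards [hF, h3.1 u h5] with s hs h6 y h7 h8
        exact h6.trans_le ((hr' s ⟨y, h7, h8⟩).2 y ⟨h7, h8⟩)
      · obtain ⟨u, hu⟩ := exists_gt (β t)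
        refine ⟨u, hu, ?_⟩
        filter_upwards [hF] with s hs y h7 h8
        exact (hR s hs.1 hs.2 ⟨y, h7, h8⟩).elim
    obtain ⟨u, hu, hu'⟩ := hu
    obtain ⟨v, hv, hv'⟩ := hv
    refine ⟨u, v, hu, hv, fun u' v' h4 h5 h6 h7 => ?_⟩
    filter_upwards [hF, hu', hv', h1.1 u' h5, h1.2 v' h6] with s hs hsu hsv h8 h9
    have key : ∀ z, u' < z → z < v' → A (s, z) → z = β s := fun z h10 h11 h12 => by
      rcases lt_trichotomy z (β s) with h | h | h
      · exact (lt_asymm (hsu z h12 h) (h4.trans_lt h10)).elim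
      · exact h
      · exact (lt_asymm (hsv z h12 h) (h11.trans_le h7)).elim
    refine ⟨fun h => ⟨β s, h8, h9, ?_, key⟩, fun h z h10 h11 h12 => h ?_⟩
    · rcases hA' with hA' | hA'
      · exact hA' s hs.1 (hs.2.trans_le (hc₃'.trans hc₂'))
      · exact (hA' t ht (ht'.trans_le (hc₃'.trans hc₂')) h).elim
    · rcases hA' with hA' | hA'
      · exact hA' t ht (ht'.trans_le (hc₃'.trans hc₂'))
      · exact (hA' s hs.1 (hs.2.trans_le (hc₃'.trans hc₂')) (key z h10 h11 h12 ▸ h12)).elim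
  refine h5 t (h6.trans_lt (h9.trans_lt (h12.trans_lt ht)))
    (ht'.trans_le (hc₃'.trans (hc₂'.trans (hc₁'.trans (h14.trans (h11.trans h8)))))) ⟨?_, ?_⟩
  · exact main (eventually_rgt.2 ⟨c₃, ht', fun s h1 h2 => ⟨ht.trans h1, h2⟩⟩) hβt.1 hlt.1 hrt.1
  · exact main (eventually_lft.2 ⟨a₄, ht, fun s h1 h2 => ⟨h1, h2.trans ht'⟩⟩) hβt.2 hlt.2 hrt.2

theorem DFn.finite_not_bdd [hY : Nonempty Y] {A : X × Y → Prop} (hA : DFn S A) (hfin : ∀ t, {y | A (t, y)}.Finite) :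
    {t | ¬ ∃ u v, (∀ᶠ s in rgt t, ∀ y, A (s, y) → u < y ∧ y < v) ∧
      ∀ᶠ s in lft t, ∀ y, A (s, y) → u < y ∧ y < v}.Finite := by
  have hdef : DFn S (fun t : X => ∃ u v, (∀ᶠ s in rgt t, ∀ y, A (s, y) → u < y ∧ y < v) ∧
      ∀ᶠ s in lft t, ∀ y, A (s, y) → u < y ∧ y < v) := by
    simp only [eventually_rgt, eventually_lft]
    fun_prop
  obtain ⟨l, hl, hl'⟩ := DFn.exists_min_choice (S := S) (R := fun t y => A (t, y))
    (by fun_prop) hfin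
  obtain ⟨r, hr, hr'⟩ := DFn.exists_max_choice (S := S) (R := fun t y => A (t, y))
    (by fun_prop) hfin
  refine (hl.finite_not_contAt.union hr.finite_not_contAt).subset fun t ht => ?_
  by_contra hc
  simp only [Set.mem_union, Set.mem_ofPred_eq, not_or, not_not] at hc
  obtain ⟨u, hu⟩ := exists_lt (l t)
  obtain ⟨v, hv⟩ := exists_gt (r t)
  refine ht ⟨u, v, ?_, ?_⟩
  · filter_upwards [hc.1.1.1 u hu, hc.2.1.2 v hv] with s h1 h2 y hy
    exact ⟨h1.trans_le ((hl' s ⟨y, hy⟩).2 y hy), ((hr' s ⟨y, hy⟩).2 y hy).trans_lt h2⟩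
  · filter_upwards [hc.1.2.1 u hu, hc.2.2.2 v hv] with s h1 h2 y hy
    exact ⟨h1.trans_le ((hl' s ⟨y, hy⟩).2 y hy), ((hr' s ⟨y, hy⟩).2 y hy).trans_lt h2⟩

theorem DFn.ncard_eq_def {T : Type*} [DSpace S T] {A : T × Y → Prop} (hA : DFn S A)
    (hfin : ∀ t, {y | A (t, y)}.Finite) (n : ℕ) :
    DFn S (fun t => {y | A (t, y)}.ncard = n) := by
  have h1 : DFn S (fun t => ∃ c : Fin n → Y, (∀ i : Fin n, ∀ j : Fin n, c i = c j → i = j) ∧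
      ∀ y, A (t, y) ↔ ∃ i : Fin n, c i = y) := by
    refine DFn.ex (P := fun t (c : Fin n → Y) => (∀ i : Fin n, ∀ j : Fin n, c i = c j → i = j) ∧
      ∀ y, A (t, y) ↔ ∃ i : Fin n, c i = y) (DFn.and ?_ ?_)
    · exact DFn.finite_all fun i => DFn.finite_all fun j => by fun_prop
    · have : DFn S (fun p : (T × (Fin n → Y)) × Y => ∃ i : Fin n, p.1.2 i = p.2) :=
        (DFn.finite_all (P := fun (i : Fin n) (p : (T × (Fin n → Y)) × Y) => ¬ p.1.2 i = p.2)
          fun i => by fun_prop).not.congr fun p => by simp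
      fun_prop
  refine h1.congr fun t => ⟨fun h => ?_, ?_⟩
  · have e := (hfin t).toFinset.equivFinOfCardEq ((Set.ncard_eq_toFinset_card _ (hfin t)).symm.trans h)
    refine ⟨fun i => (e.symm i).1, fun i j h => e.symm.injective (Subtype.ext h), fun y => ?_⟩
    refine ⟨fun hy => ⟨e ⟨y, by simpa using hy⟩, by simp⟩, ?_⟩
    rintro ⟨i, rfl⟩
    exact (hfin t).mem_toFinset.1 (e.symm i).2
  · rintro ⟨c, h1, h2⟩
    have : {y | A (t, y)} = Set.range c := by
      ext y
      exact h2 y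
    rw [this, ← Set.image_univ, Set.ncard_image_of_injective _ fun i j h => h1 i j h, Set.ncard_univ,
      Nat.card_fin]

theorem DFn.uniform_finiteness {A : X × Y → Prop} (hA : DFn S A)
    (hfin : ∀ t, {y | A (t, y)}.Finite) : ∃ K, ∀ t, {y | A (t, y)}.ncard ≤ K := by
  classical
  rcases isEmpty_or_nonempty Y with hY | hY
  · exact ⟨0, fun t => by simp [Set.eq_empty_of_isEmpty]⟩
  have hbad := (hA.finite_not_nice hfin).union (hA.finite_not_bdd hfin)
  set F := hbad.toFinset with hF
  have hgood : ∀ t, t ∉ F → (∀ᶠ s in rgt t, {y | A (s, y)}.ncard = {y | A (t, y)}.ncard) ∧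
      ∀ᶠ s in lft t, {y | A (s, y)}.ncard = {y | A (t, y)}.ncard := by
    intro t ht
    simp only [hF, Finite.mem_toFinset, Set.mem_union, Set.mem_ofPred_eq, not_or, not_not] at ht
    obtain ⟨h1, u, v, h2, h3⟩ := ht
    rw [Set.ncard_eq_toFinset_card _ (hfin t)]
    have h4 : ∀ y, y ∈ (hfin t).toFinset ↔ A (t, y) := fun y => by simp
    refine ⟨(DUF.rgt (S := S) t).eventually_ncard_eq hA hfin _ ⟨u, v, h2⟩ ?_,
      (DUF.lft (S := S) t).eventually_ncard_eq hA hfin _ ⟨u, v, h3⟩ ?_⟩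
    · simpa only [h4] using fun y => (h1 y).1
    · simpa only [h4] using fun y => (h1 y).2
  have key : ∀ x y, x ≤ y → (∀ z, x ≤ z → z ≤ y → z ∉ F) →
      {z | A (y, z)}.ncard = {z | A (x, z)}.ncard := by
    intro x y hxy h
    refine OMin.Icc_induction (S := S) (Q := fun t => {z | A (t, z)}.ncard = {z | A (x, z)}.ncard)
      (x := x) (y := y) (hA.ncard_eq_def hfin _) rfl ?_ ?_ y hxy le_rfl
    · intro z h1 h2 h3
      rw [← h3]
      exact (hgood z (h z h1 h2.le)).1
    · intro z h1 h2 h3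
      obtain ⟨l, hl, h4⟩ := eventually_lft.1 (hgood z (h z h1.le h2)).2
      obtain ⟨s, h5, h6⟩ := exists_between (max_lt hl h1)
      rw [← h4 s ((le_max_left _ _).trans_lt h5) h6]
      exact h3 s ((le_max_right _ _).trans h5.le) h6
  have key2 : ∀ x y, x ∉ F → y ∉ F → F.filter (· < x) = F.filter (· < y) →
      {z | A (y, z)}.ncard = {z | A (x, z)}.ncard := by
    have : ∀ x y, x ∉ F → y ∉ F → F.filter (· < x) = F.filter (· < y) →
        ∀ z, x ≤ z → z ≤ y → z ∉ F := by
      intro x y hx hy h z h1 h2 hz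
      have h1' := h1.lt_of_ne fun e => hx (e ▸ hz)
      have h2' := h2.lt_of_ne fun e => hy (e ▸ hz)
      have h3 : z ∈ F.filter (· < x) := h ▸ Finset.mem_filter.2 ⟨hz, h2'⟩
      exact h1'.not_gt (Finset.mem_filter.1 h3).2
    intro x y hx hy h
    rcases le_total x y with h1 | h1
    · exact key x y h1 (this x y hx hy h)
    · exact (key y x h1 (this y x hy hx h.symm)).symm
  obtain ⟨K₁, hK₁⟩ : ∃ K, ∀ s ∈ F.powerset, ∀ t, t ∉ F → F.filter (· < t) = s →
      {y | A (t, y)}.ncard ≤ K := by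
    have : ∀ s, ∃ K, ∀ t, t ∉ F → F.filter (· < t) = s → {y | A (t, y)}.ncard ≤ K := by
      intro s
      by_cases h : ∃ t, t ∉ F ∧ F.filter (· < t) = s
      · obtain ⟨t, h1, h2⟩ := h
        exact ⟨_, fun t' h3 h4 => (key2 t t' h1 h3 (h2.trans h4.symm)).le⟩
      · exact ⟨0, fun t h1 h2 => (h ⟨t, h1, h2⟩).elim⟩
    choose K hK using this
    exact ⟨F.powerset.sup K, fun s hs t h1 h2 => (hK s t h1 h2).trans (Finset.le_sup hs)⟩
  refine ⟨max K₁ (F.sup fun t => {y | A (t, y)}.ncard), fun t => ?_⟩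
  by_cases ht : t ∈ F
  · exact (Finset.le_sup (f := fun t => {y | A (t, y)}.ncard) ht).trans (le_max_right _ _)
  · exact (hK₁ _ (by simp) t ht rfl).trans (le_max_left _ _)

end UniformFiniteness

section Charts

variable {N : Type u} [LinearOrder N] [DenselyOrdered N] [NoMinOrder N] [NoMaxOrder N]
  [Nonempty N] {S : Struc N}

open OMin

/-- A definable subset of `N^m` none of whose projections to two coordinates has interior is
a finite disjoint union of definable sets on each of which some coordinate is injective. -/
theorem exists_charts {m : ℕ} [NeZero m] {C : (Fin m → N) → Prop} (hC : DFn S C)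
    (hdim : ∀ i k, i ≠ k → ∀ a b c d : N, a < b → c < d →
      ∃ x y, a < x ∧ x < b ∧ c < y ∧ y < d ∧ ∀ g, C g → g i = x → g k ≠ y) :
    ∃ (n : ℕ) (X : Fin n → (Fin m → N) → Prop) (c : Fin n → Fin m), (∀ j, DFn S (X j)) ∧
      (∀ j g, X j g → C g) ∧ (∀ g, C g → ∃! j, X j g) ∧
      ∀ j g h, X j g → X j h → g (c j) = h (c j) → g = h := by
  classical
  set R : Fin m → Fin m → N × N → Prop := fun i k p => ∃ g : Fin m → N, C g ∧ g i = p.1 ∧ g k = p.2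
    with hR
  have hRd : ∀ i k, DFn S (R i k) := fun i k => by
    simp only [hR]
    fun_prop
  set W : Fin m → Fin m → N → Prop := fun i k t =>
    ∃ a b, a < b ∧ ∀ y, a < y → y < b → R i k (t, y) with hW
  have hWd : ∀ i k, DFn S (W i k) := fun i k => by
    have := hRd i k
    simp only [hW]
    fun_prop
  have hWfin : ∀ i k, i ≠ k → {t | W i k t}.Finite := by
    intro i k hik
    by_contra hinf
    obtain ⟨a, b, hab, h⟩ := exists_Ioo_of_infinite (S := S) (hWd i k) hinf
    obtain ⟨a', b', c, d, h1, h2, h3, h4, h5⟩ := DFn.exists_box (hRd i k) hab fun t h1 h2 => by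
      obtain ⟨u, v, huv, h3⟩ := h t h1 h2
      exact Set.infinite_of_Ioo_subset huv h3
    obtain ⟨x, y, h6, h7, h8, h9, h10⟩ := hdim i k hik a' b' c d h2 h4
    obtain ⟨g, h11, h12, h13⟩ := h5 x y h6 h7 h8 h9
    exact h10 g h11 h12 h13
  set A : Fin m → Fin m → N × N → Prop := fun i k p => R i k p ∧ ¬ W i k p.1 with hA
  have hAd : ∀ i k, DFn S (A i k) := fun i k => by
    have := hRd i k
    have := hWd i k
    simp only [hA]
    fun_prop
  have hAfin : ∀ i k t, {y | A i k (t, y)}.Finite := by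
    intro i k t
    by_contra hinf
    obtain ⟨a, b, hab, h⟩ := exists_Ioo_of_infinite (S := S)
      (P := fun y => A i k (t, y)) ((hAd i k).comp (by fun_prop)) hinf
    obtain ⟨y, h1, h2⟩ := exists_between hab
    exact (h y h1 h2).2 ⟨a, b, hab, fun y h1 h2 => (h y h1 h2).1⟩
  choose K hK using fun i k => (hAd i k).uniform_finiteness (hAfin i k)
  obtain ⟨K₁, hK₁⟩ : ∃ K₁, ∀ i k, K i k ≤ K₁ :=
    ⟨Finset.univ.sup fun p : Fin m × Fin m => K p.1 p.2, fun i k =>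
      Finset.le_sup (f := fun p : Fin m × Fin m => K p.1 p.2) (Finset.mem_univ (i, k))⟩
  set C₀ : Set (Fin m → N) := {g | C g ∧ ∀ i, ∃ k, k ≠ i ∧ W i k (g i)} with hC₀
  have hC₀fin : C₀.Finite := by
    refine (Set.Finite.pi' (ι := Fin m) (t := fun i => ⋃ k ∈ {k | k ≠ i}, {t | W i k t})
      fun i => (Set.toFinite _).biUnion fun k hk => hWfin i k (Ne.symm hk)).subset ?_
    intro g hg i
    obtain ⟨k, hk, h⟩ := hg.2 i
    exact Set.mem_biUnion (x := k) hk h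
  have := hC₀fin.to_subtype
  set J := (Fin m × (Fin m → Fin (K₁ + 1))) ⊕ C₀ with hJ
  set X₀ : J → (Fin m → N) → Prop := fun j g => C g ∧ Sum.elim
    (fun p => ∀ k, k ≠ p.1 → ¬ W p.1 k (g p.1) ∧
      {y | A p.1 k (g p.1, y) ∧ y < g k}.ncard = p.2 k) (fun h => g = h.1) j with hX₀
  set c₀ : J → Fin m := fun j => Sum.elim Prod.fst (fun _ => 0) j with hc₀
  have hX₀d : ∀ j, DFn S (X₀ j) := by
    rintro (⟨i, r⟩ | h) <;> simp only [hX₀, Sum.elim_inl, Sum.elim_inr]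
    · refine hC.and (DFn.finite_all fun k => ?_)
      refine DFn.imp (by fun_prop) (DFn.and ((hWd i k).comp (by fun_prop)).not ?_)
      have := hAd i k
      exact DFn.ncard_eq_def (A := fun p : (Fin m → N) × N => A i k (p.1 i, p.2) ∧ p.2 < p.1 k)
        (by fun_prop) (fun t => (hAfin i k (t i)).subset fun y hy => hy.1) _
    · exact hC.and (DFn.eq (by fun_prop) (by fun_prop))
  have hX₀c : ∀ g, C g → ∃ j, X₀ j g := by
    intro g hg
    by_cases h : ∀ i, ∃ k, k ≠ i ∧ W i k (g i)
    · exact ⟨.inr ⟨g, hg, h⟩, hg, rfl⟩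
    · push Not at h
      obtain ⟨i, hi⟩ := h
      refine ⟨.inl ⟨i, fun k => ⟨{y | A i k (g i, y) ∧ y < g k}.ncard, ?_⟩⟩, hg, fun k hk =>
        ⟨hi k hk, rfl⟩⟩
      exact Nat.lt_succ_of_le ((Set.ncard_le_ncard (fun y hy => hy.1) (hAfin i k (g i))).trans
        ((hK i k _).trans (hK₁ i k)))
  have hX₀i : ∀ j g h, X₀ j g → X₀ j h → g (c₀ j) = h (c₀ j) → g = h := by
    rintro (⟨i, r⟩ | h) g g' hg hg' he
    · have hlt : ∀ g g', X₀ (.inl ⟨i, r⟩) g → X₀ (.inl ⟨i, r⟩) g' → g i = g' i → ∀ k, k ≠ i →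
          ¬ g k < g' k := by
        intro g g' hg hg' he k hk hlt
        have h1 := (hg.2 k hk).2.trans (hg'.2 k hk).2.symm
        have hfin : {y | A i k (g' i, y) ∧ y < g' k}.Finite :=
          (hAfin i k (g' i)).subset fun y hy => hy.1
        refine (Set.ncard_lt_ncard ⟨?_, fun hsub => ?_⟩ hfin).ne h1
        · intro y hy
          exact ⟨he ▸ hy.1, hy.2.trans hlt⟩
        · exact lt_irrefl _ (hsub (a := g k) ⟨⟨⟨g, hg.1, he, rfl⟩, (hg'.2 k hk).1⟩, hlt⟩).2
      funext k
      by_cases hk : k = i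
      · exact hk ▸ he
      · exact le_antisymm (le_of_not_gt (hlt g' g hg' hg he.symm k hk))
          (le_of_not_gt (hlt g g' hg hg' he k hk))
    · exact hg.2.trans hg'.2.symm
  obtain ⟨n, ⟨e⟩⟩ := Finite.exists_equiv_fin J
  refine ⟨n, fun j g => X₀ (e.symm j) g ∧ ∀ j', j' < j → ¬ X₀ (e.symm j') g, fun j => c₀ (e.symm j),
    fun j => (hX₀d _).and (DFn.finite_all fun j' => DFn.imp (by fun_prop) (hX₀d _).not),
    fun j g hg => hg.1.1, fun g hg => ?_, fun j g h hg hh => hX₀i _ g h hg.1 hh.1⟩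
  obtain ⟨j, hj⟩ := hX₀c g hg
  have hex : ∃ j, X₀ (e.symm j) g := ⟨e j, by simpa using hj⟩
  obtain ⟨j, hj, hmin⟩ := Set.exists_min_image {j | X₀ (e.symm j) g} (fun j => j) (Set.toFinite _) hex
  refine ⟨j, ⟨hj, fun j' hj' h => hj'.not_ge (hmin j' h)⟩, fun j' hj' => ?_⟩
  exact le_antisymm (le_of_not_gt fun h => hj'.2 j h hj) (hmin j' hj'.1)

end Charts

section Sum

variable {N : Type u} [LinearOrder N] [DenselyOrdered N] [NoMinOrder N] [NoMaxOrder N]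
  [Nonempty N] {S : Struc N}

/-- The definable structure pulled back along a map. -/
@[reducible]
def DSpace.induced {X : Type v} {Y : Type w} [DSpace S Y] (k : X → Y) : DSpace S X where
  plot c := DSpace.plot S (fun x => k (c x))
  plot_comp {_ _ _ _ c _} h hg := DSpace.plot_comp (c := fun z => k (c z)) h hg
  plot_const a := DSpace.plot_const (k a)

theorem OMin.of_sum {X Y M : Type*} [LinearOrder X] [LinearOrder Y] [LinearOrder M]
    [DSpace S X] [DSpace S Y] [DSpace S M] [OMin S X] [OMin S Y] [DSet S M]
    {f : X → M} {g : Y → M} {z : M} (hf : DFn S f) (hg : DFn S g) (mf : StrictMono f)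
    (mg : StrictMono g) (hfz : ∀ x, f x < z) (hgz : ∀ y, z < g y)
    (hc : ∀ m, (∃ x, f x = m) ∨ m = z ∨ ∃ y, g y = m) : OMin S M where
  lt_def := by
    have h : DFn S (fun p : M × M => (∃ x x', f x = p.1 ∧ f x' = p.2 ∧ x < x') ∨
        (∃ y y', g y = p.1 ∧ g y' = p.2 ∧ y < y') ∨ ((∃ x, f x = p.1) ∧ ¬ ∃ x, f x = p.2) ∨
        ((∃ y, g y = p.2) ∧ ¬ ∃ y, g y = p.1)) := by fun_prop
    refine h.congr fun p => ⟨fun hp => ?_, ?_⟩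
    · rcases hc p.1 with ⟨x, hx⟩ | hx | ⟨y, hy⟩
      · by_cases h2 : ∃ x, f x = p.2
        · obtain ⟨x', hx'⟩ := h2
          exact Or.inl ⟨x, x', hx, hx', mf.lt_iff_lt.1 (hx ▸ hx' ▸ hp)⟩
        · exact Or.inr (Or.inr (Or.inl ⟨⟨x, hx⟩, h2⟩))
      · rcases hc p.2 with ⟨x', h'⟩ | h' | h'
        · have := hfz x'; rw [h', ← hx] at this; exact absurd hp this.asymm
        · rw [hx, h'] at hp; exact absurd hp (lt_irrefl _)
        · refine Or.inr (Or.inr (Or.inr ⟨h', ?_⟩))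
          rintro ⟨y, hy⟩
          have := hgz y; rw [hy, hx] at this; exact lt_irrefl _ this
      · rcases hc p.2 with ⟨x', h'⟩ | h' | ⟨y', h'⟩
        · exact absurd ((hfz x').trans (hgz y)) (by rw [hy, h']; exact hp.asymm)
        · exact absurd (hgz y) (by rw [hy, ← h']; exact hp.asymm)
        · exact Or.inr (Or.inl ⟨y, y', hy, h', mg.lt_iff_lt.1 (hy ▸ h' ▸ hp)⟩)
    · rintro (⟨x, x', h1, h2, h3⟩ | ⟨x, x', h1, h2, h3⟩ | ⟨⟨x, hx⟩, h2⟩ | ⟨⟨y, hy⟩, h2⟩)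
      · rw [← h1, ← h2]; exact mf h3
      · rw [← h1, ← h2]; exact mg h3
      · rw [← hx]
        rcases hc p.2 with h | h | ⟨y, h⟩
        · exact absurd h h2
        · rw [h]; exact hfz x
        · rw [← h]; exact (hfz x).trans (hgz y)
      · rw [← hy]
        rcases hc p.1 with ⟨x, h⟩ | h | h
        · rw [← h]; exact (hfz x).trans (hgz y)
        · rw [h]; exact hgz y
        · exact absurd h h2
  omin {P} hP := by
    obtain ⟨F, hF⟩ := OMin.omin (S := S) (hP.comp hf)
    obtain ⟨K, hK⟩ := OMin.omin (S := S) (hP.comp hg)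
    classical
    refine ⟨insert z (F.image f ∪ K.image g), fun x y hxy h => ?_⟩
    have hz := h z (by simp)
    have hFf : ∀ t ∈ F, f t < x ∨ y < f t := fun t ht => h _ (by
      simp only [Finset.mem_insert, Finset.mem_union, Finset.mem_image]
      exact Or.inr (Or.inl ⟨t, ht, rfl⟩))
    have hKg : ∀ t ∈ K, g t < x ∨ y < g t := fun t ht => h _ (by
      simp only [Finset.mem_insert, Finset.mem_union, Finset.mem_image]
      exact Or.inr (Or.inr ⟨t, ht, rfl⟩))
    rcases hz with hz | hz
    · have aux : ∀ m, z < m → ∃ y, g y = m := by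
        intro m hm
        rcases hc m with ⟨x, h⟩ | h | h
        · rw [← h] at hm; exact absurd hm (hfz x).asymm
        · exact absurd hm (by rw [h]; exact lt_irrefl _)
        · exact h
      obtain ⟨x, rfl⟩ := aux x hz
      obtain ⟨y, rfl⟩ := aux y (hz.trans hxy)
      exact hK x y (mg.lt_iff_lt.1 hxy) fun t ht => by simpa [mg.lt_iff_lt] using hKg t ht
    · have aux : ∀ m, m < z → ∃ y, f y = m := by
        intro m hm
        rcases hc m with h | h | ⟨y, h⟩
        · exact h
        · exact absurd hm (by rw [h]; exact lt_irrefl _)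
        · rw [← h] at hm; exact absurd hm (hgz y).asymm
      obtain ⟨x, rfl⟩ := aux x (hxy.trans hz)
      obtain ⟨y, rfl⟩ := aux y hz
      exact hF x y (mf.lt_iff_lt.1 hxy) fun t ht => by simpa [mf.lt_iff_lt] using hFf t ht

/-- Two dense o-minimal orders can be placed side by side. -/
theorem OMin.exists_sum (X Y : Type u) [LinearOrder X] [DenselyOrdered X] [NoMinOrder X]
    [NoMaxOrder X] [Nonempty X] [DSpace S X] [OMin S X]
    [LinearOrder Y] [DenselyOrdered Y] [NoMinOrder Y]
    [NoMaxOrder Y] [Nonempty Y] [DSpace S Y] [OMin S Y] :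
    ∃ (M : Type u) (_ : LinearOrder M) (_ : DenselyOrdered M) (_ : NoMinOrder M)
      (_ : NoMaxOrder M) (_ : Nonempty M) (_ : DSpace S M) (_ : OMin S M) (f : X → M) (g : Y → M),
      DFn S f ∧ DFn S g ∧ f.Injective ∧ g.Injective ∧ ∀ x y, f x ≠ g y := by
  classical
  obtain ⟨a⟩ := ‹Nonempty N›
  obtain ⟨b, hb⟩ := exists_gt a
  obtain ⟨c, hc⟩ := exists_gt b
  obtain ⟨x₀⟩ := ‹Nonempty X›
  obtain ⟨y₀⟩ := ‹Nonempty Y›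
  let k : X ⊕ₗ (PUnit.{u+1} ⊕ₗ Y) → N × X × Y := fun m => Sum.elim (fun x => (a, x, y₀))
    (fun m' => Sum.elim (fun _ => (b, x₀, y₀)) (fun y => (c, x₀, y)) (ofLex m')) (ofLex m)
  let f : X → X ⊕ₗ (PUnit.{u+1} ⊕ₗ Y) := fun x => toLex (Sum.inl x)
  let z : X ⊕ₗ (PUnit.{u+1} ⊕ₗ Y) := toLex (Sum.inr (toLex (Sum.inl PUnit.unit)))
  let g : Y → X ⊕ₗ (PUnit.{u+1} ⊕ₗ Y) := fun y => toLex (Sum.inr (toLex (Sum.inr y)))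
  let _ : DSpace S (X ⊕ₗ (PUnit.{u+1} ⊕ₗ Y)) := DSpace.induced k
  have hk : DFn S k := ⟨fun _ h => h⟩
  have mk : ∀ {W : Type u} [DSpace S W] (h : W → X ⊕ₗ (PUnit.{u+1} ⊕ₗ Y)),
      DFn S (fun w => k (h w)) → DFn S h := fun h H => ⟨fun c hc => H.plot c hc⟩
  have hf : DFn S f := mk _ (show DFn S fun x => (a, x, y₀) by fun_prop)
  have hg : DFn S g := mk _ (show DFn S fun y => (c, x₀, y) by fun_prop)
  have cov : ∀ m, (∃ x, f x = m) ∨ m = z ∨ ∃ y, g y = m := by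
    rintro (x | _ | y)
    · exact Or.inl ⟨x, rfl⟩
    · exact Or.inr (Or.inl rfl)
    · exact Or.inr (Or.inr ⟨y, rfl⟩)
  have : DSet S (X ⊕ₗ (PUnit.{u+1} ⊕ₗ Y)) := by
    obtain ⟨ι, _, v, ρ, hv, hρ, e⟩ := DSet.code (S := S) (X := N × X × Y)
    let r : N × X × Y → X ⊕ₗ (PUnit.{u+1} ⊕ₗ Y) := fun q =>
      if q.1 = a then f q.2.1 else if q.1 = c then g q.2.2 else z
    have hr : DFn S r := by
      have h : DFn S (fun q : N × X × Y => if q.1 = a then (a, q.2.1, y₀) else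
          if q.1 = c then (c, x₀, q.2.2) else (b, x₀, y₀)) :=
        DFn.ite (by fun_prop) (by fun_prop) (DFn.ite (by fun_prop) (by fun_prop) (by fun_prop))
      refine mk _ ?_
      convert h using 2 with q
      simp only [r]
      split_ifs <;> rfl
    refine ⟨ι, inferInstance, fun m => v (k m), fun x => r (ρ x), by fun_prop, by fun_prop, ?_⟩
    intro m
    simp only [e]
    rcases cov m with ⟨x, rfl⟩ | rfl | ⟨y, rfl⟩
    · simp [r, k, f]
    · simp [r, k, z, hb.ne', hc.ne]
    · simp [r, k, g, (hb.trans hc).ne']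
  have hfz : ∀ x, f x < z := fun x => Sum.Lex.inl_lt_inr _ _
  have hgz : ∀ y, z < g y := fun y => Sum.Lex.inr_lt_inr_iff.2 (Sum.Lex.inl_lt_inr _ _)
  have mf : StrictMono f := fun x y h => Sum.Lex.inl_lt_inl_iff.2 h
  have mg : StrictMono g := fun x y h => Sum.Lex.inr_lt_inr_iff.2 (Sum.Lex.inr_lt_inr_iff.2 h)
  exact ⟨_, inferInstance, inferInstance, inferInstance, inferInstance, ⟨z⟩, inferInstance,
    OMin.of_sum hf hg mf mg hfz hgz cov, f, g, hf, hg, mf.injective, mg.injective,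
    fun x y => ((hfz x).trans (hgz y)).ne⟩

/-- Finitely many copies of the line embed into a single dense o-minimal order. -/
theorem OMin.exists_copies (S : Struc N) (n : ℕ) :
    ∃ (M : Type u) (_ : LinearOrder M) (_ : DenselyOrdered M) (_ : NoMinOrder M)
      (_ : NoMaxOrder M) (_ : Nonempty M) (_ : DSpace S M) (_ : OMin S M) (f : Fin n → N → M),
      (∀ j, DFn S (f j)) ∧ ∀ i j s t, f i s = f j t → i = j ∧ s = t := by
  induction n with
  | zero =>
    exact ⟨N, inferInstance, inferInstance, inferInstance, inferInstance, inferInstance,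
      inferInstance, inferInstance, fun j => j.elim0, fun j => j.elim0, fun j => j.elim0⟩
  | succ n ih =>
    obtain ⟨M, _, _, _, _, _, _, _, f, hf, inj⟩ := ih
    obtain ⟨M', i1, i2, i3, i4, i5, i6, i7, p, q, hp, hq, ip, iq, hpq⟩ :=
      OMin.exists_sum (S := S) N M
    refine ⟨M', i1, i2, i3, i4, i5, i6, i7, Fin.cons p (fun j t => q (f j t)), ?_, ?_⟩
    · intro j
      induction j using Fin.cases with
      | zero => simpa using hp
      | succ j => simpa using hq.comp (hf j)
    · intro i j s t h
      induction i using Fin.cases with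
      | zero =>
        induction j using Fin.cases with
        | zero => exact ⟨rfl, ip h⟩
        | succ j => exact absurd h (hpq _ _)
      | succ i =>
        induction j using Fin.cases with
        | zero => exact absurd h.symm (hpq _ _)
        | succ j =>
          obtain ⟨h1, h2⟩ := inj i j s t (iq h)
          exact ⟨congrArg _ h1, h2⟩

end Sum

section Ends

variable {N : Type u} [LinearOrder N] {S : Struc N}
variable {M : Type v} [LinearOrder M] [DenselyOrdered M] [NoMinOrder M] [NoMaxOrder M]
  [Nonempty M]

/-- The ends of a line: its infinite ends and the one-sided germs at its points. -/
def IsEnd (F : Filter M) : Prop := F = atTop ∨ F = atBot ∨ (∃ t, F = rgt t) ∨ ∃ t, F = lft t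

variable [DSpace S M] [OMin S M]

include S in
theorem IsEnd.duf {F : Filter M} (h : IsEnd F) : DUF S F := by
  rcases h with rfl | rfl | ⟨t, rfl⟩ | ⟨t, rfl⟩
  exacts [DUF.top, DUF.bot, DUF.rgt t, DUF.lft t]

/-- The end with a given code: `(true, t)` lies to the right of `t`, `(false, t)` to its left. -/
def endAt : Bool × Option M → Filter M
  | (true, none) => atBot
  | (true, some t) => rgt t
  | (false, none) => atTop
  | (false, some t) => lft t

theorem isEnd_iff {F : Filter M} : IsEnd F ↔ ∃ p, F = endAt p := by
  constructor
  · rintro (h | h | ⟨t, h⟩ | ⟨t, h⟩)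
    exacts [⟨(false, none), h⟩, ⟨(true, none), h⟩, ⟨(true, some t), h⟩, ⟨(false, some t), h⟩]
  · rintro ⟨⟨_ | _, _ | t⟩, h⟩
    exacts [Or.inl h, Or.inr (Or.inr (Or.inr ⟨t, h⟩)), Or.inr (Or.inl h),
      Or.inr (Or.inr (Or.inl ⟨t, h⟩))]

theorem endAt_injective_of_cut {p q : Bool × Option M}
    (h : ∀ x, (∀ᶠ t in endAt p, x < t) ↔ ∀ᶠ t in endAt q, x < t) : p = q := by
  have top : ∀ x : M, (∀ᶠ t in atTop, x < t) ↔ True := fun x => by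
    simpa using eventually_gt_atTop x
  have bot : ∀ x : M, (∀ᶠ t in atBot, x < t) ↔ False := fun x => by
    simp only [iff_false]
    intro h
    obtain ⟨t, h1, h2⟩ := (h.and (eventually_lt_atBot x)).exists
    exact h1.asymm h2
  have r : ∀ y x : M, (∀ᶠ t in rgt y, x < t) ↔ x ≤ y := fun y x => by
    rw [eventually_rgt]
    constructor
    · rintro ⟨z, hz, h⟩
      by_contra! hlt
      obtain ⟨t, h1, h2⟩ := exists_between (lt_min hz hlt)
      exact (h t h1 (h2.trans_le (min_le_left _ _))).not_ge (h2.trans_le (min_le_right _ _)).le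
    · intro h
      obtain ⟨z, hz⟩ := exists_gt y
      exact ⟨z, hz, fun t ht _ => h.trans_lt ht⟩
  have l : ∀ y x : M, (∀ᶠ t in lft y, x < t) ↔ x < y := fun y x => by
    rw [eventually_lft]
    constructor
    · rintro ⟨z, hz, h⟩
      obtain ⟨t, h1, h2⟩ := exists_between hz
      exact (h t h1 h2).trans h2
    · intro h
      exact ⟨x, h, fun t ht _ => ht⟩
  obtain ⟨_ | _, _ | s⟩ := p <;> obtain ⟨_ | _, _ | t⟩ := q <;>
    simp only [endAt, top, bot, r, l] at h
  · rfl
  · exact absurd ((h t).1 trivial) (lt_irrefl t)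
  · simp at h
  · obtain ⟨z, hz⟩ := exists_gt t
    exact absurd ((h z).1 trivial) hz.not_ge
  · exact absurd ((h s).2 trivial) (lt_irrefl s)
  · rcases lt_trichotomy s t with h1 | h1 | h1
    · exact absurd ((h s).2 h1) (lt_irrefl _)
    · rw [h1]
    · exact absurd ((h t).1 h1) (lt_irrefl _)
  · obtain ⟨z, hz⟩ := exists_lt s
    exact absurd ((h z).1 hz) not_false
  · have h1 := (h t).2 le_rfl
    obtain ⟨z, h2, h3⟩ := exists_between h1
    exact absurd ((h z).1 h3) h2.not_ge
  · simp at h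
  · obtain ⟨z, hz⟩ := exists_lt t
    exact absurd ((h z).2 hz) not_false
  · rfl
  · exact absurd ((h t).2 le_rfl) not_false
  · obtain ⟨z, hz⟩ := exists_gt s
    exact absurd ((h z).2 trivial) hz.not_ge
  · have h1 := (h s).1 le_rfl
    obtain ⟨z, h2, h3⟩ := exists_between h1
    exact absurd ((h z).2 h3) h2.not_ge
  · exact absurd ((h s).1 le_rfl) not_false
  · rw [le_antisymm ((h s).1 le_rfl) ((h t).2 le_rfl)]

theorem endAt_injective : Function.Injective (endAt (M := M)) :=
  fun _ _ h => endAt_injective_of_cut fun x => by rw [h]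

theorem IsEnd.eq_of_cut {F G : Filter M} (hF : IsEnd F) (hG : IsEnd G)
    (h : ∀ x, (∀ᶠ t in F, x < t) ↔ ∀ᶠ t in G, x < t) : F = G := by
  obtain ⟨p, rfl⟩ := isEnd_iff.1 hF
  obtain ⟨q, rfl⟩ := isEnd_iff.1 hG
  rw [endAt_injective_of_cut h]

include S in
theorem IsEnd.eq_of_le {F G : Filter M} (hF : IsEnd F) (hG : IsEnd G) (h : F ≤ G) : F = G := by
  refine hF.eq_of_cut hG fun x => ⟨fun hx => ?_, fun hx => h hx⟩
  rcases (hG.duf (S := S)).ultra (P := fun t => x < t) (by fun_prop) with h' | h'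
  · exact h'
  · have := (hF.duf (S := S)).neBot
    obtain ⟨t, h1, h2⟩ := (hx.and (h h')).exists
    exact absurd h1 h2

theorem LimAt.tendsto_end {X : Type*} [DSpace S X] {F : Filter X} (hF : DUF S F) {f : X → M}
    (hf : DFn S f) {y : M} (h : LimAt F f y) (hy : ∀ᶠ t in F, f t ≠ y) :
    Tendsto f F (rgt y) ∨ Tendsto f F (lft y) := by
  have h2 : ∀ᶠ t in F, y < f t ∨ f t < y := hy.mono fun t ht => ht.lt_or_gt.symm
  rcases hF.eventually_or (by fun_prop) h2 with h2 | h2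
  · refine Or.inl fun s hs => ?_
    obtain ⟨z, hz, h'⟩ := hs
    rw [Filter.mem_map]
    filter_upwards [h2, h.2 z hz] with t h3 h4 using h' _ h3 h4
  · refine Or.inr fun s hs => ?_
    obtain ⟨z, hz, h'⟩ := hs
    rw [Filter.mem_map]
    filter_upwards [h2, h.1 z hz] with t h3 h4 using h' _ h4 h3

theorem DUF.exists_end {X : Type*} [DSpace S X] {F : Filter X} (hF : DUF S F) {f : X → M}
    (hf : DFn S f) (h : ∀ y, ∀ᶠ t in F, f t ≠ y) : ∃ G, IsEnd G ∧ Tendsto f F G := by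
  rcases hF.lim_cases hf with ⟨y, hy⟩ | h1 | h1
  · rcases hy.tendsto_end hF hf (h y) with h1 | h1
    · exact ⟨_, Or.inr (Or.inr (Or.inl ⟨y, rfl⟩)), h1⟩
    · exact ⟨_, Or.inr (Or.inr (Or.inr ⟨y, rfl⟩)), h1⟩
  · exact ⟨_, Or.inl rfl, tendsto_atTop.2 fun b => (h1 b).mono fun _ => le_of_lt⟩
  · exact ⟨_, Or.inr (Or.inl rfl), tendsto_atBot.2 fun b => (h1 b).mono fun _ => le_of_lt⟩

theorem IsEnd.eventually_ne {F : Filter M} (h : IsEnd F) (x : M) : ∀ᶠ t in F, t ≠ x := by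
  rcases h with rfl | rfl | ⟨t, rfl⟩ | ⟨t, rfl⟩
  · exact (eventually_gt_atTop x).mono fun _ => ne_of_gt
  · exact (eventually_lt_atBot x).mono fun _ => ne_of_lt
  · rcases le_or_gt x t with h | h
    · obtain ⟨z, hz⟩ := exists_gt t
      exact ⟨z, hz, fun s hs _ => (h.trans_lt hs).ne'⟩
    · exact ⟨x, h, fun s _ hs => hs.ne⟩
  · rcases le_or_gt t x with h | h
    · obtain ⟨z, hz⟩ := exists_lt t
      exact ⟨z, hz, fun s _ hs => (hs.trans_le h).ne⟩
    · exact ⟨x, h, fun s hs _ => hs.ne'⟩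

theorem OMin.exists_finset_eventually {P : M → Prop} (hP : DFn S P) : ∃ F : Finset M, ∀ t ∉ F,
    (∀ᶠ s in rgt t, (P s ↔ P t)) ∧ ∀ᶠ s in lft t, (P s ↔ P t) := by
  obtain ⟨F, hF⟩ := OMin.omin hP
  refine ⟨F, fun x hxF => ⟨?_, ?_⟩⟩
  · obtain ⟨y, hy, h⟩ := F.exists_gt_forall_le x
    refine ⟨y, hy, fun t h1 h2 => (hF _ _ h1 fun f hf => ?_).symm⟩
    rcases lt_trichotomy f x with h3 | h3 | h3
    · exact Or.inl h3
    · exact absurd (show x ∈ F by rwa [← h3]) hxF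
    · exact Or.inr (h2.trans_le (h f hf h3))
  · obtain ⟨y, hy, h⟩ := Finset.exists_gt_forall_le (X := Mᵒᵈ) F x
    refine ⟨y, hy, fun t h1 h2 => hF _ _ h2 fun f hf => ?_⟩
    rcases lt_trichotomy f x with h3 | h3 | h3
    · exact Or.inl (lt_of_le_of_lt (h f hf h3) h1)
    · exact absurd (show x ∈ F by rwa [← h3]) hxF
    · exact Or.inr h3

end Ends

section Germs

variable {N : Type u} [LinearOrder N] [Nonempty N] {S : Struc N}
variable {M : Type v} [LinearOrder M] [DenselyOrdered M] [NoMinOrder M] [NoMaxOrder M]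
  [Nonempty M] [DSpace S M] [OMin S M] {Γ : Type w} [DSpace S Γ] [DSet S Γ]

/-- An injective definable coordinate on a definable set together with a definable inverse. -/
structure Coord (S : Struc N) (Γ : Type w) (M : Type v) [DSpace S Γ] [DSpace S M] where
  c : Γ → M
  τ : M → Γ
  hc : DFn S c
  hτ : DFn S τ
  left_inv : ∀ x, τ (c x) = x

namespace Coord

attribute [fun_prop] Coord.hc Coord.hτ
attribute [simp] Coord.left_inv

variable (κ : Coord S Γ M)

@[fun_prop]
theorem dfn_c {X : Type*} [DSpace S X] {f : X → Γ} (hf : DFn S f) : DFn S (fun x => κ.c (f x)) :=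
  κ.hc.comp hf

@[fun_prop]
theorem dfn_τ {X : Type*} [DSpace S X] {f : X → M} (hf : DFn S f) : DFn S (fun x => κ.τ (f x)) :=
  κ.hτ.comp hf

theorem inj {x y : Γ} (h : κ.c x = κ.c y) : x = y := by
  rw [← κ.left_inv x, h, κ.left_inv]

/-- An end lying in the definable set. -/
def GEnd (F : Filter Γ) : Prop :=
  ∃ ε : Filter M, IsEnd ε ∧ (∀ᶠ t in ε, κ.c (κ.τ t) = t) ∧ F = map κ.τ ε

variable {κ} {F G : Filter Γ}

theorem GEnd.duf (h : κ.GEnd F) : DUF S F := by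
  obtain ⟨ε, h1, h2, rfl⟩ := h
  exact (h1.duf (S := S)).map κ.hτ

theorem map_c_map_τ {ε : Filter M} (h : ∀ᶠ t in ε, κ.c (κ.τ t) = t) : map κ.c (map κ.τ ε) = ε := by
  rw [Filter.map_map]
  exact (Filter.map_congr h).trans Filter.map_id

theorem GEnd.eventually_ne (h : κ.GEnd F) (x : Γ) : ∀ᶠ t in F, t ≠ x := by
  obtain ⟨ε, h1, h2, rfl⟩ := h
  rw [Filter.eventually_map]
  filter_upwards [h1.eventually_ne (κ.c x), h2] with t h3 h4 h5
  exact h3 (by rw [← h4, h5])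

theorem GEnd.eq_of_le (hF : κ.GEnd F) (hG : κ.GEnd G) (h : F ≤ G) : F = G := by
  obtain ⟨ε, h1, h2, rfl⟩ := hF
  obtain ⟨δ, h3, h4, rfl⟩ := hG
  have := Filter.map_mono (m := κ.c) h
  rw [map_c_map_τ h2, map_c_map_τ h4] at this
  rw [h1.eq_of_le (S := S) h3 this]

theorem exists_gEnd (hF : DUF S F) (h : ∀ x, ∀ᶠ t in F, t ≠ x) : ∃ G, κ.GEnd G ∧ F ≤ G := by
  obtain ⟨ε, h1, h2⟩ := hF.exists_end κ.hc (fun y => by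
    by_cases hy : ∃ x, κ.c x = y
    · obtain ⟨x, rfl⟩ := hy
      exact (h x).mono fun t ht e => ht (κ.inj e)
    · exact Eventually.of_forall fun t e => hy ⟨t, e⟩)
  refine ⟨map κ.τ ε, ⟨ε, h1, ?_, rfl⟩, ?_⟩
  · rcases (h1.duf (S := S)).ultra (P := fun t => κ.c (κ.τ t) = t) (by fun_prop) with h3 | h3
    · exact h3
    · have := hF.neBot
      obtain ⟨t, ht⟩ := (h2.eventually h3).exists
      exact absurd (by simp) ht
  · have := Filter.map_mono (m := κ.τ) h2
    rw [Filter.map_map] at this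
    convert this using 1
    exact (Filter.map_id' (f := F)).symm.trans (Filter.map_congr (by simp [Filter.EventuallyEq]))

theorem GEnd.map (hF : κ.GEnd F) (f : Γ ≃ Γ) (hf : DFn S f) (hf' : DFn S f.symm) :
    κ.GEnd (Filter.map f F) := by
  have aux : ∀ (g : Γ ≃ Γ) {F : Filter Γ}, DFn S g → κ.GEnd F →
      ∃ G, κ.GEnd G ∧ Filter.map g F ≤ G := fun g F hg hF =>
    exists_gEnd (hF.duf.map hg) fun x => by
      rw [Filter.eventually_map]
      exact (hF.eventually_ne (g.symm x)).mono fun t ht e => ht (by simp [← e])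
  obtain ⟨F₁, h1, h2⟩ := aux f hf hF
  obtain ⟨F₂, h3, h4⟩ := aux f.symm hf' h1
  have e1 : ∀ F : Filter Γ, Filter.map f.symm (Filter.map f F) = F := fun F => by
    simp [Filter.map_map]
  have e2 : ∀ F : Filter Γ, Filter.map f (Filter.map f.symm F) = F := fun F => by
    simp [Filter.map_map]
  have h5 : F ≤ F₂ := by
    have := (Filter.map_mono (m := f.symm) h2).trans h4
    rwa [e1] at this
  obtain rfl := hF.eq_of_le h3 h5
  have h6 := Filter.map_mono (m := f) h4
  rw [e2] at h6
  rwa [le_antisymm h2 h6]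

variable (κ)

/-- The one-sided germs at a point, seen in the coordinate. -/
def germs (x : Γ) : Set (Filter Γ) := {Filter.map κ.τ (rgt (κ.c x)), Filter.map κ.τ (lft (κ.c x))}

/-- Interior points in the coordinate. -/
def Int (x : Γ) : Prop :=
  (∀ᶠ t in rgt (κ.c x), κ.c (κ.τ t) = t) ∧ ∀ᶠ t in lft (κ.c x), κ.c (κ.τ t) = t

variable {κ}

theorem Int.gEnd {x : Γ} (h : κ.Int x) (hF : F ∈ κ.germs x) : κ.GEnd F := by
  rcases hF with rfl | rfl
  · exact ⟨_, Or.inr (Or.inr (Or.inl ⟨_, rfl⟩)), h.1, rfl⟩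
  · exact ⟨_, Or.inr (Or.inr (Or.inr ⟨_, rfl⟩)), h.2, rfl⟩

theorem Int.ne {x : Γ} (h : κ.Int x) :
    Filter.map κ.τ (rgt (κ.c x)) ≠ Filter.map κ.τ (lft (κ.c x)) := by
  intro e
  have := congrArg (Filter.map κ.c) e
  rw [map_c_map_τ h.1, map_c_map_τ h.2] at this
  have := endAt_injective (a₁ := (true, some (κ.c x))) (a₂ := (false, some (κ.c x))) this
  simp at this

variable (κ) in
/-- Points at which a definable map is interior and continuous in the coordinate. -/
def Reg (f : Γ → Γ) (x : Γ) : Prop :=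
  κ.Int x ∧ κ.Int (f x) ∧ DFn.ContAt (fun t => κ.c (f (κ.τ t))) (κ.c x)

theorem Reg.image_germs {f : Γ ≃ Γ} (hf : DFn S f) (hf' : DFn S f.symm) {x : Γ}
    (h : κ.Reg f x) : Filter.map f '' κ.germs x = κ.germs (f x) := by
  obtain ⟨h1, h2, h3⟩ := h
  have aux : ∀ ε : Filter M, IsEnd ε → (∀ᶠ t in ε, κ.c (κ.τ t) = t) →
      LimAt ε (fun t => κ.c (f (κ.τ t))) (κ.c (f (κ.τ (κ.c x)))) →
      (∀ᶠ t in ε, t ≠ κ.c x) → Filter.map f (Filter.map κ.τ ε) ∈ κ.germs (f x) := by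
    intro ε hε hm hl hn
    have hg : κ.GEnd (Filter.map κ.τ ε) := ⟨ε, hε, hm, rfl⟩
    rw [κ.left_inv] at hl
    have hne : ∀ᶠ t in ε, κ.c (f (κ.τ t)) ≠ κ.c (f x) := by
      filter_upwards [hn, hm] with t h4 h5 h6
      exact h4 (by rw [← h5, f.injective (κ.inj h6)])
    have key : ∀ δ : Filter M, Tendsto (fun t => κ.c (f (κ.τ t))) ε δ →
        κ.GEnd (Filter.map κ.τ δ) →
        Filter.map f (Filter.map κ.τ ε) = Filter.map κ.τ δ := by
      intro δ hδ hδ'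
      refine (hg.map f hf hf').eq_of_le hδ' ?_
      have := Filter.map_mono (m := κ.τ) hδ
      rw [Filter.map_map] at this
      rw [Filter.map_map]
      convert this using 2
      ext t
      simp
    rcases hl.tendsto_end (hε.duf (S := S)) (by fun_prop) hne with h4 | h4
    · rw [key _ h4 (h2.gEnd (Or.inl rfl))]
      exact Or.inl rfl
    · rw [key _ h4 (h2.gEnd (Or.inr rfl))]
      exact Or.inr rfl
  have r := aux _ (Or.inr (Or.inr (Or.inl ⟨κ.c x, rfl⟩))) h1.1 h3.1
    (IsEnd.eventually_ne (Or.inr (Or.inr (Or.inl ⟨_, rfl⟩))) _)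
  have l := aux _ (Or.inr (Or.inr (Or.inr ⟨κ.c x, rfl⟩))) h1.2 h3.2
    (IsEnd.eventually_ne (Or.inr (Or.inr (Or.inr ⟨_, rfl⟩))) _)
  have hne := (Filter.map_injective f.injective).ne h1.ne
  rw [germs, Set.image_pair]
  rw [germs] at r l ⊢
  rcases r with r | r <;> rcases l with l | l
  · exact absurd (r.trans l.symm) hne
  · rw [r, l]
  · rw [r, l, Set.pair_comm]
  · exact absurd (r.trans l.symm) hne

theorem Reg.def {Z : Type*} [DSpace S Z] {f : Z → Γ → Γ} (hf : DFn S (fun p : Z × Γ => f p.1 p.2)) :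
    DFn S (fun p : Z × Γ => κ.Reg (f p.1) p.2) := by
  simp only [Reg, Int, DFn.ContAt, LimAt, eventually_rgt, eventually_lft]
  fun_prop

theorem finite_not_int : {x | ¬ κ.Int x}.Finite := by
  obtain ⟨F, hF⟩ := OMin.exists_finset_eventually (S := S) (P := fun t => κ.c (κ.τ t) = t)
    (by fun_prop)
  refine ((F.finite_toSet).preimage (f := κ.c) (fun x _ y _ h => κ.inj h)).subset ?_
  intro x hx
  by_contra hxF
  exact hx ⟨(hF _ hxF).1.mono fun t ht => ht.2 (by simp),
    (hF _ hxF).2.mono fun t ht => ht.2 (by simp)⟩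

theorem finite_not_reg {f : Γ ≃ Γ} (hf : DFn S f) : {x | ¬ κ.Reg f x}.Finite := by
  have h1 := (DFn.finite_not_contAt (S := S) (f := fun t => κ.c (f (κ.τ t))) (by fun_prop)).preimage
    (f := κ.c) (fun x _ y _ h => κ.inj h)
  have h2 := (finite_not_int (κ := κ)).preimage (f := f) f.injective.injOn
  refine ((finite_not_int (κ := κ)).union (h2.union h1)).subset fun x hx => ?_
  by_contra h
  simp only [Set.mem_union, Set.mem_preimage, Set.mem_ofPred_eq, not_or, not_not] at h
  exact hx ⟨h.1, h.2.1, h.2.2⟩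

/-- If the vertical fibres of a planar definable set are finite, so are almost all
horizontal fibres. -/
theorem finite_infinite_fibres (κ : Coord S Γ M) {R : Γ × Γ → Prop} (hR : DFn S R)
    (h : ∀ g, {y | R (g, y)}.Finite) : {y | {g | R (g, y)}.Infinite}.Finite := by
  by_contra hinf
  let B : M × M → Prop := fun p => κ.c (κ.τ p.1) = p.1 ∧ κ.c (κ.τ p.2) = p.2 ∧ R (κ.τ p.2, κ.τ p.1)
  have hB : DFn S B := by fun_prop
  let Q : M → Prop := fun t => ∃ a b, a < b ∧ ∀ s, a < s → s < b → B (t, s)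
  have hQ : DFn S Q := by
    simp only [Q]
    fun_prop
  have hQi : {t | Q t}.Infinite := by
    refine (Set.Infinite.image (f := κ.c) (fun x _ y _ h => κ.inj h) hinf).mono ?_
    rintro _ ⟨y, hy, rfl⟩
    refine OMin.exists_Ioo_of_infinite (S := S) (P := fun s => B (κ.c y, s)) (by fun_prop) ?_
    refine (Set.Infinite.image (f := κ.c) (fun x _ y _ h => κ.inj h) hy).mono ?_
    rintro _ ⟨g, hg, rfl⟩
    simpa [B] using hg
  obtain ⟨a, b, hab, h1⟩ := OMin.exists_Ioo_of_infinite hQ hQi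
  obtain ⟨a', b', c, d, -, hab', -, hcd, hbox⟩ := DFn.exists_box hB hab (fun t ht1 ht2 => by
    obtain ⟨p, q, hpq, h2⟩ := h1 t ht1 ht2
    exact Set.infinite_of_Ioo_subset hpq h2)
  obtain ⟨s, hs1, hs2⟩ := exists_between hcd
  refine (Set.infinite_of_Ioo_subset hab' (s := {t | B (t, s)})
    fun t ht1 ht2 => hbox t s ht1 ht2 hs1 hs2) ?_
  refine ((h (κ.τ s)).image κ.c).subset ?_
  rintro t ⟨h3, h4, h5⟩
  exact ⟨κ.τ t, h5, h3⟩

end Coord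

end Germs

/-- Definable groups. -/
class DGrp {N : Type u} [LinearOrder N] (S : Struc N) (Γ : Type w) [Group Γ] [DSpace S Γ] :
    Prop extends DSet S Γ where
  mul_def : DFn S (fun p : Γ × Γ => p.1 * p.2)
  inv_def : DFn S (fun x : Γ => x⁻¹)

section

variable {N : Type u} [LinearOrder N] {S : Struc N} {Γ : Type w} [Group Γ] [DSpace S Γ] [DGrp S Γ]
  {X : Type*} [DSpace S X] {f g : X → Γ}

@[fun_prop]
theorem DFn.mul (hf : DFn S f) (hg : DFn S g) : DFn S (fun x => f x * g x) :=
  DGrp.mul_def.comp (f := fun x => (f x, g x)) (by fun_prop)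

@[fun_prop]
theorem DFn.inv (hf : DFn S f) : DFn S (fun x => (f x)⁻¹) := DGrp.inv_def.comp hf

end


section GroupEnds

variable {N : Type u} [LinearOrder N] [Nonempty N] {S : Struc N}
variable {M : Type v} [LinearOrder M] [DenselyOrdered M] [NoMinOrder M] [NoMaxOrder M]
  [Nonempty M] [DSpace S M] [OMin S M] {Γ : Type w} [Group Γ] [DSpace S Γ] [DGrp S Γ]

namespace Coord

variable {κ : Coord S Γ M} {F : Filter Γ}

theorem GEnd.smul (h : κ.GEnd F) (g : Γ) : κ.GEnd (g • F) :=
  h.map (Equiv.mulLeft g) (by simp only [Equiv.coe_mulLeft]; fun_prop)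
    (by simp only [Equiv.mulLeft_symm, Equiv.coe_mulLeft]; fun_prop)

theorem GEnd.inv (h : κ.GEnd F) : κ.GEnd F⁻¹ :=
  h.map (Equiv.inv Γ) (DGrp.inv_def (S := S)) (DGrp.inv_def (S := S))

theorem op_smul_inv (g : Γ) (F : Filter Γ) : (g • F)⁻¹ = MulOpposite.op g⁻¹ • F⁻¹ := by
  change Filter.map _ (Filter.map _ F) = Filter.map _ (Filter.map _ F)
  simp only [Filter.map_map]
  congr 1
  ext x
  simp

theorem exists_generic [Infinite Γ] (κ : Coord S Γ M) {T : Γ → Γ ≃ Γ}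
    (hT : DFn S (fun p : Γ × Γ => T p.1 p.2)) :
    ∀ᶠ y in cofinite, ∀ᶠ g in cofinite, κ.Reg (T g) y := by
  have hR := Reg.def (κ := κ) (f := fun g => T g) hT
  have := finite_infinite_fibres κ (R := fun p => ¬ κ.Reg (T p.1) p.2) hR.not
    (fun g => finite_not_reg (f := T g) (hT.comp (f := fun x => (g, x)) (by fun_prop)))
  rw [eventually_cofinite]
  refine this.subset fun y hy => ?_
  rwa [Set.mem_ofPred_eq, eventually_cofinite] at hy

/-- The two germs at the identity of a one-dimensional group. -/
structure Base (κ : Coord S Γ M) (Λ : Set (Filter Γ)) : Prop where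
  gEnd : ∀ F ∈ Λ, κ.GEnd F
  pair : ∃ η η', η ≠ η' ∧ Λ = {η, η'}
  generic : ∀ᶠ x in cofinite, κ.Int x ∧ κ.germs x = x • Λ
  comm : ∀ g : Γ, MulOpposite.op g • Λ = g • Λ
  inv_mem : ∀ F ∈ Λ, F⁻¹ ∈ Λ

theorem eventually_mul_left {p : Γ → Prop} (h : ∀ᶠ x in cofinite, p x) (g : Γ) :
    ∀ᶠ x in cofinite, p (g * x) :=
  (mul_right_injective g).tendsto_cofinite.eventually h

theorem eventually_mul_right {p : Γ → Prop} (h : ∀ᶠ x in cofinite, p x) (g : Γ) :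
    ∀ᶠ x in cofinite, p (x * g) :=
  (mul_left_injective g).tendsto_cofinite.eventually h

theorem eventually_inv {p : Γ → Prop} (h : ∀ᶠ x in cofinite, p x) :
    ∀ᶠ x in cofinite, p x⁻¹ :=
  (inv_injective (G := Γ)).tendsto_cofinite.eventually h

theorem exists_base [Infinite Γ] (κ : Coord S Γ M) : ∃ Λ, κ.Base Λ := by
  have hi : ∀ᶠ x in cofinite, κ.Int x := finite_not_int
  have h1 := κ.exists_generic (T := Equiv.mulLeft) (by simp only [Equiv.coe_mulLeft]; fun_prop)
  have h2 := κ.exists_generic (T := Equiv.mulRight) (by simp only [Equiv.coe_mulRight]; fun_prop)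
  obtain ⟨a, ha, hai⟩ := (h1.and hi).exists
  obtain ⟨b, hb⟩ := h2.exists
  have hl : ∀ᶠ x in cofinite, κ.Int x ∧ κ.germs x = x • (a⁻¹ • κ.germs a) := by
    filter_upwards [eventually_mul_right ha a⁻¹] with x hx
    have e : Equiv.mulLeft (x * a⁻¹) a = x := by simp
    have h3 := hx.image_germs (by simp only [Equiv.coe_mulLeft]; fun_prop)
      (by simp only [Equiv.mulLeft_symm, Equiv.coe_mulLeft]; fun_prop)
    have h4 := hx.2.1
    rw [e] at h3 h4
    exact ⟨h4, by rw [← h3, smul_smul]; rfl⟩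
  have hr : ∀ᶠ x in cofinite, κ.germs x = MulOpposite.op x • (MulOpposite.op b⁻¹ • κ.germs b) := by
    filter_upwards [eventually_mul_left hb b⁻¹] with x hx
    have e : Equiv.mulRight (b⁻¹ * x) b = x := by simp
    have h3 := hx.image_germs (by simp only [Equiv.coe_mulRight]; fun_prop)
      (by simp only [Equiv.mulRight_symm, Equiv.coe_mulRight]; fun_prop)
    rw [e] at h3
    rw [← h3, smul_smul, ← MulOpposite.op_mul]
    rfl
  set Λ := a⁻¹ • κ.germs a with hΛ
  have hG : ∀ F ∈ Λ, κ.GEnd F := by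
    rintro _ ⟨F, hF, rfl⟩
    exact (hai.gEnd hF).smul _
  have hcomm : ∀ g : Γ, MulOpposite.op g • Λ = g • Λ := by
    intro g
    obtain ⟨y, h3, h4, h5, h6⟩ := (hl.and (hr.and ((eventually_mul_right hl g).and
      (eventually_mul_right hr g)))).exists
    have : y • (g • Λ) = y • (MulOpposite.op g • Λ) := by
      rw [smul_smul, ← h5.2, h6, smul_comm y, ← h3.2, h4, smul_smul, smul_smul, smul_smul,
        ← MulOpposite.op_mul, ← MulOpposite.op_mul, ← MulOpposite.op_mul]
    exact (smul_left_cancel y this).symm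
  refine ⟨Λ, hG, ⟨_, _, ?_, by rw [hΛ, germs, ← Set.image_smul, Set.image_pair]⟩, hl, hcomm, ?_⟩
  · exact fun e => hai.ne (smul_left_cancel _ e)
  · have h3 : ∀ᶠ x in cofinite, κ.Reg (Equiv.inv Γ) x := finite_not_reg (DGrp.inv_def (S := S))
    obtain ⟨y, h4, h5, h6⟩ := (h3.and (hl.and (eventually_inv hl))).exists
    have h7 := h4.image_germs (DGrp.inv_def (S := S)) (DGrp.inv_def (S := S))
    rw [Equiv.inv_apply, h6.2, ← hcomm, h5.2] at h7
    intro F hF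
    have h8 : (y • F)⁻¹ ∈ MulOpposite.op y⁻¹ • Λ := by
      rw [← h7]
      exact ⟨_, Set.smul_mem_smul_set hF, rfl⟩
    rw [op_smul_inv] at h8
    exact (Set.smul_mem_smul_set_iff).1 h8

end Coord

end GroupEnds

section EvenEnds

variable {N : Type u} [LinearOrder N] {S : Struc N}
variable {M : Type v} [LinearOrder M] [DenselyOrdered M] [NoMinOrder M] [NoMaxOrder M]
  [Nonempty M] [DSpace S M] [OMin S M]

theorem Filter.eventually_iff_of_const {X : Type*} {F : Filter X} [F.NeBot] {Q : X → Prop}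
    {p : Prop} (h : ∀ᶠ t in F, (Q t ↔ p)) : (∀ᶠ t in F, Q t) ↔ p := by
  rw [eventually_congr h, eventually_const]

/-- The outer ends of a set: those ends of the line which it contains and which do not lie at
one of its points. -/
def OuterEnd (Q : M → Prop) (p : Bool × Option M) : Prop :=
  (∀ᶠ s in endAt p, Q s) ∧ ∀ t ∈ p.2, ¬ Q t

open Classical in
include S in
theorem outerEnd_count {Q : M → Prop}
    (hop : ∀ t, Q t → (∀ᶠ s in rgt t, Q s) ∧ ∀ᶠ s in lft t, Q s) (F : Finset M) :
    ∀ m, (∀ f ∈ F, f < m) →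
    (∀ x y, x < y → y < m → (∀ f ∈ F, f < x ∨ y < f) → (Q x ↔ Q y)) →
    ((if OuterEnd Q (true, none) then 1 else 0) +
      ∑ t ∈ F, if OuterEnd Q (true, some t) then 1 else 0) =
    (∑ t ∈ F, if OuterEnd Q (false, some t) then 1 else 0) +
      if ∀ᶠ s in lft m, Q s then 1 else 0 := by
  have nr : ∀ t : M, (rgt t).NeBot := fun t => (DUF.rgt (S := S) t).neBot
  have nl : ∀ t : M, (lft t).NeBot := fun t => (DUF.lft (S := S) t).neBot
  induction F using Finset.induction_on_max with
  | empty =>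
    intro m _ hc
    obtain ⟨s, hs⟩ := exists_lt m
    have h1 : ∀ t, t < s → (Q t ↔ Q s) := fun t ht => hc t s ht hs (by simp)
    have h2 : ∀ t, s < t → t < m → (Q t ↔ Q s) := fun t ht ht' => (hc s t ht ht' (by simp)).symm
    have h3 : OuterEnd Q (true, none) ↔ Q s := by
      simp only [OuterEnd, endAt, Option.mem_def, reduceCtorEq, false_imp_iff, implies_true,
        and_true]
      exact eventually_iff_of_const ((eventually_lt_atBot s).mono h1)
    have h4 : (∀ᶠ t in lft m, Q t) ↔ Q s :=
      eventually_iff_of_const ⟨s, hs, fun t ht ht' => h2 t ht ht'⟩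
    simp [h3, h4]
  | insert k F hk ih =>
    intro m hm hc
    have hkF : k ∉ F := fun h => (hk k h).false
    have hkm : k < m := hm k (by simp)
    have ih' := ih k hk (fun x y hxy hy hf => hc x y hxy (hy.trans hkm) fun f hf' => by
      rcases Finset.mem_insert.1 hf' with rfl | h
      exacts [Or.inr hy, hf f h])
    rw [Finset.sum_insert hkF, Finset.sum_insert hkF]
    obtain ⟨s, hs1, hs2⟩ := exists_between hkm
    have h1 : ∀ t t', k < t → t < t' → t' < m → (Q t ↔ Q t') := fun t t' h1 h2 h3 =>
      hc t t' h2 h3 fun f hf => by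
        rcases Finset.mem_insert.1 hf with rfl | h
        exacts [Or.inl h1, Or.inl ((hk f h).trans h1)]
    have h2 : (∀ᶠ t in rgt k, Q t) ↔ Q s :=
      eventually_iff_of_const ⟨s, hs1, fun t ht ht' => h1 t s ht ht' hs2⟩
    have h3 : (∀ᶠ t in lft m, Q t) ↔ Q s :=
      eventually_iff_of_const ⟨s, hs2, fun t ht ht' => (h1 s t hs1 ht ht').symm⟩
    have h4 : OuterEnd Q (true, some k) ↔ (Q s ∧ ¬ Q k) := by
      simp [OuterEnd, endAt, h2]
    have h5 : OuterEnd Q (false, some k) ↔ ((∀ᶠ t in lft k, Q t) ∧ ¬ Q k) := by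
      simp [OuterEnd, endAt]
    have h6 := hop k
    rw [h2] at h6
    rw [h3]
    simp only [h4, h5] at *
    by_cases hk : Q k
    · simp [hk, h6 hk] at ih' ⊢
      exact ih'
    · simp only [hk, not_false_eq_true, and_true] at ih' ⊢
      omega

theorem even_outerEnds {Q : M → Prop} (hQ : DFn S Q)
    (hop : ∀ t, Q t → (∀ᶠ s in rgt t, Q s) ∧ ∀ᶠ s in lft t, Q s) :
    Even {p | OuterEnd Q p}.ncard := by
  classical
  have nr : ∀ t : M, (rgt t).NeBot := fun t => (DUF.rgt (S := S) t).neBot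
  have nl : ∀ t : M, (lft t).NeBot := fun t => (DUF.lft (S := S) t).neBot
  obtain ⟨F, hF, hF'⟩ : ∃ F : Finset M, (∀ x y, x < y → (∀ f ∈ F, f < x ∨ y < f) → (Q x ↔ Q y)) ∧
      ∀ t ∉ F, (∀ᶠ s in rgt t, (Q s ↔ Q t)) ∧ ∀ᶠ s in lft t, (Q s ↔ Q t) := by
    obtain ⟨F₁, h1⟩ := OMin.omin hQ
    obtain ⟨F₂, h2⟩ := OMin.exists_finset_eventually hQ
    exact ⟨F₁ ∪ F₂, fun x y hxy h => h1 x y hxy fun f hf => h f (Finset.mem_union_left _ hf),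
      fun t ht => h2 t fun h => ht (Finset.mem_union_right _ h)⟩
  obtain ⟨m, hm⟩ : ∃ m, ∀ f ∈ F, f < m := by
    obtain ⟨b, hb⟩ := F.bddAbove
    obtain ⟨m, hm⟩ := exists_gt b
    exact ⟨m, fun f hf => (hb hf).trans_lt hm⟩
  have hcount := outerEnd_count (S := S) hop F m hm (fun x y hxy _ h => hF x y hxy h)
  obtain ⟨s, hs⟩ := exists_gt m
  have h1 : (∀ᶠ t in lft m, Q t) ↔ OuterEnd Q (false, none) := by
    simp only [OuterEnd, endAt, Option.mem_def, reduceCtorEq, false_imp_iff, implies_true,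
        and_true]
    rw [eventually_iff_of_const (F := atTop) (p := Q m)
      ((eventually_gt_atTop m).mono fun t ht => (hF m t ht fun f hf => Or.inl (hm f hf)).symm)]
    obtain ⟨z, hz, hz'⟩ := Finset.exists_gt_forall_le (X := Mᵒᵈ) F m
    exact eventually_iff_of_const ⟨z, hz, fun t ht ht' =>
      hF t m ht' fun f hf => Or.inl (lt_of_le_of_lt (hz' f hf (hm f hf)) ht)⟩
  have hsome : ∀ b t, OuterEnd Q (b, some t) → t ∈ F := by
    intro b t ⟨h2, h3⟩
    by_contra htF
    refine h3 t rfl ?_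
    cases b with
    | true => exact (eventually_iff_of_const (F := rgt t) (hF' t htF).1).1 h2
    | false => exact (eventually_iff_of_const (F := lft t) (hF' t htF).2).1 h2
  have hset : {p | OuterEnd Q p} =
      ↑(((Finset.univ : Finset Bool) ×ˢ F.insertNone).filter (OuterEnd Q)) := by
    ext ⟨b, o⟩
    simp only [Set.mem_ofPred_eq, Finset.coe_filter, Finset.mem_product, Finset.mem_univ, true_and,
      Finset.mem_insertNone]
    refine ⟨fun h => ⟨fun t ht => ?_, h⟩, fun h => h.2⟩
    rw [Option.mem_def] at ht
    subst ht
    exact hsome b t h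
  rw [hset, Set.ncard_coe_finset, Finset.card_filter, Finset.sum_product, Fintype.sum_bool,
    Finset.sum_insertNone, Finset.sum_insertNone, hcount, if_congr h1 rfl rfl, add_comm (ite _ _ _)]
  exact ⟨_, rfl⟩

end EvenEnds

section BadEnd

variable {N : Type u} [LinearOrder N] [Nonempty N] {S : Struc N}
variable {M : Type v} [LinearOrder M] [DenselyOrdered M] [NoMinOrder M] [NoMaxOrder M]
  [Nonempty M] [DSpace S M] [OMin S M] {Γ : Type w} [Group Γ] [DSpace S Γ] [DGrp S Γ]

theorem DFn.mem_finite {X : Type*} [DSpace S X] [DSet S X] {s : Set X} (hs : s.Finite) :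
    DFn S (fun x => x ∈ s) := by
  induction s, hs using Set.Finite.induction_on with
  | empty => simpa using DFn.const False
  | insert _ _ ih =>
    simp only [Set.mem_insert_iff]
    fun_prop

namespace Coord

variable {κ : Coord S Γ M} {Λ : Set (Filter Γ)}

theorem eq_of_mem_germs {F : Filter Γ} {x y : Γ} (hx : κ.Int x) (hy : κ.Int y)
    (h : F ∈ κ.germs x) (h' : F ∈ κ.germs y) : x = y := by
  have aux : ∀ z, κ.Int z → F ∈ κ.germs z → ∃ b, Filter.map κ.c F = endAt (b, some (κ.c z)) := by
    rintro z hz (rfl | rfl)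
    · exact ⟨true, map_c_map_τ hz.1⟩
    · exact ⟨false, map_c_map_τ hz.2⟩
  obtain ⟨b, hb⟩ := aux x hx h
  obtain ⟨b', hb'⟩ := aux y hy h'
  have := endAt_injective (hb.symm.trans hb')
  simp only [Prod.mk.injEq, Option.some.injEq] at this
  exact κ.inj this.2

theorem GEnd.eventually_notMem {F : Filter Γ} (hF : κ.GEnd F) {s : Set Γ} (hs : s.Finite) :
    ∀ᶠ x in F, x ∉ s := by
  have : ∀ᶠ x in F, ∀ y ∈ s, x ≠ y :=
    (Filter.eventually_all_finite hs).2 fun y _ => hF.eventually_ne y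
  exact this.mono fun x hx hxs => hx x hxs rfl

theorem Base.eq_of_mem [Infinite Γ] (h : κ.Base Λ) {F : Filter Γ} {x y : Γ} (hx : F ∈ x • Λ)
    (hy : F ∈ y • Λ) : x = y := by
  obtain ⟨z, h1, h2⟩ := ((eventually_mul_right h.generic x).and
    (eventually_mul_right h.generic y)).exists
  have : z * x = z * y := eq_of_mem_germs (F := z • F) h1.1 h2.1
    (by rw [h1.2, ← smul_smul]; exact Set.smul_mem_smul_set hx)
    (by rw [h2.2, ← smul_smul]; exact Set.smul_mem_smul_set hy)
  exact mul_left_cancel this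

theorem Base.gEnd_of_mem (h : κ.Base Λ) {F : Filter Γ} {x : Γ} (hx : F ∈ x • Λ) : κ.GEnd F := by
  obtain ⟨s, hs, rfl⟩ := hx
  exact (h.gEnd s hs).smul x

theorem Base.inv_mem_smul (h : κ.Base Λ) {F : Filter Γ} {x : Γ} (hx : F ∈ x • Λ) :
    F⁻¹ ∈ x⁻¹ • Λ := by
  obtain ⟨s, hs, rfl⟩ := hx
  rw [← h.comm]
  change (x • s)⁻¹ ∈ _
  rw [op_smul_inv]
  exact Set.smul_mem_smul_set (h.inv_mem s hs)

theorem odd_card_of_inv {F : Finset Γ} (h1 : (1 : Γ) ∈ F) (hinv : ∀ x ∈ F, x⁻¹ ∈ F)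
    (htf : ∀ x : Γ, x ≠ 1 → x * x ≠ 1) : Odd F.card := by
  classical
  have h : Even (F.erase 1).card := by
    rw [← ZMod.natCast_eq_zero_iff_even, Finset.cast_card]
    refine Finset.sum_involution (fun x _ => x⁻¹) (fun _ _ => by decide) ?_ ?_ (by simp)
    · intro x hx _ e
      refine htf x (Finset.ne_of_mem_erase hx) ?_
      nth_rw 1 [← e]
      simp
    · intro x hx
      simp only [Finset.mem_erase, ne_eq, inv_eq_one] at hx ⊢
      exact ⟨hx.1, hinv x hx.2⟩
  rw [← Finset.card_erase_add_one h1]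
  exact h.add_one

/-- A one-dimensional group without involutions has an end which is not a translate of the
germs at the identity: otherwise the outer ends of a fundamental domain for inversion would be
odd in number. -/
theorem Base.exists_end [Infinite Γ] (h : κ.Base Λ) (htf : ∀ x : Γ, x ≠ 1 → x * x ≠ 1) :
    ∃ F, κ.GEnd F ∧ ∀ x : Γ, F ∉ x • Λ := by
  classical
  by_contra! H
  let D : Γ → Prop := fun x => κ.c x < κ.c x⁻¹
  have hD : DFn S D := by fun_prop
  obtain ⟨G, hG⟩ := OMin.exists_finset_eventually (S := S) (P := fun t => D (κ.τ t)) (by fun_prop)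
  let F₀ : Set Γ := {x | ¬ (κ.Int x ∧ κ.germs x = x • Λ)} ∪ κ.c ⁻¹' G ∪ {1}
  have hF₀ : F₀.Finite := (Set.Finite.union h.generic
    ((G.finite_toSet).preimage (fun x _ y _ h => κ.inj h))).union (Set.finite_singleton 1)
  let F : Set Γ := F₀ ∪ F₀⁻¹
  have hF : F.Finite := hF₀.union hF₀.inv
  have h1F : (1 : Γ) ∈ F := Or.inl (Or.inr rfl)
  have hFi : ∀ x, x⁻¹ ∈ F ↔ x ∈ F := fun x => by
    simp only [F, Set.mem_union, Set.mem_inv, inv_inv, or_comm]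
  have hFg : ∀ x ∉ F, κ.Int x ∧ κ.germs x = x • Λ := fun x hx => by
    by_contra hc
    exact hx (Or.inl (Or.inl (Or.inl hc)))
  have hFD : ∀ x ∉ F, (∀ᶠ t in rgt (κ.c x), D (κ.τ t) ↔ D x) ∧
      ∀ᶠ t in lft (κ.c x), D (κ.τ t) ↔ D x := fun x hx => by
    have := hG (κ.c x) fun hc => hx (Or.inl (Or.inl (Or.inr hc)))
    simpa using this
  have hFd := DFn.mem_finite (S := S) hF
  let D' : Γ → Prop := fun x => D x ∧ x ∉ F
  have hD' : DFn S D' := by fun_prop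
  let Q : M → Prop := fun t => κ.c (κ.τ t) = t ∧ D' (κ.τ t)
  have hQ : DFn S Q := by fun_prop
  have hop : ∀ t, Q t → (∀ᶠ s in rgt t, Q s) ∧ ∀ᶠ s in lft t, Q s := by
    rintro t ⟨h1, h2, h3⟩
    have hi := (hFg _ h3).1
    have hd := hFD _ h3
    have hr := (hi.gEnd (Or.inl rfl)).eventually_notMem hF
    have hl := (hi.gEnd (Or.inr rfl)).eventually_notMem hF
    rw [Filter.eventually_map] at hr hl
    rw [Int] at hi
    rw [h1] at hi hd hr hl
    constructor
    · filter_upwards [hi.1, hd.1, hr] with s h4 h5 h6 using ⟨h4, h5.2 h2, h6⟩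
    · filter_upwards [hi.2, hd.2, hl] with s h4 h5 h6 using ⟨h4, h5.2 h2, h6⟩
  have heven := even_outerEnds hQ hop
  obtain ⟨η, η', hne, hΛ⟩ := h.pair
  let E : Finset (Filter Γ) := (hF.toFinset ×ˢ {η, η'}).image fun p => p.1 • p.2
  have hE : ∀ e, e ∈ E ↔ ∃ x ∈ F, e ∈ x • Λ := fun e => by
    simp only [E, Finset.mem_image, Finset.mem_product, Set.Finite.mem_toFinset, Prod.exists,
      Set.mem_smul_set, hΛ]
    constructor
    · rintro ⟨x, s, ⟨h1, h2⟩, h3⟩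
      exact ⟨x, h1, s, by simpa using h2, h3⟩
    · rintro ⟨x, h1, s, h2, h3⟩
      exact ⟨x, s, ⟨h1, by simpa using h2⟩, h3⟩
  have hEcard : E.card = hF.toFinset.card * 2 := by
    rw [Finset.card_image_of_injOn, Finset.card_product, Finset.card_pair hne]
    rintro ⟨x, s⟩ hx ⟨y, s'⟩ hy hxy
    simp only [Finset.coe_product, Set.mem_prod, Finset.mem_coe] at hx hy hxy
    have hs : s ∈ Λ := by rw [hΛ]; simpa using hx.2
    have hs' : s' ∈ Λ := by rw [hΛ]; simpa using hy.2
    obtain rfl := h.eq_of_mem (F := x • s) (Set.smul_mem_smul_set hs)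
      (by rw [hxy]; exact Set.smul_mem_smul_set hs')
    rw [smul_left_cancel x hxy]
  have hsplit : ∀ x ∉ F, (D' x⁻¹ ↔ ¬ D' x) := by
    intro x hx
    have hx1 : κ.c x ≠ κ.c x⁻¹ := fun e => by
      refine htf x (fun h => hx (h ▸ h1F)) ?_
      nth_rw 1 [κ.inj e]
      simp
    simp only [D', D, hFi, hx, not_false_eq_true, and_true, inv_inv, not_lt]
    exact ⟨le_of_lt, fun h => h.lt_of_ne hx1.symm⟩
  have hflip : ∀ e ∈ E, (∀ᶠ x in e⁻¹, D' x) ↔ ¬ ∀ᶠ x in e, D' x := by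
    intro e he
    obtain ⟨x, hx, hxe⟩ := (hE e).1 he
    have he := h.gEnd_of_mem hxe
    rw [he.duf.not_eventually hD', show e⁻¹ = Filter.map (·⁻¹) e from rfl, Filter.eventually_map]
    exact eventually_congr ((he.eventually_notMem hF).mono hsplit)
  have hEinv : ∀ e ∈ E, e⁻¹ ∈ E := by
    intro e he
    obtain ⟨x, hx, hxe⟩ := (hE e).1 he
    exact (hE _).2 ⟨x⁻¹, (hFi x).2 hx, h.inv_mem_smul hxe⟩
  have hhalf : (E.filter fun e => ∀ᶠ x in e, D' x).card =
      (E.filter fun e => ¬ ∀ᶠ x in e, D' x).card := by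
    refine Finset.card_nbij' (·⁻¹) (·⁻¹) ?_ ?_ (fun _ _ => inv_inv _) (fun _ _ => inv_inv _)
    · intro e he
      simp only [Finset.coe_filter, Set.mem_ofPred_eq] at he ⊢
      exact ⟨hEinv e he.1, by rw [hflip e he.1]; exact not_not.2 he.2⟩
    · intro e he
      simp only [Finset.coe_filter, Set.mem_ofPred_eq] at he ⊢
      exact ⟨hEinv e he.1, (hflip e he.1).2 he.2⟩
  have hbij : (fun p => Filter.map κ.τ (endAt p)) '' {p | OuterEnd Q p} =
      ↑(E.filter fun e => ∀ᶠ x in e, D' x) := by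
    ext e
    simp only [Finset.coe_filter, Set.mem_image, Set.mem_ofPred_eq]
    constructor
    · rintro ⟨p, ⟨h1, h2⟩, rfl⟩
      have hmid : ∀ᶠ t in endAt p, κ.c (κ.τ t) = t := h1.mono fun t ht => ht.1
      have hDp : ∀ᶠ x in Filter.map κ.τ (endAt p), D' x := h1.mono fun t ht => ht.2
      have hg : κ.GEnd (Filter.map κ.τ (endAt p)) := ⟨_, isEnd_iff.2 ⟨p, rfl⟩, hmid, rfl⟩
      refine ⟨(hE _).2 ?_, hDp⟩
      obtain ⟨x, hx⟩ := H _ hg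
      refine ⟨x, ?_, hx⟩
      by_contra hxF
      have hi := (hFg x hxF).1
      have hd := hFD x hxF
      rw [← (hFg x hxF).2] at hx
      have hnq : κ.c x ∈ p.2 ∧ D x := by
        have := (hg.duf).neBot
        rcases hx with hx | hx
        · have e := congrArg (Filter.map κ.c) hx
          rw [map_c_map_τ hmid, map_c_map_τ hi.1] at e
          refine ⟨by rw [endAt_injective (a₂ := (true, some (κ.c x))) e]; rfl, ?_⟩
          rw [e] at h1
          have := (DUF.rgt (S := S) (κ.c x)).neBot
          obtain ⟨t, h3, h4⟩ := (h1.and hd.1).exists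
          exact h4.1 h3.2.1
        · have e := congrArg (Filter.map κ.c) hx
          rw [map_c_map_τ hmid, map_c_map_τ hi.2] at e
          refine ⟨by rw [endAt_injective (a₂ := (false, some (κ.c x))) e]; rfl, ?_⟩
          rw [e] at h1
          have := (DUF.lft (S := S) (κ.c x)).neBot
          obtain ⟨t, h3, h4⟩ := (h1.and hd.2).exists
          exact h4.1 h3.2.1
      refine h2 _ hnq.1 ⟨by simp, ?_⟩
      rw [κ.left_inv]
      exact ⟨hnq.2, hxF⟩
    · rintro ⟨he, hDe⟩
      obtain ⟨x, hxF, hx⟩ := (hE _).1 he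
      obtain ⟨ε, hε, hm, rfl⟩ := h.gEnd_of_mem hx
      obtain ⟨p, rfl⟩ := isEnd_iff.1 hε
      refine ⟨p, ⟨hm.and hDe, ?_⟩, rfl⟩
      rintro t ht ⟨h1, h2, h3⟩
      refine h3 ?_
      have : Filter.map κ.τ (endAt p) ∈ κ.germs (κ.τ t) := by
        obtain ⟨b, o⟩ := p
        obtain rfl : o = some t := ht
        rw [germs, h1]
        cases b
        exacts [Or.inr rfl, Or.inl rfl]
      rw [(hFg _ h3).2] at this
      rwa [h.eq_of_mem this hx]
  have hinj : Set.InjOn (fun p => Filter.map κ.τ (endAt p)) {p | OuterEnd Q p} := by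
    rintro p ⟨h1, -⟩ q ⟨h2, -⟩ e
    have := congrArg (Filter.map κ.c) e
    simp only at this
    rw [map_c_map_τ (h1.mono fun t ht => ht.1), map_c_map_τ (h2.mono fun t ht => ht.1)] at this
    exact endAt_injective this
  rw [← hinj.ncard_image, hbij, Set.ncard_coe_finset] at heven
  have hcard := Finset.card_filter_add_card_filter_not (s := E) (fun e => ∀ᶠ x in e, D' x)
  have hodd := odd_card_of_inv (F := hF.toFinset) (by simpa using h1F)
    (fun x hx => by simpa [hFi] using hx) htf
  rw [← hhalf, hEcard] at hcard
  rw [← Nat.not_even_iff_odd] at hodd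
  exact hodd (by convert heven using 1; omega)

end Coord

end BadEnd

section InvariantEnd

variable {N : Type u} [LinearOrder N] [Nonempty N] {S : Struc N}
variable {M : Type v} [LinearOrder M] [DenselyOrdered M] [NoMinOrder M] [NoMaxOrder M]
  [Nonempty M] [DSpace S M] [OMin S M] {Γ : Type w} [Group Γ] [DSpace S Γ] [DGrp S Γ]

namespace Coord

variable {κ : Coord S Γ M} {Λ : Set (Filter Γ)} {F G : Filter Γ}

theorem GEnd.eq_of_cut (hF : κ.GEnd F) (hG : κ.GEnd G)
    (h : ∀ x, (∀ᶠ y in F, x < κ.c y) ↔ ∀ᶠ y in G, x < κ.c y) : F = G := by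
  obtain ⟨ε, h1, h2, rfl⟩ := hF
  obtain ⟨δ, h3, h4, rfl⟩ := hG
  rw [h1.eq_of_cut h3]
  intro x
  have := h x
  rw [Filter.eventually_map, Filter.eventually_map] at this
  rw [← eventually_congr (h2.mono fun t ht => show x < κ.c (κ.τ t) ↔ x < t by rw [ht]),
    ← eventually_congr (h4.mono fun t ht => show x < κ.c (κ.τ t) ↔ x < t by rw [ht]), this]

theorem GEnd.stabilizer_def (hF : κ.GEnd F) :
    DFn S (fun g : Γ => g ∈ MulAction.stabilizer Γ F) := by
  have h1 := (hF.duf (S := S)).fam (Z := Γ × M) (P := fun p y => p.2 < κ.c (p.1 * y)) (by fun_prop)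
  have h2 := (hF.duf (S := S)).fam (Z := Γ × M) (P := fun p y => p.2 < κ.c y) (by fun_prop)
  refine DFn.congr (P := fun g => ∀ x, (∀ᶠ y in F, x < κ.c (g * y)) ↔ ∀ᶠ y in F, x < κ.c y)
    (DFn.all (h1.iff h2)) fun g => ?_
  rw [MulAction.mem_stabilizer_iff]
  constructor
  · intro e x
    conv_rhs => rw [← e]
    exact Iff.rfl
  · intro h
    exact (hF.smul g).eq_of_cut hF h

theorem Base.finite_bad (h : κ.Base Λ) : {F | κ.GEnd F ∧ ∀ x : Γ, F ∉ x • Λ}.Finite := by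
  classical
  obtain ⟨G, hG⟩ := OMin.exists_finset_eventually (S := S) (P := fun t => κ.c (κ.τ t) = t)
    (by fun_prop)
  have hb : {x | ¬ (κ.Int x ∧ κ.germs x = x • Λ)}.Finite := h.generic
  let B : Finset M := G ∪ hb.toFinset.image κ.c
  refine ((Finset.univ ×ˢ B.insertNone).finite_toSet.image
    fun p => Filter.map κ.τ (endAt p)).subset ?_
  rintro _ ⟨⟨ε, hε, hm, rfl⟩, hx⟩
  obtain ⟨⟨b, o⟩, rfl⟩ := isEnd_iff.1 hε
  refine ⟨(b, o), ?_, rfl⟩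
  simp only [Finset.coe_product, Finset.coe_univ, Set.mem_prod, Set.mem_univ, true_and,
    Finset.mem_coe, Finset.mem_insertNone]
  intro t ht
  obtain rfl : o = some t := ht
  by_contra htB
  have hne : (endAt (b, some t)).NeBot := (hε.duf (S := S)).neBot
  have htc : κ.c (κ.τ t) = t := by
    have := hG t fun h => htB (Finset.mem_union_left _ h)
    cases b
    · obtain ⟨s, h1, h2⟩ := (hm.and this.2).exists
      exact h2.1 h1
    · obtain ⟨s, h1, h2⟩ := (hm.and this.1).exists
      exact h2.1 h1
  have hg : κ.Int (κ.τ t) ∧ κ.germs (κ.τ t) = κ.τ t • Λ := by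
    by_contra hc
    refine htB (Finset.mem_union_right _ (Finset.mem_image.2 ⟨κ.τ t, ?_, htc⟩))
    simpa using hc
  refine hx (κ.τ t) ?_
  rw [← hg.2, germs, htc]
  cases b
  exacts [Or.inr rfl, Or.inl rfl]

theorem Base.exists_invariant_end [Infinite Γ] (h : κ.Base Λ)
    (htf : ∀ x : Γ, x ≠ 1 → x * x ≠ 1)
    (hconn : ∀ H : Subgroup Γ, DFn S (fun x => x ∈ H) → H.FiniteIndex → H = ⊤) :
    ∃ F, κ.GEnd F ∧ ∀ g : Γ, g • F = F ∧ MulOpposite.op g • F = F := by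
  have key : ∀ F, κ.GEnd F → (∀ x : Γ, F ∉ x • Λ) → ∀ g : Γ, g • F = F := by
    intro F hF hb g
    have hfin : (MulAction.orbit Γ F).Finite := by
      refine h.finite_bad.subset ?_
      rintro _ ⟨g, rfl⟩
      refine ⟨hF.smul g, fun x hx => hb (g⁻¹ * x) ?_⟩
      rw [← smul_smul, ← Set.smul_mem_smul_set_iff (a := g), smul_inv_smul]
      exact hx
    have hst := hconn (MulAction.stabilizer Γ F) hF.stabilizer_def ⟨by
      rw [MulAction.index_stabilizer]
      exact (Set.ncard_pos hfin).2 (MulAction.nonempty_orbit F) |>.ne'⟩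
    have : g ∈ MulAction.stabilizer Γ F := by rw [hst]; trivial
    exact this
  obtain ⟨F, hF, hb⟩ := h.exists_end htf
  refine ⟨F, hF, fun g => ⟨key F hF hb g, ?_⟩⟩
  have h2 := key F⁻¹ hF.inv (fun x hx => hb x⁻¹ (by
    have := h.inv_mem_smul hx
    rwa [inv_inv] at this)) g⁻¹
  have h3 := congrArg (·⁻¹) h2
  simpa [op_smul_inv] using h3

end Coord

end InvariantEnd

section LeftEnds

variable {M : Type v} [LinearOrder M] [DenselyOrdered M] [NoMinOrder M] [NoMaxOrder M] [Nonempty M]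

/-- The interval between `m` and the end lying to the left of `o`. -/
def Near (o : Option M) (m : M) : Set M := {t | m < t ∧ ∀ b ∈ o, t < b}

theorem near_ordConnected (o : Option M) (m : M) : (Near o m).OrdConnected :=
  ⟨fun _ hx _ hy _ hz => ⟨hx.1.trans_le hz.1, fun b hb => hz.2.trans_lt (hy.2 b hb)⟩⟩

theorem eventually_endAt_false {o : Option M} {p : M → Prop} :
    (∀ᶠ t in endAt (false, o), p t) ↔ ∃ m, (∀ b ∈ o, m < b) ∧ ∀ t ∈ Near o m, p t := by
  cases o with
  | none =>
    refine (eventually_atTop_lt (P := p)).trans (exists_congr fun m => ?_)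
    simp [Near]
  | some b =>
    refine (eventually_lft (P := p)).trans (exists_congr fun m => ?_)
    simp [Near]

theorem endAt_false_gt {o : Option M} {m : M} (hm : ∀ b ∈ o, m < b) :
    ∀ᶠ t in endAt (false, o), t ∈ Near o m :=
  eventually_endAt_false.2 ⟨m, hm, fun _ h => h⟩

variable {N : Type u} [LinearOrder N] {S : Struc N} [DSpace S M] [OMin S M]

theorem DFn.mono3_near {Y : Type*} [LinearOrder Y] [DenselyOrdered Y] [NoMinOrder Y] [NoMaxOrder Y]
    [Nonempty Y] [DSpace S Y] [OMin S Y] {f : M → Y} (hf : DFn S f) (o : Option M) :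
    ∃ m, (∀ b ∈ o, m < b) ∧ Mono3 f (Near o m) := by
  obtain ⟨F, hF⟩ := hf.monotonicity
  have hε : IsEnd (endAt (false, o)) := isEnd_iff.2 ⟨_, rfl⟩
  have : ∀ᶠ t in endAt (false, o), ∀ x ∈ F, t ≠ x :=
    (Finset.eventually_all F).2 fun x _ => hε.eventually_ne x
  obtain ⟨m, hm, h⟩ := eventually_endAt_false.1 this
  exact ⟨m, hm, hF _ (near_ordConnected o m) fun x hx hx' => h x hx' x hx rfl⟩

end LeftEnds

section InvariantOrder

variable {N : Type u} [LinearOrder N] [Nonempty N] {S : Struc N}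
variable {M : Type v} [LinearOrder M] [DenselyOrdered M] [NoMinOrder M] [NoMaxOrder M]
  [Nonempty M] [DSpace S M] [OMin S M] {Γ : Type w} [Group Γ] [DSpace S Γ] [DGrp S Γ]

namespace Coord

variable {κ : Coord S Γ M} {Λ : Set (Filter Γ)} {o : Option M} {e : Filter Γ}

/-- The order of a group given by the order of the coordinate at an invariant end. -/
def endLT (κ : Coord S Γ M) (e : Filter Γ) (x y : Γ) : Prop := ∀ᶠ s in e, κ.c (x * s) < κ.c (y * s)

theorem endLT_trichotomy (he : DUF S e) (x y : Γ) : κ.endLT e x y ∨ x = y ∨ κ.endLT e y x := by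
  by_cases hxy : x = y
  · exact .inr (.inl hxy)
  rcases he.ultra (P := fun s => κ.c (x * s) < κ.c (y * s)) (by fun_prop) with h | h
  · exact .inl h
  · exact .inr (.inr (h.mono fun s hs => lt_of_le_of_ne (not_lt.1 hs)
      fun h => hxy (mul_right_cancel (κ.inj h).symm)))

theorem endLT_mul_right (hinv : ∀ g : Γ, g • e = e) {x y : Γ} (z : Γ) (h : κ.endLT e x y) :
    κ.endLT e (x * z) (y * z) := by
  unfold endLT at h ⊢
  rw [← hinv z] at h
  have h : ∀ᶠ s in e, κ.c (x * (z * s)) < κ.c (y * (z * s)) := h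
  simpa only [mul_assoc] using h

theorem endLT_mul_left (hm : ∀ᶠ t in endAt (false, o), κ.c (κ.τ t) = t)
    (he : e = map κ.τ (endAt (false, o))) (hinv : ∀ g : Γ, g • e = e) {x y : Γ} (z : Γ)
    (h : κ.endLT e x y) : κ.endLT e (z * x) (z * y) := by
  have hd : DUF S (endAt (false, o)) := (isEnd_iff.2 ⟨_, rfl⟩ : IsEnd _).duf
  have hne := hd.neBot
  have mv : ∀ {p : Γ → Prop} (g : Γ), (∀ᶠ s in e, p s) → ∀ᶠ s in e, p (g * s) := fun g hp => by
    rw [← hinv g] at hp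
    exact hp
  have hc : ∀ {p : M → Prop}, (∀ᶠ t in endAt (false, o), p t) → ∀ᶠ s in e, p (κ.c s) :=
    fun {p} hp => by
      rw [he, Filter.eventually_map]
      filter_upwards [hp, hm] with t h1 h2
      rwa [h2]
  have hτ : ∀ {p : Γ → Prop}, (∀ᶠ s in e, p s) → ∀ᶠ t in endAt (false, o), p (κ.τ t) :=
    fun {p} hp => by rwa [he, Filter.eventually_map] at hp
  obtain ⟨m, hmo, h3⟩ := DFn.mono3_near (S := S) (f := fun t => κ.c (z * κ.τ t)) (by fun_prop) o
  obtain ⟨t₁, ht₁⟩ := (endAt_false_gt hmo).exists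
  have hmono : StrictMonoOn (fun t => κ.c (z * κ.τ t)) (Near o m) := by
    rcases h3 with h3 | h3 | h3
    · exfalso
      obtain ⟨t, h4, h5, h6, h7⟩ := ((endAt_false_gt hmo).and (hm.and
        ((isEnd_iff.2 ⟨_, rfl⟩ : IsEnd (endAt (false, o))).eventually_ne
          (κ.c (κ.τ t₁)) |>.and (endAt_false_gt hmo)))).exists
      have h8 := κ.inj (h3 t h4 t₁ ht₁)
      exact h6 (by rw [← h5, mul_left_cancel h8])
    · exact h3
    · exfalso
      have h4 : ∀ᶠ t in endAt (false, o), κ.c (z * κ.τ t) ∈ Near o (κ.c (z * κ.τ t₁)) := by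
        refine hτ (mv z (hc (endAt_false_gt ?_)))
        intro b hb
        by_contra! hle
        obtain ⟨t, h5, h6, h7⟩ := ((endAt_false_gt ht₁.2).and ((endAt_false_gt hmo).and
          (hτ (mv z (hc (endAt_false_gt hmo)))))).exists
        have := h3 ht₁ h6 h5.1
        obtain ⟨t', h8, h9, h10⟩ := ((hτ (mv z (hc (endAt_false_gt h7.2)))).and
          ((endAt_false_gt h6.2).and (endAt_false_gt hmo))).exists
        exact (h3 h6 h10 h9.1).asymm h8.1
      obtain ⟨t, h5, h6, h7⟩ := (h4.and ((endAt_false_gt ht₁.2).and (endAt_false_gt hmo))).exists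
      exact (h3 ht₁ h7 h6.1).asymm h5.1
  unfold endLT at h ⊢
  filter_upwards [h, mv x (hc (endAt_false_gt hmo)), mv y (hc (endAt_false_gt hmo))] with s h4 h5 h6
  simpa [mul_assoc] using hmono h5 h6 h4

theorem exists_order (hm : ∀ᶠ t in endAt (false, o), κ.c (κ.τ t) = t)
    (he : e = map κ.τ (endAt (false, o))) (hinv : ∀ g : Γ, g • e = e) :
    ∃ _ : LinearOrder Γ, (∀ x y, x < y ↔ κ.endLT e x y) ∧ MulLeftStrictMono Γ ∧
      MulRightStrictMono Γ := by
  classical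
  have hd₀ : DUF S (endAt (false, o)) := (isEnd_iff.2 ⟨_, rfl⟩ : IsEnd _).duf
  have hd : DUF S e := (hd₀.map κ.hτ).congr_filter he.symm
  have hne := hd.neBot
  have : IsStrictTotalOrder Γ (κ.endLT e) :=
    { trichotomous := fun x y h1 h2 => by
        rcases endLT_trichotomy (κ := κ) hd x y with h | h | h
        exacts [absurd h h1, h, absurd h h2]
      irrefl := fun x h => by
        obtain ⟨s, hs⟩ := Eventually.exists h
        exact lt_irrefl _ hs
      trans := fun x y z h1 h2 => (Eventually.and h1 h2).mono fun s hs => hs.1.trans hs.2 }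
  let _ := linearOrderOfSTO (κ.endLT e)
  exact ⟨_, fun x y => Iff.rfl, ⟨fun z x y h => endLT_mul_left hm he hinv z h⟩,
    ⟨fun z x y h => endLT_mul_right hinv z h⟩⟩

end Coord
end InvariantOrder

section OrderedGroup

variable {N : Type u} [LinearOrder N] [Nonempty N] {S : Struc N}
variable {M : Type v} [LinearOrder M] [DenselyOrdered M] [NoMinOrder M] [NoMaxOrder M]
  [Nonempty M] [DSpace S M] [OMin S M] {Γ : Type w} [Group Γ] [DSpace S Γ] [DGrp S Γ]

namespace Coord

variable {κ : Coord S Γ M} {Λ : Set (Filter Γ)} {o : Option M} {e : Filter Γ}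
  [LinearOrder Γ] [MulLeftStrictMono Γ] [MulRightStrictMono Γ]

theorem endLT_def (hd : DUF S e) (hlt : ∀ x y, x < y ↔ κ.endLT e x y) :
    DFn S (fun p : Γ × Γ => p.1 < p.2) := by
  refine DFn.congr (hd.fam (Z := Γ × Γ) (P := fun p s => κ.c (p.1 * s) < κ.c (p.2 * s))
    (by fun_prop)) fun p => (hlt p.1 p.2)

theorem Base.exists_right (h : κ.Base Λ) (hL : DFn S (fun p : Γ × Γ => p.1 < p.2)) :
    ∃ η η', Λ = {η, η'} ∧ (∀ᶠ g in η, 1 < g) ∧ (∀ᶠ g in η', g < 1) ∧ η' = η⁻¹ := by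
  have hP : DFn S (fun g : Γ => 1 < g) := hL.comp (f := fun g : Γ => ((1 : Γ), g)) (by fun_prop)
  have inv : ∀ {F : Filter Γ}, (∀ᶠ g in F, 1 < g) → ∀ᶠ g in F⁻¹, g < 1 := fun hF => by
    change ∀ᶠ g in Filter.map _ _, _
    rw [Filter.eventually_map]
    exact hF.mono fun g hg => inv_lt_one'.2 hg
  obtain ⟨η, η', hne, rfl⟩ := h.pair
  have key : ∀ η η', η ≠ η' → (κ.Base {η, η'}) → (∀ᶠ g in η, 1 < g) →
      (∀ᶠ g in η', g < 1) ∧ η' = η⁻¹ := by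
    intro η η' hne h h1
    have hd := (h.gEnd η (by simp)).duf (S := S)
    have hb := hd.neBot
    have e : η' = η⁻¹ := by
      rcases h.inv_mem η (by simp) with h2 | h2
      · exfalso
        have := inv h1
        rw [h2] at this
        obtain ⟨s, h3, h4⟩ := (this.and h1).exists
        exact h3.asymm h4
      · exact h2.symm
    exact ⟨e ▸ inv h1, e⟩
  have hη := (h.gEnd η (by simp)).duf (S := S)
  rcases hη.ultra hP with h1 | h1
  · exact ⟨η, η', rfl, h1, key η η' hne h h1⟩
  · have h2 : ∀ᶠ g in η, g < 1 := by
      filter_upwards [h1, (h.gEnd η (by simp)).eventually_ne 1] with g h3 h4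
      exact lt_of_le_of_ne (not_lt.1 h3) h4
    have h3 : ∀ᶠ g in η⁻¹, 1 < g := by
      change ∀ᶠ g in Filter.map _ _, _
      rw [Filter.eventually_map]
      exact h2.mono fun g hg => one_lt_inv'.2 hg
    rcases h.inv_mem η (by simp) with h4 | h4
    · exfalso
      rw [h4] at h3
      have := hη.neBot
      obtain ⟨s, h5, h6⟩ := (h3.and h2).exists
      exact h5.asymm h6
    · have h4 : η⁻¹ = η' := h4
      rw [h4] at h3
      exact ⟨η', η, Set.pair_comm _ _, h3, key η' η hne.symm (by rwa [Set.pair_comm]) h3⟩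

theorem exists_strictMono_near (h : κ.Base Λ) (hm : ∀ᶠ t in endAt (false, o), κ.c (κ.τ t) = t)
    (he : e = map κ.τ (endAt (false, o))) (hinv : ∀ g : Γ, g • e = e)
    (hlt : ∀ x y, x < y ↔ κ.endLT e x y) {η η' : Filter Γ} (hΛ : Λ = {η, η'})
    (h1 : ∀ᶠ g in η, 1 < g) (h1' : ∀ᶠ g in η', g < 1) :
    ∃ m, (∀ b ∈ o, m < b) ∧ StrictMonoOn κ.τ (Near o m) ∧
      ∀ t ∈ Near o m, κ.c (κ.τ t) = t ∧ Filter.map κ.τ (rgt t) = κ.τ t • η ∧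
        Filter.map κ.τ (lft t) = κ.τ t • η' := by
  have hd₀ : DUF S (endAt (false, o)) := (isEnd_iff.2 ⟨_, rfl⟩ : IsEnd _).duf
  have hd : DUF S e := (hd₀.map κ.hτ).congr_filter he.symm
  have hL := endLT_def hd hlt
  have hne₀ := hd₀.neBot
  have hg : ∀ᶠ t in endAt (false, o), κ.Int (κ.τ t) ∧ κ.germs (κ.τ t) = κ.τ t • Λ := by
    have hb : {x | ¬ (κ.Int x ∧ κ.germs x = x • Λ)}.Finite := h.generic
    have : κ.GEnd e := ⟨_, isEnd_iff.2 ⟨_, rfl⟩, hm, he⟩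
    have h2 := this.eventually_notMem hb
    rw [he, Filter.eventually_map] at h2
    exact h2.mono fun t ht => by simpa using ht
  have up : ∀ (w : Γ) {F : Filter Γ}, (∀ᶠ g in F, 1 < g) → ∀ᶠ g in w • F, w < g := fun w F hF => by
    change ∀ᶠ g in Filter.map _ _, _
    rw [Filter.eventually_map]
    exact hF.mono fun g hg => lt_mul_of_one_lt_right' w hg
  have dn : ∀ (w : Γ) {F : Filter Γ}, (∀ᶠ g in F, g < 1) → ∀ᶠ g in w • F, g < w := fun w F hF => by
    change ∀ᶠ g in Filter.map _ _, _
    rw [Filter.eventually_map]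
    exact hF.mono fun g hg => mul_lt_of_lt_one_right' w hg
  have hA : DFn S (fun t : M => ∀ᶠ s in rgt t, κ.τ t < κ.τ s) := by
    have h2 : DFn S (fun t : M => ∃ y, t < y ∧ ∀ s, t < s → s < y → κ.τ t < κ.τ s) := by
      have h3 : DFn S (fun p : M × M => κ.τ p.1 < κ.τ p.2) :=
        hL.comp (f := fun p : M × M => (κ.τ p.1, κ.τ p.2)) (by fun_prop)
      have h4 : DFn S (fun p : (M × M) × M => κ.τ p.1.1 < κ.τ p.2) :=
        h3.comp (f := fun p : (M × M) × M => (p.1.1, p.2)) (by fun_prop)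
      have h5 : DFn S (fun p : M × M => ∀ s, p.1 < s → s < p.2 → κ.τ p.1 < κ.τ s) :=
        DFn.all (DFn.imp (by fun_prop) (DFn.imp (by fun_prop) h4))
      exact DFn.ex (DFn.and (by fun_prop) h5)
    exact h2.congr fun t => by rw [eventually_rgt]
  have germ : ∀ t, κ.c (κ.τ t) = t → κ.germs (κ.τ t) = κ.τ t • Λ → κ.Int (κ.τ t) →
      (Filter.map κ.τ (rgt t) = κ.τ t • η ∧ Filter.map κ.τ (lft t) = κ.τ t • η') ∨
      (Filter.map κ.τ (rgt t) = κ.τ t • η' ∧ Filter.map κ.τ (lft t) = κ.τ t • η) := by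
    intro t h2 h3 h4
    have h5 := h4.ne
    rw [germs, h2, hΛ, ← Set.image_smul, Set.image_pair, Set.pair_eq_pair_iff] at h3
    exact h3
  rcases hd₀.ultra hA with hA | hA
  · obtain ⟨m, hmo, h2⟩ := eventually_endAt_false.1 (hA.and (hm.and hg))
    have h3 : ∀ t ∈ Near o m, κ.c (κ.τ t) = t ∧ Filter.map κ.τ (rgt t) = κ.τ t • η ∧
        Filter.map κ.τ (lft t) = κ.τ t • η' := by
      intro t ht
      obtain ⟨h4, h5, h6, h7⟩ := h2 t ht
      refine ⟨h5, (germ t h5 h7 h6).resolve_right ?_⟩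
      rintro ⟨h8, -⟩
      have h9 := dn (κ.τ t) h1'
      rw [← h8, Filter.eventually_map] at h9
      have := (DUF.rgt (S := S) t).neBot
      obtain ⟨s, h10, h11⟩ := (h4.and h9).exists
      exact h10.asymm h11
    refine ⟨m, hmo, ?_, h3⟩
    intro x hx y hy hxy
    refine OMin.Icc_induction (S := S) (Q := fun z => x < z → κ.τ x < κ.τ z) (x := x) (y := y)
      ?_ ?_ ?_ ?_ y hxy.le le_rfl hxy
    · refine DFn.imp (by fun_prop) ?_
      exact hL.comp (f := fun z : M => (κ.τ x, κ.τ z)) (by fun_prop)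
    · exact fun h => absurd h (lt_irrefl _)
    · intro z hxz hzy hz
      refine (h2 z ((near_ordConnected o m).out hx hy ⟨hxz, hzy.le⟩)).1.mono fun s hs _ => ?_
      rcases hxz.eq_or_lt with rfl | hxz
      exacts [hs, (hz hxz).trans hs]
    · intro z hxz hzy hz _
      have h4 := dn (κ.τ z) h1'
      rw [← (h3 z ((near_ordConnected o m).out hx hy ⟨hxz.le, hzy⟩)).2.2, Filter.eventually_map,
        eventually_lft] at h4
      obtain ⟨a, ha, h4⟩ := h4
      obtain ⟨s, hs, hs'⟩ := exists_between (max_lt ha hxz)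
      exact (hz s ((le_max_right _ _).trans hs.le) hs' ((le_max_right _ _).trans_lt hs)).trans
        (h4 s ((le_max_left _ _).trans_lt hs) hs')
  · exfalso
    obtain ⟨m, hmo, h2⟩ := eventually_endAt_false.1 (hA.and (hm.and hg))
    have h3 : ∀ t ∈ Near o m, κ.c (κ.τ t) = t ∧ Filter.map κ.τ (rgt t) = κ.τ t • η' ∧
        Filter.map κ.τ (lft t) = κ.τ t • η := by
      intro t ht
      obtain ⟨h4, h5, h6, h7⟩ := h2 t ht
      refine ⟨h5, (germ t h5 h7 h6).resolve_left ?_⟩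
      rintro ⟨h8, -⟩
      have h9 := up (κ.τ t) h1
      rw [← h8, Filter.eventually_map] at h9
      exact h4 h9
    have hanti : StrictAntiOn κ.τ (Near o m) := by
      intro x hx y hy hxy
      refine OMin.Icc_induction (S := S) (Q := fun z => x < z → κ.τ z < κ.τ x) (x := x) (y := y)
        ?_ ?_ ?_ ?_ y hxy.le le_rfl hxy
      · refine DFn.imp (by fun_prop) ?_
        exact hL.comp (f := fun z : M => (κ.τ z, κ.τ x)) (by fun_prop)
      · exact fun h => absurd h (lt_irrefl _)
      · intro z hxz hzy hz
        have h4 := dn (κ.τ z) h1'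
        rw [← (h3 z ((near_ordConnected o m).out hx hy ⟨hxz, hzy.le⟩)).2.1,
          Filter.eventually_map] at h4
        refine h4.mono fun s hs _ => ?_
        rcases hxz.eq_or_lt with rfl | hxz
        exacts [hs, hs.trans (hz hxz)]
      · intro z hxz hzy hz _
        have h4 := up (κ.τ z) h1
        rw [← (h3 z ((near_ordConnected o m).out hx hy ⟨hxz.le, hzy⟩)).2.2, Filter.eventually_map,
          eventually_lft] at h4
        obtain ⟨a, ha, h4⟩ := h4
        obtain ⟨s, hs, hs'⟩ := exists_between (max_lt ha hxz)
        exact (h4 s ((le_max_left _ _).trans_lt hs) hs').trans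
          (hz s ((le_max_right _ _).trans hs.le) hs' ((le_max_right _ _).trans_lt hs))
    have mv : ∀ (g : Γ), ∀ᶠ s in e, κ.c (g * s) ∈ Near o m := fun g => by
      have : ∀ᶠ s in e, κ.c s ∈ Near o m := by
        rw [he, Filter.eventually_map]
        filter_upwards [endAt_false_gt hmo, hm] with t h1 h2
        rwa [h2]
      rw [← hinv g] at this
      exact this
    have := ((h.gEnd η (by simp [hΛ])).duf (S := S)).neBot
    obtain ⟨x, hx⟩ := h1.exists
    have := hd.neBot
    obtain ⟨s, h4, h5, h6⟩ := (((hlt 1 x).1 hx).and ((mv 1).and (mv x))).exists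
    have h7 := hanti h5 h6 h4
    rw [κ.left_inv, κ.left_inv] at h7
    exact h7.not_gt (by gcongr)

end Coord
end OrderedGroup

section OrderedGroupOMin

variable {N : Type u} [LinearOrder N] [Nonempty N] {S : Struc N}
variable {M : Type v} [LinearOrder M] [DenselyOrdered M] [NoMinOrder M] [NoMaxOrder M]
  [Nonempty M] [DSpace S M] [OMin S M] {Γ : Type w} [Group Γ] [DSpace S Γ] [DGrp S Γ]

namespace Coord

variable {κ : Coord S Γ M} {Λ : Set (Filter Γ)} {o : Option M} {e : Filter Γ}
  [LinearOrder Γ] [MulLeftStrictMono Γ] [MulRightStrictMono Γ]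

theorem Base.omin (h : κ.Base Λ) (hm : ∀ᶠ t in endAt (false, o), κ.c (κ.τ t) = t)
    (he : e = map κ.τ (endAt (false, o))) (hinv : ∀ g : Γ, g • e = e ∧ MulOpposite.op g • e = e)
    (hlt : ∀ x y, x < y ↔ κ.endLT e x y) :
    DenselyOrdered Γ ∧ NoMinOrder Γ ∧ NoMaxOrder Γ ∧ OMin S Γ := by
  classical
  have := mulLeftMono_of_mulLeftStrictMono Γ
  have := mulRightMono_of_mulRightStrictMono Γ
  have hd₀ : DUF S (endAt (false, o)) := (isEnd_iff.2 ⟨_, rfl⟩ : IsEnd _).duf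
  have hd : DUF S e := (hd₀.map κ.hτ).congr_filter he.symm
  have hL := endLT_def hd hlt
  have hne₀ := hd₀.neBot
  have hne := hd.neBot
  have hGe : κ.GEnd e := ⟨_, isEnd_iff.2 ⟨_, rfl⟩, hm, he⟩
  obtain ⟨η, η', hΛ, h1, h1', hηη'⟩ := h.exists_right hL
  obtain ⟨m, hmo, hmono, hJ⟩ := exists_strictMono_near h hm he (fun g => (hinv g).1) hlt hΛ h1 h1'
  have hη := (h.gEnd η (by simp [hΛ])).duf (S := S)
  have hη' := (h.gEnd η' (by simp [hΛ])).duf (S := S)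
  have hηn := hη.neBot
  have hηn' := hη'.neBot
  have toJ : ∀ {p : Γ → Prop}, (∀ t ∈ Near o m, p (κ.τ t)) → ∀ᶠ s in e, p s := fun {p} hp => by
    rw [he, Filter.eventually_map]
    exact (endAt_false_gt hmo).mono fun t ht => hp t ht
  have hcJ : ∀ᶠ s in e, κ.c s ∈ Near o m := toJ fun t ht => by rwa [(hJ t ht).1]
  have cmono : ∀ {x y : Γ}, κ.c x ∈ Near o m → κ.c y ∈ Near o m → (κ.c x < κ.c y ↔ x < y) :=
    fun {x y} hx hy => by
      have := hmono.lt_iff_lt hx hy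
      rwa [κ.left_inv, κ.left_inv, iff_comm] at this
  have hgt : ∀ g, ∀ᶠ s in e, g < s := by
    intro g
    rcases hd.ultra (P := fun s => g < s)
      (hL.comp (f := fun s : Γ => (g, s)) (by fun_prop)) with h2 | h2
    · exact h2
    · exfalso
      have h3 : ∀ h, ∀ᶠ s in e, s ≤ h := by
        intro h
        rw [← (hinv (h * g⁻¹)).1]
        change ∀ᶠ s in Filter.map _ _, _
        rw [Filter.eventually_map]
        refine h2.mono fun s hs => ?_
        calc h * g⁻¹ * s ≤ h * g⁻¹ * g := by gcongr; exact not_lt.1 hs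
          _ = h := by group
      obtain ⟨t, ht⟩ := (endAt_false_gt hmo).exists
      have h4 := h3 (κ.τ t)
      rw [he, Filter.eventually_map] at h4
      obtain ⟨s, h5, h6, h7⟩ := (h4.and ((endAt_false_gt ht.2).and (endAt_false_gt hmo))).exists
      exact (hmono ht h7 h6.1).not_ge h5
  have hη1 : ∀ k, 1 < k → ∀ᶠ g in η, g < k := by
    intro k hk
    rcases hη.ultra (P := fun s => s < k)
      (hL.comp (f := fun s : Γ => (s, k)) (by fun_prop)) with h2 | h2
    · exact h2
    · exfalso
      have h3 : ∀ᶠ w in e, κ.c (w * k) ∈ Near o m := by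
        rw [← (hinv k).2] at hcJ
        exact hcJ
      obtain ⟨w, h4, h5⟩ := (hcJ.and h3).exists
      have h6 := (cmono h4 h5).2 (lt_mul_of_one_lt_right' w hk)
      have h7 := (hJ _ h4).2.1
      rw [κ.left_inv] at h7
      have h8 : ∀ᶠ s in w • η, w * k ≤ s := by
        change ∀ᶠ s in Filter.map _ _, _
        rw [Filter.eventually_map]
        refine h2.mono fun s hs => ?_
        change w * k ≤ w * s
        gcongr
        exact not_lt.1 hs
      rw [← h7, Filter.eventually_map, eventually_rgt] at h8
      obtain ⟨z, hz, h8⟩ := h8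
      obtain ⟨s, hs, hs'⟩ := exists_between (lt_min hz h6)
      have h9 := h8 s hs (hs'.trans_le (min_le_left _ _))
      have hsJ := (near_ordConnected o m).out h4 h5 ⟨hs.le, (hs'.trans_le (min_le_right _ _)).le⟩
      have h10 := hmono hsJ h5 (hs'.trans_le (min_le_right _ _))
      rw [κ.left_inv] at h10
      exact h10.not_ge h9
  have hη1' : ∀ k, k < 1 → ∀ᶠ g in η', k < g := by
    intro k hk
    rw [hηη']
    change ∀ᶠ s in Filter.map _ _, _
    rw [Filter.eventually_map]
    exact (hη1 k⁻¹ (one_lt_inv'.2 hk)).mono fun g hg => lt_inv'.1 hg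
  have hβ : ∀ d g, κ.c d ∈ Near o m → d ≤ g → κ.c g ∈ Near o m := by
    intro d g hd' hdg
    obtain ⟨t₁, h2, h3⟩ := (((by rw [he] at hgt; exact hgt g) : ∀ᶠ t in endAt (false, o),
      g < κ.τ t).and (endAt_false_gt hmo)).exists
    have hP : DFn S (fun t : M => (m < t ∧ ∀ b ∈ o, t < b) ∧ κ.τ t ≤ g) := by
      refine DFn.and (DFn.and (by fun_prop) ?_) ?_
      · cases o with
        | none => exact DFn.congr (P := fun _ => True) (by fun_prop) (by simp)
        | some b => exact DFn.congr (P := fun t => t < b) (by fun_prop) (by simp)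
      · exact DFn.congr (P := fun t => ¬ g < κ.τ t)
          (hL.comp (f := fun t : M => (g, κ.τ t)) (by fun_prop)).not fun t => not_lt.symm
    obtain ⟨t₀, ht₀⟩ := OMin.exists_isLUB hP (a := κ.c d) (b := t₁)
      ⟨hd', by rwa [κ.left_inv]⟩ (fun t ht => by
        by_contra! hlt'
        exact (h2.trans (hmono h3 ht.1 hlt')).not_ge ht.2)
    have hdt : κ.c d ≤ t₀ := ht₀.1 ⟨hd', by rwa [κ.left_inv]⟩
    have ht1 : t₀ ≤ t₁ := ht₀.2 fun t ht => by
      by_contra! hlt'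
      exact (h2.trans (hmono h3 ht.1 hlt')).not_ge ht.2
    have hJ₀ := (near_ordConnected o m).out hd' h3 ⟨hdt, ht1⟩
    obtain ⟨h4, h5, h6⟩ := hJ t₀ hJ₀
    rcases lt_trichotomy (κ.τ t₀) g with h7 | h7 | h7
    · exfalso
      have h8 : ∀ᶠ s in κ.τ t₀ • η, s < g := by
        change ∀ᶠ s in Filter.map _ _, _
        rw [Filter.eventually_map]
        exact (hη1 ((κ.τ t₀)⁻¹ * g) (lt_inv_mul_iff_lt.2 ‹_›)).mono fun s hs =>
          lt_inv_mul_iff_mul_lt.1 hs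
      rw [← h5, Filter.eventually_map, eventually_rgt] at h8
      obtain ⟨z, hz, h8⟩ := h8
      have ht1' : t₀ < t₁ := (hmono.lt_iff_lt hJ₀ h3).1 (h7.trans h2)
      obtain ⟨s, hs, hs'⟩ := exists_between (lt_min hz ht1')
      have : s ≤ t₀ := ht₀.1 ⟨(near_ordConnected o m).out hJ₀ h3
        ⟨hs.le, (hs'.trans_le (min_le_right _ _)).le⟩, (h8 s hs (hs'.trans_le (min_le_left _ _))).le⟩
      exact this.not_gt hs
    · rwa [← h7, h4]
    · exfalso
      have h8 : ∀ᶠ s in κ.τ t₀ • η', g < s := by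
        change ∀ᶠ s in Filter.map _ _, _
        rw [Filter.eventually_map]
        exact (hη1' ((κ.τ t₀)⁻¹ * g) (inv_mul_lt_iff_lt_mul.2 (by simpa using h7))).mono fun s hs =>
          inv_mul_lt_iff_lt_mul.1 hs
      rw [← h6, Filter.eventually_map, eventually_lft] at h8
      obtain ⟨z, hz, h8⟩ := h8
      obtain ⟨s, hs, hs'⟩ := ht₀.exists_between hz
      rcases hs'.2.lt_or_eq with h9 | h9
      · exact (h8 s hs'.1 h9).not_ge hs.2
      · exact h7.not_ge (h9 ▸ hs.2)
  have hdense : DenselyOrdered Γ := ⟨fun x y hxy => by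
    obtain ⟨g, h2, h3⟩ := (h1.and (hη1 (x⁻¹ * y) (lt_inv_mul_iff_lt.2 ‹_›))).exists
    exact ⟨x * g, lt_mul_of_one_lt_right' x h2, lt_inv_mul_iff_mul_lt.1 h3⟩⟩
  have hmax : NoMaxOrder Γ := ⟨fun x => by
    obtain ⟨g, h2⟩ := h1.exists
    exact ⟨x * g, lt_mul_of_one_lt_right' x h2⟩⟩
  have hmin : NoMinOrder Γ := ⟨fun x => by
    obtain ⟨g, h2⟩ := h1'.exists
    exact ⟨x * g, mul_lt_of_lt_one_right' x h2⟩⟩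
  refine ⟨hdense, hmin, hmax, { lt_def := hL, omin := fun {P} hP => ?_ }⟩
  obtain ⟨d, hd'⟩ := hcJ.exists
  have key : ∀ {P : Γ → Prop}, DFn S P → ∃ F : Finset Γ, ∀ x y, 1 ≤ x → x < y →
      (∀ f ∈ F, f < x ∨ y < f) → (P x ↔ P y) := by
    intro P hP
    obtain ⟨F, hF⟩ := OMin.omin (S := S) (P := fun t : M => P (κ.τ t * d⁻¹))
      (hP.comp (f := fun t : M => κ.τ t * d⁻¹) (by fun_prop))
    refine ⟨F.image fun t => κ.τ t * d⁻¹, fun x y hx hxy hxF => ?_⟩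
    have hxJ := hβ d (x * d) hd' (le_mul_of_one_le_left' hx)
    have hyJ := hβ d (y * d) hd' (le_mul_of_one_le_left' (hx.trans hxy.le))
    have := hF (κ.c (x * d)) (κ.c (y * d)) ((cmono hxJ hyJ).2 (by gcongr)) fun f hf => by
      by_contra! hc
      have hfJ := (near_ordConnected o m).out hxJ hyJ hc
      have h2 := hmono.monotoneOn hxJ hfJ hc.1
      have h3 := hmono.monotoneOn hfJ hyJ hc.2
      rw [κ.left_inv] at h2 h3
      rcases hxF _ (Finset.mem_image_of_mem _ hf) with h4 | h4
      · exact h4.not_ge (le_mul_inv_iff_mul_le.2 h2)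
      · exact h4.not_ge (mul_inv_le_iff_le_mul.2 h3)
    simpa using this
  obtain ⟨F, hF⟩ := key hP
  obtain ⟨G, hG⟩ := key (P := fun x => P x⁻¹) (hP.comp (f := fun x : Γ => x⁻¹) (by fun_prop))
  refine ⟨F ∪ G.image (·⁻¹) ∪ {1}, fun x y hxy hxyF => ?_⟩
  rcases hxyF 1 (by simp) with h2 | h2
  · exact hF x y h2.le hxy fun f hf => hxyF f (by simp [hf])
  · have := hG y⁻¹ x⁻¹ (one_le_inv'.2 h2.le) (inv_lt_inv_iff.2 hxy) fun f hf => by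
      rcases hxyF f⁻¹ (by simp [hf]) with h3 | h3
      · exact Or.inr (by simpa using inv_lt_inv_iff.2 h3)
      · exact Or.inl (by simpa using inv_lt_inv_iff.2 h3)
    simpa using this.symm

/-- The coordinate with values in the reversed line. -/
def dual (κ : Coord S Γ M) : Coord S Γ Mᵒᵈ where
  c x := OrderDual.toDual (κ.c x)
  τ t := κ.τ (OrderDual.ofDual t)
  hc := by fun_prop
  hτ := by fun_prop
  left_inv x := by simp

end Coord

end OrderedGroupOMin

section

variable {N : Type u} [LinearOrder N] [Nonempty N] {S : Struc N}
variable {M : Type v} [LinearOrder M] [DenselyOrdered M] [NoMinOrder M] [NoMaxOrder M]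
  [Nonempty M] [DSpace S M] [OMin S M] {Γ : Type w} [Group Γ] [DSpace S Γ] [DGrp S Γ]

/-- A one-dimensional definably connected group without involutions carries a bi-invariant
definable order which is o-minimal. -/
theorem Coord.exists_ordered_group [Infinite Γ] (κ : Coord S Γ M)
    (htf : ∀ x : Γ, x ≠ 1 → x * x ≠ 1)
    (hconn : ∀ H : Subgroup Γ, DFn S (fun x => x ∈ H) → H.FiniteIndex → H = ⊤) :
    ∃ _ : LinearOrder Γ, MulLeftStrictMono Γ ∧ MulRightStrictMono Γ ∧ DenselyOrdered Γ ∧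
      NoMinOrder Γ ∧ NoMaxOrder Γ ∧ OMin S Γ := by
  obtain ⟨Λ, hΛ⟩ := κ.exists_base
  obtain ⟨e, ⟨ε, hε, hm, he⟩, hinv⟩ := hΛ.exists_invariant_end htf hconn
  obtain ⟨⟨b, o⟩, rfl⟩ := isEnd_iff.1 hε
  cases b with
  | false =>
    obtain ⟨L, hlt, hl, hr⟩ := κ.exists_order hm he fun g => (hinv g).1
    exact ⟨L, hl, hr, hΛ.omin hm he hinv hlt⟩
  | true =>
    obtain ⟨Λ', hΛ'⟩ := Coord.exists_base (M := Mᵒᵈ) κ.dual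
    have e1 : (endAt (true, o) : Filter M) = endAt (M := Mᵒᵈ) (false, o) := by
      cases o with
      | none => rfl
      | some t =>
        ext s
        exact exists_congr fun y => and_congr Iff.rfl (forall_congr' fun t => Iff.intro
          (fun h h1 h2 => h h2 h1) (fun h h1 h2 => h h2 h1))
    rw [e1] at he hm
    obtain ⟨L, hlt, hl, hr⟩ := Coord.exists_order (M := Mᵒᵈ) (κ := κ.dual) (o := o) (e := e) hm he
      fun g => (hinv g).1
    exact ⟨L, hl, hr, Coord.Base.omin (M := Mᵒᵈ) hΛ' (o := o) (e := e) hm he hinv hlt⟩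

end

section Elements

variable {N : Type u} [LinearOrder N] {S : Struc N}

theorem Struc.df_iff_dfn {ι : Type} [Finite ι] {P : (ι → N) → Prop} : S.Df P ↔ DFn S P :=
  DSpace.plot_iff (X := Prop)

theorem Struc.def_iff_dfn {m : ℕ} {s : Set (Fin m → N)} :
    S.Def m s ↔ DFn S (fun x : Fin m → N => x ∈ s) := by
  rw [← Struc.df_iff_dfn]
  refine ⟨fun h => ⟨m, Equiv.refl _, h⟩, ?_⟩
  rintro ⟨n, e, h⟩
  obtain rfl : m = n := by simpa using Fintype.card_congr e
  have := S.def_reindex e.symm h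
  convert this using 1
  ext x
  simp [Function.comp_assoc]

theorem Struc.defFunOn_iff_dfn {m n : ℕ} {A : Set (Fin m → N)} {f : (Fin m → N) → Fin n → N} :
    S.DefFunOn A f ↔ DFn S (fun p : (Fin m → N) × (Fin n → N) => p.1 ∈ A ∧ f p.1 = p.2) := by
  rw [Struc.DefFunOn, Struc.def_iff_dfn]
  constructor
  · intro h
    refine (h.comp (f := fun p : (Fin m → N) × (Fin n → N) => Fin.append p.1 p.2)
      (DFn.pi fun i => ?_)).congr fun p => ?_
    · refine Fin.addCases (fun i => ?_) (fun i => ?_) i <;> simp <;> fun_prop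
    · simp [Function.comp_def]
  · intro h
    exact h.comp (f := fun z : Fin (m + n) → N => (z ∘ Fin.castAdd n, z ∘ Fin.natAdd m))
      (by simp only [Function.comp_def]; fun_prop)

theorem Struc.defFun2_iff_dfn {m n k : ℕ} {A : Set (Fin m → N)} {B : Set (Fin n → N)}
    {f : (Fin m → N) → (Fin n → N) → Fin k → N} :
    S.DefFun2 A B f ↔ DFn S (fun p : ((Fin m → N) × (Fin n → N)) × (Fin k → N) =>
      p.1.1 ∈ A ∧ p.1.2 ∈ B ∧ f p.1.1 p.1.2 = p.2) := by
  rw [Struc.DefFun2, Struc.def_iff_dfn]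
  constructor
  · intro h
    refine (h.comp (f := fun p : ((Fin m → N) × (Fin n → N)) × (Fin k → N) =>
      Fin.append (Fin.append p.1.1 p.1.2) p.2) (DFn.pi fun i => ?_)).congr fun p => ?_
    · refine Fin.addCases (fun i => ?_) (fun i => ?_) i
      · refine Fin.addCases (fun i => ?_) (fun i => ?_) i <;> simp <;> fun_prop
      · simp; fun_prop
    · simp [Function.comp_def]
  · intro h
    exact h.comp (f := fun z : Fin (m + n + k) → N =>
      ((z ∘ Fin.castAdd k ∘ Fin.castAdd n, z ∘ Fin.castAdd k ∘ Fin.natAdd m),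
        z ∘ Fin.natAdd (m + n))) (by simp only [Function.comp_def]; fun_prop)

namespace DefGroup

variable [TopologicalSpace N] {m n : ℕ} {G : DefGroup S m} {H : DefGroup S n}

instance : DSpace S G.Elt := DSpace.instSubtype (p := fun x => x ∈ G.carrier)

variable {X : Type*} [DSpace S X]

@[fun_prop]
theorem dfn_val {f : X → G.Elt} (hf : DFn S f) : DFn S (fun x => (f x).1) :=
  ⟨fun c h => hf.plot c h⟩

theorem dfn_carrier : DFn S (fun x : Fin m → N => x ∈ G.carrier) :=
  Struc.def_iff_dfn.1 G.carrier_def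

variable [Nonempty N]

instance : DSet S G.Elt := DSet.subtype (p := fun x => x ∈ G.carrier) dfn_carrier (1 : G.Elt)

instance : DGrp S G.Elt where
  mul_def := by
    have h := Struc.defFun2_iff_dfn.1 G.mul_graph_def
    refine DFn.of_graph ((h.comp (f := fun p : (G.Elt × G.Elt) × G.Elt =>
      ((p.1.1.1, p.1.2.1), p.2.1)) (by fun_prop)).congr fun p => ?_)
    exact ⟨fun h => ⟨p.1.1.2, p.1.2.2, congrArg Subtype.val h⟩, fun h => Subtype.ext h.2.2⟩
  inv_def := by
    have h := Struc.defFunOn_iff_dfn.1 G.inv_graph_def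
    refine DFn.of_graph ((h.comp (f := fun p : G.Elt × G.Elt => (p.1.1, p.2.1))
      (by fun_prop)).congr fun p => ?_)
    exact ⟨fun h => ⟨p.1.2, congrArg Subtype.val h⟩, fun h => Subtype.ext h.2⟩

theorem dfn_elt_iff {s : Set (Fin m → N)} (hs : s ⊆ G.carrier) :
    S.Def m s ↔ DFn S (fun x : G.Elt => x.1 ∈ s) := by
  rw [Struc.def_iff_dfn]
  refine ⟨fun h => h.comp (f := fun x : G.Elt => x.1) (by fun_prop), fun h => ?_⟩
  refine (DFn.ex (P := fun (x : Fin m → N) (y : G.Elt) => y.1 = x ∧ y.1 ∈ s) ?_).congr fun x => ?_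
  · exact DFn.and (by fun_prop) (h.comp (f := fun p : (Fin m → N) × G.Elt => p.2) (by fun_prop))
  · exact ⟨fun h => ⟨⟨x, hs h⟩, rfl, h⟩, fun ⟨y, e, h⟩ => e ▸ h⟩

/-- Definable subgroups as subgroups of the group of elements. -/
def IsDefSubgroup.subgroup {K : Set (Fin m → N)} (hK : G.IsDefSubgroup K) : Subgroup G.Elt where
  carrier := {x | x.1 ∈ K}
  one_mem' := hK.2.2.1
  mul_mem' {a b} ha hb := hK.2.2.2.1 a.1 ha b.1 hb
  inv_mem' {a} ha := hK.2.2.2.2 a.1 ha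

theorem IsDefSubgroup.mem_subgroup {K : Set (Fin m → N)} (hK : G.IsDefSubgroup K) {x : G.Elt} :
    x ∈ hK.subgroup ↔ x.1 ∈ K := Iff.rfl

theorem IsDefSubgroup.dfn {K : Set (Fin m → N)} (hK : G.IsDefSubgroup K) :
    DFn S (fun x => x ∈ hK.subgroup) := (dfn_elt_iff hK.1).1 hK.2.1

theorem isDefSubgroup_image {K : Subgroup G.Elt} (hK : DFn S (fun x => x ∈ K)) :
    G.IsDefSubgroup (Subtype.val '' (K : Set G.Elt)) := by
  refine ⟨?_, ?_, ⟨(1 : G.Elt), K.one_mem, rfl⟩, ?_, ?_⟩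
  · rintro _ ⟨x, -, rfl⟩
    exact x.2
  · refine (dfn_elt_iff (G := G) ?_).2 (hK.congr fun x => ?_)
    · rintro _ ⟨x, -, rfl⟩
      exact x.2
    · constructor
      · rintro ⟨y, hy, e⟩
        rwa [← Subtype.ext e]
      · intro h
        exact ⟨x, h, rfl⟩
  · rintro _ ⟨(x : G.Elt), hx, rfl⟩ _ ⟨(y : G.Elt), hy, rfl⟩
    exact ⟨(x * y : G.Elt), K.mul_mem hx hy, rfl⟩
  · rintro _ ⟨(x : G.Elt), hx, rfl⟩
    exact ⟨(x⁻¹ : G.Elt), K.inv_mem hx, rfl⟩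

theorem DefinablyConnected.eq_top (hG : G.DefinablyConnected) (K : Subgroup G.Elt)
    (hK : DFn S (fun x => x ∈ K)) (hi : K.FiniteIndex) : K = ⊤ := by
  classical
  have h := hG _ (isDefSubgroup_image hK) ?_
  · refine eq_top_iff.2 fun x _ => ?_
    obtain ⟨y, hy, e⟩ := h.ge x.2
    rwa [← Subtype.ext e]
  · have := Fintype.ofFinite (G.Elt ⧸ K)
    refine ⟨Finset.univ.image fun q : G.Elt ⧸ K => q.out.1, ?_, ?_⟩
    · intro x hx
      simp only [Finset.coe_image, Finset.coe_univ, Set.image_univ, Set.mem_range] at hx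
      obtain ⟨q, rfl⟩ := hx
      exact q.out.2
    · intro x hx
      let x' : G.Elt := ⟨x, hx⟩
      set q : G.Elt ⧸ K := QuotientGroup.mk x' with hq
      refine Set.mem_iUnion₂.2 ⟨q.out.1, Finset.mem_image_of_mem _ (Finset.mem_univ q), ?_⟩
      have h1 : q.out⁻¹ * x' ∈ K := by
        rw [← QuotientGroup.eq, QuotientGroup.out_eq']
      refine ⟨_, ⟨_, h1, rfl⟩, ?_⟩
      exact congrArg Subtype.val (mul_inv_cancel_left q.out x').symm

end DefGroup

end Elements

section

variable {N : Type u} [LinearOrder N] {S : Struc N}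

theorem DFn.finite_ex {X : Type*} [DSpace S X] {α : Type*} [Finite α] {P : α → X → Prop}
    (h : ∀ a, DFn S (P a)) : DFn S (fun x => ∃ a, P a x) :=
  (DFn.finite_all (P := fun a x => ¬ P a x) fun a => (h a).not).not.congr fun x => by simp

theorem odim_mem_of_pos [TopologicalSpace N] {m : ℕ} {A : Set (Fin m → N)} (h : odim A = 1) :
    (∃ p : Fin 1 → Fin m, Function.Injective p ∧
      (interior ((fun x : Fin m → N => x ∘ p) '' A)).Nonempty) ∧
    ¬ ∃ p : Fin 2 → Fin m, Function.Injective p ∧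
      (interior ((fun x : Fin m → N => x ∘ p) '' A)).Nonempty := by
  set K : Set ℕ := {k | ∃ p : Fin k → Fin m, Function.Injective p ∧
    (interior ((fun x : Fin m → N => x ∘ p) '' A)).Nonempty} with hK
  change sSup K = 1 at h
  have hb : BddAbove K := ⟨m, fun k ⟨p, hp, _⟩ => by simpa using Fintype.card_le_of_injective p hp⟩
  have hn : K.Nonempty := by
    by_contra hn
    rw [Set.not_nonempty_iff_eq_empty.1 hn] at h
    simp at h
  refine ⟨?_, fun h2 => ?_⟩
  · have := Nat.sSup_mem hn hb
    rwa [h] at this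
  · have : 2 ≤ sSup K := le_csSup hb h2
    omega

variable [DenselyOrdered N] [NoMinOrder N] [NoMaxOrder N] [Nonempty N] [TopologicalSpace N]
  [OrderTopology N]

theorem infinite_of_interior_nonempty {m : ℕ} {A : Set (Fin m → N)} {p : Fin 1 → Fin m}
    (h : (interior ((fun x : Fin m → N => x ∘ p) '' A)).Nonempty) : A.Infinite := by
  intro hA
  obtain ⟨x, hx⟩ := h
  have hc : Continuous (fun (t : N) (_ : Fin 1) => t) := continuous_pi fun _ => continuous_id
  have ho := IsOpen.preimage (t := interior ((fun x : Fin m → N => x ∘ p) '' A)) hc isOpen_interior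
  have hx0 : x 0 ∈ (fun (t : N) (_ : Fin 1) => t) ⁻¹'
      interior ((fun x : Fin m → N => x ∘ p) '' A) := by
    have : (fun _ : Fin 1 => x 0) = x := by
      funext i
      rw [Subsingleton.elim i 0]
    rwa [Set.mem_preimage, this]
  obtain ⟨a, b, hab, hsub⟩ := mem_nhds_iff_exists_Ioo_subset.1 (ho.mem_nhds hx0)
  refine Set.Ioo_infinite (hab.1.trans hab.2) (Set.Finite.subset
    ((hA.image (fun x : Fin m → N => x ∘ p)).preimage (f := fun (t : N) (_ : Fin 1) => t) ?_)
    fun t ht => interior_subset (s := (fun x : Fin m → N => x ∘ p) '' A) (hsub ht))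
  intro s _ t _ hst
  exact congrFun hst 0

theorem exists_box_of_odim {m : ℕ} {A : Set (Fin m → N)} (h : odim A = 1) {i k : Fin m}
    (hik : i ≠ k) {a b c d : N} (hab : a < b) (hcd : c < d) :
    ∃ x y, a < x ∧ x < b ∧ c < y ∧ y < d ∧ ∀ g ∈ A, g i = x → g k ≠ y := by
  by_contra! hno
  refine (odim_mem_of_pos h).2 ⟨![i, k], ?_, ?_⟩
  · intro s t hst
    fin_cases s <;> fin_cases t <;> simp_all
  · obtain ⟨x, hx⟩ := exists_between hab
    obtain ⟨y, hy⟩ := exists_between hcd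
    have ho : IsOpen {z : Fin 2 → N | z 0 ∈ Ioo a b ∧ z 1 ∈ Ioo c d} :=
      (isOpen_Ioo.preimage (continuous_apply 0)).inter (isOpen_Ioo.preimage (continuous_apply 1))
    refine ⟨![x, y], interior_maximal ?_ ho ⟨hx, hy⟩⟩
    rintro z ⟨hz0, hz1⟩
    obtain ⟨g, hg, h1, h2⟩ := hno (z 0) (z 1) hz0.1 hz0.2 hz1.1 hz1.2
    refine ⟨g, hg, ?_⟩
    funext t
    fin_cases t <;> simp [h1, h2]

namespace DefGroup

variable {m : ℕ} {G : DefGroup S m}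

theorem exists_coord (h : odim G.carrier = 1) :
    ∃ (M : Type u) (_ : LinearOrder M) (_ : DenselyOrdered M) (_ : NoMinOrder M)
      (_ : NoMaxOrder M) (_ : Nonempty M) (_ : DSpace S M) (_ : OMin S M),
      Nonempty (Coord S G.Elt M) := by
  classical
  obtain ⟨p, -⟩ := (odim_mem_of_pos h).1
  have : NeZero m := ⟨fun h0 => (Fin.cast h0 (p 0)).elim0⟩
  obtain ⟨n, X, c, hX, hXC, huniq, hinj⟩ := exists_charts (C := fun x => x ∈ G.carrier)
    (dfn_carrier (S := S)) fun i k hik a b c d hab hcd => exists_box_of_odim h hik hab hcd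
  obtain ⟨M, i1, i2, i3, i4, i5, i6, i7, f, hf, hfinj⟩ := OMin.exists_copies S n
  refine ⟨M, i1, i2, i3, i4, i5, i6, i7, ?_⟩
  choose j hj using fun g : G.Elt => (huniq g.1 g.2).exists
  set cm : G.Elt → M := fun g => f (j g) (g.1 (c (j g))) with hcm
  have hcd : DFn S cm := by
    refine DFn.of_graph_rel (R := fun (g : G.Elt) y => ∃ k, X k g.1 ∧ f k (g.1 (c k)) = y)
      (DFn.finite_ex fun k => ?_) fun g y => ⟨fun e => ⟨j g, hj g, e⟩, ?_⟩
    · exact ((hX k).comp (f := fun q : G.Elt × M => q.1.1) (by fun_prop)).and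
        (((hf k).comp (f := fun q : G.Elt × M => q.1.1 (c k))
          ((DFn.apply (c k)).comp (g := fun x : Fin m → N => x (c k)) (by fun_prop))).eq (by fun_prop))
    · rintro ⟨k, hk, e⟩
      have := (huniq g.1 g.2).unique hk (hj g)
      rw [hcm, ← e, this]
  have hci : Function.Injective cm := by
    intro g g' e
    obtain ⟨e1, e2⟩ := hfinj _ _ _ _ e
    refine Subtype.ext (hinj (j g) _ _ (hj g) ?_ ?_)
    · rw [e1]
      exact hj g'
    · rw [e2, e1]
  let τ : M → G.Elt := fun y => if hy : ∃ g, cm g = y then hy.choose else 1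
  have hτ : ∀ g, τ (cm g) = g := fun g => by
    have hy : ∃ g', cm g' = cm g := ⟨g, rfl⟩
    simp only [τ, dif_pos hy]
    exact hci hy.choose_spec
  have hτd : DFn S τ := by
    refine DFn.of_graph_rel (R := fun y (g : G.Elt) => cm g = y ∨ (g = 1 ∧ ¬ ∃ h, cm h = y))
      (by fun_prop) fun y g => ?_
    by_cases hy : ∃ g, cm g = y
    · obtain ⟨g', rfl⟩ := hy
      rw [hτ]
      exact ⟨fun e => .inl (by rw [e]), fun e => e.elim (fun e => (hci e).symm)
        fun e => absurd ⟨g', rfl⟩ e.2⟩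
    · simp only [τ, dif_neg hy]
      exact ⟨fun e => .inr ⟨e.symm, hy⟩, fun e => e.elim (fun e => absurd ⟨g, e⟩ hy)
        fun e => e.1.symm⟩
  exact ⟨⟨cm, τ, hcd, hτd, hτ⟩⟩

theorem exists_ordered_group (h : odim G.carrier = 1) (hconn : G.DefinablyConnected)
    (htf : G.TorsionFree) :
    ∃ _ : LinearOrder G.Elt, MulLeftStrictMono G.Elt ∧ MulRightStrictMono G.Elt ∧
      DenselyOrdered G.Elt ∧ NoMinOrder G.Elt ∧ NoMaxOrder G.Elt ∧ OMin S G.Elt := by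
  obtain ⟨M, i1, i2, i3, i4, i5, i6, i7, ⟨κ⟩⟩ := exists_coord h
  obtain ⟨p, -, hp⟩ := (odim_mem_of_pos h).1
  have : Infinite G.Elt := (infinite_of_interior_nonempty hp).to_subtype
  refine κ.exists_ordered_group (fun x hx => ?_) hconn.eq_top
  have := htf x hx 2 two_pos
  rwa [pow_two] at this

end DefGroup

end

section OrderedGroups

variable {N : Type u} [LinearOrder N] [Nonempty N] {S : Struc N}
variable {Γ : Type v} [Group Γ] [LinearOrder Γ] [MulLeftStrictMono Γ] [MulRightStrictMono Γ]
  [DenselyOrdered Γ] [NoMinOrder Γ] [NoMaxOrder Γ] [DSpace S Γ] [OMin S Γ] [DGrp S Γ]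
variable {C : Type w} [CommGroup C] [LinearOrder C] [IsOrderedMonoid C]
  [DenselyOrdered C] [NoMinOrder C] [NoMaxOrder C] [DSpace S C] [OMin S C] [DGrp S C]

/-- One-dimensional ordered definable groups have no proper nontrivial definable subgroups. -/
theorem Subgroup.eq_bot_or_eq_top_of_dfn (H : Subgroup Γ) (hH : DFn S (fun x => x ∈ H)) :
    H = ⊥ ∨ H = ⊤ := by
  have := mulLeftMono_of_mulLeftStrictMono Γ
  rcases (DUF.top (S := S) (X := Γ)).ultra hH with h | h
  · obtain ⟨a, ha⟩ := eventually_atTop.1 h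
    refine .inr (eq_top_iff.2 fun x _ => ?_)
    have h1 := ha (max a (x * a)) (le_max_left _ _)
    have h2 := ha (x⁻¹ * max a (x * a)) (by
      rw [le_inv_mul_iff_mul_le]
      exact le_max_right _ _)
    have h3 := H.mul_mem h1 (H.inv_mem h2)
    rwa [mul_inv_rev, inv_inv, mul_inv_cancel_left] at h3
  · obtain ⟨a, ha⟩ := eventually_atTop.1 h
    obtain ⟨y, hy⟩ := OMin.exists_isLUB hH H.one_mem (b := a) fun x hx =>
      le_of_not_ge fun hax => ha x hax hx
    have key : ∀ x ∈ H, 1 ≤ x := fun x hx => by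
      have : y ≤ x * y := hy.2 fun z (hz : z ∈ H) => by
        have := hy.1 (show x⁻¹ * z ∈ H from H.mul_mem (H.inv_mem hx) hz)
        rwa [inv_mul_le_iff_le_mul] at this
      by_contra! hlt
      exact (mul_lt_of_lt_one_left' y hlt).not_ge this
    refine .inl (eq_bot_iff.2 fun x hx => ?_)
    have h1 := key x hx
    have h2 := key x⁻¹ (H.inv_mem hx)
    rw [Left.one_le_inv_iff] at h2
    exact le_antisymm h2 h1

/-- A definable function from `Γ` to `C` that escapes to `+∞` yields a definable bijection. -/
theorem DFn.exists_bijective_of_top {f : Γ → C} (hf : DFn S f)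
    (htop : ∀ b, ∀ᶠ t in atTop, b < f t) : ∃ F : Γ → C, DFn S F ∧ Function.Bijective F := by
  classical
  have := mulLeftMono_of_mulLeftStrictMono Γ
  obtain ⟨a, hm⟩ := hf.mono3_top
  have hmono : StrictMonoOn f (Ioi a) := by
    obtain ⟨x, hx⟩ := exists_gt a
    obtain ⟨y, hy⟩ := eventually_atTop.1 (htop (f x))
    have hya : a < max x y := hx.trans_le (le_max_left _ _)
    have hxy := hy _ (le_max_right x y)
    rcases hm with h | h | h
    · exact absurd (h x hx _ hya) hxy.ne
    · exact h
    · have hne : x < max x y := lt_of_le_of_ne (le_max_left _ _) fun e => by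
        rw [← e] at hxy
        exact hxy.false
      exact absurd (h hx hya hne) hxy.not_gt
  have hI : ∀ᶠ c in atTop, ∃ x, a < x ∧ f x = c := by
    rcases (DUF.top (S := S) (X := C)).ultra (P := fun c => ∃ x, a < x ∧ f x = c)
      (by fun_prop) with h | h
    · exact h
    · obtain ⟨c, hc⟩ := eventually_atTop.1 h
      obtain ⟨x, h1, h2⟩ := ((htop c).and (eventually_gt_atTop a)).exists
      exact absurd ⟨x, h2, rfl⟩ (hc _ h1.le)
  obtain ⟨c, hc⟩ := eventually_atTop.1 hI
  obtain ⟨b, hb1, hb2⟩ := ((htop c).and (eventually_gt_atTop a)).exists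
  set h : Γ → C := fun x => (f b)⁻¹ * f (b * x) with hh
  have hlt : ∀ {x y}, 1 ≤ x → x < y → h x < h y := fun {x y} hx hxy => by
    have h1 : b ≤ b * x := le_mul_of_one_le_right' hx
    have h2 : b * x < b * y := mul_lt_mul_right hxy b
    exact mul_lt_mul_right (hmono (hb2.trans_le h1) (hb2.trans_le (h1.trans h2.le)) h2) _
  have h1 : h 1 = 1 := by simp [hh]
  have hsurj : ∀ z, 1 ≤ z → ∃ x, 1 ≤ x ∧ h x = z := fun z hz => by
    have hbz : f b ≤ f b * z := le_mul_of_one_le_right' hz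
    obtain ⟨x, hx, hxz⟩ := hc (f b * z) (hb1.le.trans hbz)
    refine ⟨b⁻¹ * x, ?_, by simp [hh, hxz]⟩
    rw [le_inv_mul_iff_mul_le, mul_one]
    by_contra! hxb
    have := hmono hx hb2 hxb
    rw [hxz] at this
    exact this.not_ge hbz
  set F : Γ → C := fun x => if 1 ≤ x then h x else (h x⁻¹)⁻¹ with hF
  have hpos : ∀ x, 1 ≤ x → F x = h x := fun x hx => if_pos hx
  have hneg : ∀ x, x < 1 → F x = (h x⁻¹)⁻¹ := fun x hx => if_neg hx.not_ge
  have hmF : StrictMono F := by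
    intro x y hxy
    rcases le_or_gt 1 x with hx | hx
    · rw [hpos x hx, hpos y (hx.trans hxy.le)]
      exact hlt hx hxy
    · have hx' : 1 < x⁻¹ := one_lt_inv'.2 hx
      have h3 := hlt le_rfl hx'
      rcases le_or_gt 1 y with hy | hy
      · rw [hneg x hx, hpos y hy]
        have h4 : h 1 ≤ h y := by
          rcases hy.eq_or_lt with rfl | hy
          · rfl
          · exact (hlt le_rfl hy).le
        rw [h1] at h3 h4
        exact (inv_lt_one'.2 h3).trans_le h4
      · rw [hneg x hx, hneg y hy, inv_lt_inv_iff]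
        exact hlt (one_lt_inv'.2 hy).le (inv_lt_inv_iff.2 hxy)
  refine ⟨F, DFn.ite (by fun_prop) (by fun_prop) (by fun_prop), hmF.injective, fun z => ?_⟩
  rcases le_or_gt 1 z with hz | hz
  · obtain ⟨x, hx, rfl⟩ := hsurj z hz
    exact ⟨x, hpos x hx⟩
  · obtain ⟨x, hx, e⟩ := hsurj z⁻¹ (one_le_inv'.2 hz.le)
    have hx1 : 1 < x := lt_of_le_of_ne hx fun e' => by
      rw [← e', h1] at e
      exact hz.ne (inv_eq_one.1 e.symm)
    refine ⟨x⁻¹, ?_⟩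
    rw [hneg _ (inv_lt_one'.2 hx1), inv_inv, e, inv_inv]

/-- Definable functions between orthogonal one-dimensional groups have limits at infinity. -/
theorem DFn.exists_limAt_top (horth : ∀ f : Γ → C, DFn S f → ¬ Function.Bijective f)
    {f : Γ → C} (hf : DFn S f) : ∃ c, LimAt atTop f c := by
  rcases (DUF.top (S := S) (X := Γ)).lim_cases hf with h | h | h
  · exact h
  · obtain ⟨F, hF, hb⟩ := hf.exists_bijective_of_top h
    exact absurd hb (horth F hF)
  · obtain ⟨F, hF, hb⟩ := DFn.exists_bijective_of_top (S := S) (f := fun x => (f x)⁻¹) (by fun_prop)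
      (fun b => by
        filter_upwards [h b⁻¹] with t ht
        exact lt_inv'.1 ht)
    exact absurd hb (horth F hF)

/-- Definable homomorphisms between one-dimensional groups are trivial or bijective. -/
theorem MonoidHom.trivial_or_bijective_of_dfn (f : Γ →* C) (hf : DFn S f) :
    (∀ x, f x = 1) ∨ Function.Bijective f := by
  have h1 := f.ker.eq_bot_or_eq_top_of_dfn (S := S) (by
    simp only [MonoidHom.mem_ker]
    fun_prop)
  rcases h1 with h1 | h1
  · have h2 := f.range.eq_bot_or_eq_top_of_dfn (S := S) (by
      simp only [MonoidHom.mem_range]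
      fun_prop)
    rcases h2 with h2 | h2
    · left
      intro x
      have : f x ∈ f.range := ⟨x, rfl⟩
      rw [h2] at this
      exact this
    · right
      exact ⟨(MonoidHom.ker_eq_bot_iff f).1 h1, MonoidHom.range_eq_top.1 h2⟩
  · left
    intro x
    have : x ∈ f.ker := by
      rw [h1]
      trivial
    exact this

end OrderedGroups

section Choice

variable {N : Type u} [LinearOrder N] [Nonempty N] {S : Struc N}
variable {Γ : Type v} [Group Γ] [LinearOrder Γ] [MulLeftStrictMono Γ] [MulRightStrictMono Γ]
  [DenselyOrdered Γ] [NoMinOrder Γ] [NoMaxOrder Γ] [DSpace S Γ] [OMin S Γ] [DGrp S Γ]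
variable {X : Type w} [LinearOrder X] [DenselyOrdered X] [NoMinOrder X] [NoMaxOrder X]
  [DSpace S X] [OMin S X]

/-- Choice at infinity in a definable family of neighbourhoods of `c` on the right. -/
theorem DFn.exists_choice_top_rgt {R : Γ → X → Prop} (hR : DFn S (fun p : Γ × X => R p.1 p.2))
    (c : X) (h : ∀ᶠ g in atTop, ∀ᶠ y in rgt c, R g y) :
    ∃ η : Γ → X, DFn S η ∧ ∀ᶠ g in atTop, R g (η g) := by
  have := mulLeftMono_of_mulLeftStrictMono Γ
  have : Nonempty X := ⟨c⟩
  let Q : Γ → X → Prop := fun g y => c < y ∧ ∀ z, c < z → z ≤ y → R g z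
  have hQ : DFn S (fun p : Γ × X => Q p.1 p.2) := by
    have : DFn S (fun q : (Γ × X) × X => R q.1.1 q.2) :=
      hR.comp (f := fun q : (Γ × X) × X => (q.1.1, q.2)) (by fun_prop)
    fun_prop
  have hQ' : ∀ y, DFn S (fun g => Q g y) := fun y =>
    hQ.comp (f := fun g : Γ => (g, y)) (by fun_prop)
  have hQ'' : ∀ g, DFn S (fun y => Q g y) := fun g =>
    hQ.comp (f := fun y : X => (g, y)) (by fun_prop)
  have hne : ∀ᶠ g in atTop, ∃ y, Q g y := by
    filter_upwards [h] with g hg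
    obtain ⟨y, hy, h⟩ := eventually_rgt.1 hg
    obtain ⟨t, h1, h2⟩ := exists_between hy
    exact ⟨t, h1, fun z h3 h4 => h z h3 (h4.trans_lt h2)⟩
  by_cases hc : ∃ y, ∀ᶠ g in atTop, Q g y
  · obtain ⟨y, hy⟩ := hc
    refine ⟨fun _ => y, by fun_prop, ?_⟩
    filter_upwards [hy] with g hg
    exact hg.2 y hg.1 le_rfl
  push Not at hc
  have hev : ∀ y, ∀ᶠ g in atTop, ¬ Q g y := fun y =>
    ((DUF.top (S := S) (X := Γ)).not_eventually (hQ' y)).1 (Filter.not_eventually.2 (hc y))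
  have hle : ∀ {g y z}, ¬ Q g y → c < y → Q g z → z ≤ y := fun {g y z} h1 hy h2 => by
    by_contra! h3
    exact h1 ⟨hy, fun w h4 h5 => h2.2 w h4 (h5.trans h3.le)⟩
  obtain ⟨β, hβ, hβR⟩ := DFn.exists_partial_choice (S := S) (T := Γ) (Y := X)
    (R := fun g y => (∀ z, Q g z → z ≤ y) ∧ ∀ w, (∀ z, Q g z → z ≤ w) → y ≤ w) (by
      have h1 : DFn S (fun q : (Γ × X) × X => Q q.1.1 q.2) :=
        hQ.comp (f := fun q : (Γ × X) × X => (q.1.1, q.2)) (by fun_prop)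
      have h2 : DFn S (fun q : ((Γ × X) × X) × X => Q q.1.1.1 q.2) :=
        hQ.comp (f := fun q : ((Γ × X) × X) × X => (q.1.1.1, q.2)) (by fun_prop)
      fun_prop)
    (fun g y y' h1 h2 => le_antisymm (h1.2 _ h2.1) (h2.2 _ h1.1))
  have hβ1 : ∀ y > c, ∀ᶠ g in atTop, IsLUB {z | Q g z} (β g) ∧ β g ≤ y := fun y hy => by
    filter_upwards [hne, hev y] with g ⟨z, hz⟩ hg
    obtain ⟨b, hb⟩ := OMin.exists_isLUB (hQ'' g) hz fun x hx => hle hg hy hx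
    have := hβR g ⟨b, fun z hz => hb.1 hz, fun w hw => hb.2 hw⟩
    exact ⟨⟨this.1, fun w hw => this.2 w fun z hz => hw hz⟩,
      this.2 y fun z hz => hle hg hy hz⟩
  have hβc : ∀ᶠ g in atTop, IsLUB {z | Q g z} (β g) ∧ c < β g := by
    obtain ⟨y, hy⟩ := exists_gt c
    filter_upwards [hβ1 y hy, hne] with g hg ⟨z, hz⟩
    exact ⟨hg.1, hz.1.trans_le (hg.1.1 hz)⟩
  obtain ⟨a, hm⟩ := hβ.mono3_top
  obtain ⟨a', ha'⟩ := eventually_atTop.1 hβc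
  have hanti : StrictAntiOn β (Ioi a) := by
    obtain ⟨x, hx⟩ := exists_gt (max a a')
    obtain ⟨hxa, hxa'⟩ := max_lt_iff.1 hx
    obtain ⟨y, h1, h2⟩ := exists_between (ha' x hxa'.le).2
    obtain ⟨z, h3, h4⟩ := ((hβ1 y h1).and (eventually_gt_atTop x)).exists
    have h5 : β z < β x := h3.2.trans_lt h2
    rcases hm with h | h | h
    · exact absurd (h z (hxa.trans h4) x hxa) h5.ne
    · exact absurd (h hxa (hxa.trans h4) h4) h5.not_gt
    · exact h
  obtain ⟨k, hk⟩ := exists_gt (1 : Γ)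
  refine ⟨fun g => β (g * k), by fun_prop, ?_⟩
  filter_upwards [hβc, eventually_gt_atTop a, eventually_ge_atTop a'] with g hg hga hga'
  have hgk : g < g * k := lt_mul_of_one_lt_right' g hk
  have h1 := hanti hga (hga.trans hgk) hgk
  obtain ⟨z, hz, h2⟩ := (lt_isLUB_iff hg.1).1 h1
  exact hz.2 _ (ha' _ (hga'.trans hgk.le)).2 h2.le

theorem DFn.exists_choice_top_of_gt {R : Γ → X → Prop} (hR : DFn S (fun p : Γ × X => R p.1 p.2))
    (e : X) (h : ∀ᶠ g in atTop, ∃ y, e < y ∧ R g y) :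
    ∃ η : Γ → X, DFn S η ∧ ∀ᶠ g in atTop, R g (η g) := by
  have := mulLeftMono_of_mulLeftStrictMono Γ
  have : Nonempty X := ⟨e⟩
  have hR' : ∀ g, DFn S (fun y => R g y) := fun g =>
    hR.comp (f := fun y : X => (g, y)) (by fun_prop)
  obtain ⟨α, hα, hαR⟩ := DFn.exists_partial_choice (S := S) (T := Γ) (Y := X)
    (R := fun g y => (∀ z, e < z → R g z → y ≤ z) ∧ ∀ w, (∀ z, e < z → R g z → w ≤ z) → w ≤ y) (by
      have h1 : DFn S (fun q : (Γ × X) × X => R q.1.1 q.2) :=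
        hR.comp (f := fun q : (Γ × X) × X => (q.1.1, q.2)) (by fun_prop)
      have h2 : DFn S (fun q : ((Γ × X) × X) × X => R q.1.1.1 q.2) :=
        hR.comp (f := fun q : ((Γ × X) × X) × X => (q.1.1.1, q.2)) (by fun_prop)
      fun_prop)
    (fun g y y' h1 h2 => le_antisymm (h2.2 _ h1.1) (h1.2 _ h2.1))
  have hαg : ∀ᶠ g in atTop, IsGLB {z | e < z ∧ R g z} (α g) := by
    filter_upwards [h] with g ⟨y, hy⟩
    obtain ⟨b, hb⟩ := OMin.exists_isGLB (S := S) (P := fun z => e < z ∧ R g z)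
      (by have := hR' g; fun_prop) hy (b := e) fun x hx => hx.1.le
    have := hαR g ⟨b, fun z h1 h2 => hb.1 ⟨h1, h2⟩, fun w hw => hb.2 fun z hz => hw z hz.1 hz.2⟩
    exact ⟨fun z hz => this.1 z hz.1 hz.2, fun w hw => this.2 w fun z h1 h2 => hw ⟨h1, h2⟩⟩
  rcases (DUF.top (S := S) (X := Γ)).ultra (P := fun g => R g (α g))
    (hR.comp (f := fun g => (g, α g)) (by fun_prop)) with h1 | h1
  · exact ⟨α, hα, h1⟩
  have h2 : ∀ᶠ g in atTop, ∀ᶠ y in rgt (α g), R g y := by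
    filter_upwards [hαg, h1] with g hg h1
    rcases (DUF.rgt (S := S) (α g)).ultra (hR' g) with h2 | h2
    · exact h2
    · obtain ⟨y, hy, h2⟩ := eventually_rgt.1 h2
      obtain ⟨z, hz, h3⟩ := (isGLB_lt_iff hg).1 hy
      rcases (hg.1 hz).eq_or_lt with h4 | h4
      · exact absurd (h4 ▸ hz.2) h1
      · exact absurd hz.2 (h2 z h4 h3)
  obtain ⟨a, hm⟩ := hα.mono3_top
  have hcont : ∀ᶠ g in atTop, DFn.ContAt α g := by
    rcases (DUF.top (S := S) (X := Γ)).ultra (DFn.contAt_def hα) with h3 | h3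
    · exact h3
    · obtain ⟨b, hb⟩ := eventually_atTop.1 h3
      exact absurd ((DFn.finite_not_contAt hα).subset (fun x (hx : b ≤ x) => hb x hx))
        (Set.Ici_infinite b)
  have rgt_mul : ∀ (g : Γ) {P : Γ → Prop}, (∀ᶠ t in rgt g, P t) → ∀ᶠ k in rgt 1, P (g * k) := by
    intro g P hP
    obtain ⟨y, hy, hP⟩ := eventually_rgt.1 hP
    refine eventually_rgt.2 ⟨g⁻¹ * y, lt_inv_mul_iff_mul_lt.2 (by rwa [mul_one]), fun k h4 h5 =>
      hP _ (lt_mul_of_one_lt_right' g h4) (lt_inv_mul_iff_mul_lt.1 h5)⟩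
  have lft_mul : ∀ (g : Γ) {P : Γ → Prop}, (∀ᶠ t in lft g, P t) →
      ∀ᶠ k in rgt 1, P (g * k⁻¹) := by
    intro g P hP
    obtain ⟨y, hy, hP⟩ := eventually_lft.1 hP
    refine eventually_rgt.2 ⟨y⁻¹ * g, lt_inv_mul_iff_mul_lt.2 (by rwa [mul_one]), fun k h4 h5 =>
      hP _ ?_ ?_⟩
    · have := inv_lt_inv_iff.2 h5
      rw [mul_inv_rev, inv_inv] at this
      exact inv_mul_lt_iff_lt_mul.1 this
    · exact mul_lt_of_lt_one_right' g (inv_lt_one'.2 h4)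
  rcases hm with hm | hm | hm
  · obtain ⟨x, hx⟩ := exists_gt a
    refine DFn.exists_choice_top_rgt hR (α x) ?_
    filter_upwards [h2, eventually_gt_atTop a] with g hg hga
    rwa [hm x hx g hga]
  · obtain ⟨η, h3, h4⟩ := DFn.exists_choice_top_rgt (R := fun g k => R g (α (g * k)))
      (hR.comp (f := fun p : Γ × Γ => (p.1, α (p.1 * p.2))) (by fun_prop)) 1 (by
        filter_upwards [h2, hcont, eventually_gt_atTop a] with g hg hc hga
        obtain ⟨y, hy, hg⟩ := eventually_rgt.1 hg
        have h3 : ∀ᶠ t in rgt g, α t < y := hc.1.2 y hy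
        have h4 : ∀ᶠ t in rgt g, g < t := by
          obtain ⟨z, hz⟩ := exists_gt g
          exact eventually_rgt.2 ⟨z, hz, fun t h _ => h⟩
        exact rgt_mul g ((h3.and h4).mono fun t ht =>
          hg _ (hm hga (hga.trans ht.2) ht.2) ht.1))
    exact ⟨fun g => α (g * η g), by fun_prop, h4⟩
  · obtain ⟨η, h3, h4⟩ := DFn.exists_choice_top_rgt (R := fun g k => R g (α (g * k⁻¹)))
      (hR.comp (f := fun p : Γ × Γ => (p.1, α (p.1 * p.2⁻¹))) (by fun_prop)) 1 (by
        filter_upwards [h2, hcont, eventually_gt_atTop a] with g hg hc hga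
        obtain ⟨y, hy, hg⟩ := eventually_rgt.1 hg
        have h3 : ∀ᶠ t in lft g, α t < y := hc.2.2 y hy
        have h4 : ∀ᶠ t in lft g, a < t ∧ t < g := eventually_lft.2 ⟨a, hga, fun t h h' => ⟨h, h'⟩⟩
        exact lft_mul g ((h3.and h4).mono fun t ht =>
          hg _ (hm ht.2.1 hga ht.2.2) ht.1))
    exact ⟨fun g => α (g * (η g)⁻¹), by fun_prop, h4⟩

theorem DFn.exists_choice_top_one {R : Γ → X → Prop} (hR : DFn S (fun p : Γ × X => R p.1 p.2))
    (h : ∀ᶠ g in atTop, ∃ y, R g y) :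
    ∃ η : Γ → X, DFn S η ∧ ∀ᶠ g in atTop, R g (η g) := by
  have hU := DUF.top (S := S) (X := Γ)
  have := hU.neBot
  obtain ⟨g, e, he⟩ := h.exists
  have h' : ∀ᶠ g in atTop, R g e ∨ (∃ y, e < y ∧ R g y) ∨ ∃ y, y < e ∧ R g y := by
    filter_upwards [h] with g ⟨y, hy⟩
    rcases lt_trichotomy y e with h1 | rfl | h1
    exacts [.inr (.inr ⟨y, h1, hy⟩), .inl hy, .inr (.inl ⟨y, h1, hy⟩)]
  rcases hU.eventually_or (hR.comp (f := fun g => (g, e)) (by fun_prop)) h' with h1 | h1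
  · exact ⟨fun _ => e, by fun_prop, h1⟩
  rcases hU.eventually_or (by fun_prop) h1 with h1 | h1
  · exact DFn.exists_choice_top_of_gt hR e h1
  · exact DFn.exists_choice_top_of_gt (X := Xᵒᵈ) (R := R) hR (OrderDual.toDual e) h1

end Choice

section ChoiceTop

variable {N : Type u} [LinearOrder N] [DenselyOrdered N] [NoMinOrder N] [NoMaxOrder N]
  [Nonempty N] {S : Struc N}
variable {Γ : Type v} [Group Γ] [LinearOrder Γ] [MulLeftStrictMono Γ] [MulRightStrictMono Γ]
  [DenselyOrdered Γ] [NoMinOrder Γ] [NoMaxOrder Γ] [DSpace S Γ] [OMin S Γ] [DGrp S Γ]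

/-- Definable choice at infinity. -/
theorem DFn.exists_choice_top {Y : Type w} [DSpace S Y] [DSet S Y] {R : Γ → Y → Prop}
    (hR : DFn S (fun p : Γ × Y => R p.1 p.2)) (h : ∀ᶠ g in atTop, ∃ y, R g y) :
    ∃ η : Γ → Y, DFn S η ∧ ∀ᶠ g in atTop, R g (η g) := by
  have key : ∀ (ι : Type) [Finite ι] (R : Γ → (ι → N) → Prop),
      DFn S (fun p : Γ × (ι → N) => R p.1 p.2) → (∀ᶠ g in atTop, ∃ y, R g y) →
      ∃ η : Γ → (ι → N), DFn S η ∧ ∀ᶠ g in atTop, R g (η g) := by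
    intro ι _
    induction ι using Finite.induction_empty_option with
    | @of_equiv α β e ih =>
      intro R hR h
      obtain ⟨η, h1, h2⟩ := ih (fun g y => R g (y ∘ e.symm))
        (hR.comp (f := fun p : Γ × (α → N) => (p.1, p.2 ∘ e.symm))
          (DFn.prodMk (by fun_prop) (DFn.pi fun i => by
            show DFn S (fun p : Γ × (α → N) => p.2 (e.symm i))
            fun_prop)))
        (h.mono fun g ⟨y, hy⟩ => ⟨y ∘ e, by
          convert hy using 2
          ext i
          simp⟩)
      exact ⟨fun g => η g ∘ e.symm, DFn.pi fun i => by
        show DFn S (fun g => η g (e.symm i))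
        fun_prop, h2⟩
    | h_empty =>
      intro R hR h
      refine ⟨fun _ i => i.elim, by fun_prop, h.mono fun g ⟨y, hy⟩ => ?_⟩
      convert hy using 2
      exact Subsingleton.elim _ _
    | @h_option α _ ih =>
      intro R hR h
      have hpi : DFn S (fun q : (Γ × (α → N)) × N =>
          (fun o => Option.elim o q.2 q.1.2 : Option α → N)) := DFn.pi fun o => by
        cases o with
        | none =>
          show DFn S (fun q : (Γ × (α → N)) × N => q.2)
          fun_prop
        | some i =>
          show DFn S (fun q : (Γ × (α → N)) × N => q.1.2 i)
          fun_prop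
      obtain ⟨η, h1, h2⟩ := ih (fun g z => ∃ a, R g (fun o => Option.elim o a z)) (by
          refine DFn.ex (P := fun (p : Γ × (α → N)) a => R p.1 (fun o => Option.elim o a p.2)) ?_
          exact hR.comp (f := fun q : (Γ × (α → N)) × N =>
            (q.1.1, (fun o => Option.elim o q.2 q.1.2 : Option α → N)))
            (DFn.prodMk (by fun_prop) hpi))
        (h.mono fun g ⟨y, hy⟩ => ⟨fun i => y (some i), y none, by
          convert hy using 2 with o
          cases o <;> rfl⟩)
      have hpi' : DFn S (fun q : Γ × N =>
          (fun o => Option.elim o q.2 (η q.1) : Option α → N)) :=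
        hpi.comp (f := fun q : Γ × N => ((q.1, η q.1), q.2)) (by fun_prop)
      obtain ⟨a, h3, h4⟩ := DFn.exists_choice_top_one (X := N)
        (R := fun g a => R g (fun o => Option.elim o a (η g)))
        (hR.comp (f := fun q : Γ × N => (q.1, (fun o => Option.elim o q.2 (η q.1))))
          (DFn.prodMk (by fun_prop) hpi')) h2
      exact ⟨fun g o => Option.elim o (a g) (η g),
        hpi'.comp (f := fun g => (g, a g)) (by fun_prop), h4⟩
  obtain ⟨ι, _, v, ρ, hv, hρ, e⟩ := DSet.code (S := S) (X := Y)
  obtain ⟨η, h1, h2⟩ := key ι (fun g z => R g (ρ z))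
    (hR.comp (f := fun p : Γ × (ι → N) => (p.1, ρ p.2)) (by fun_prop))
    (h.mono fun g ⟨y, hy⟩ => ⟨v y, by rwa [e]⟩)
  exact ⟨fun g => ρ (η g), by fun_prop, h2⟩

end ChoiceTop

section OrderedGroupHoms

variable {N : Type u} [LinearOrder N] [Nonempty N] {S : Struc N}
variable {C : Type w} [CommGroup C] [LinearOrder C] [IsOrderedMonoid C]
  [DenselyOrdered C] [NoMinOrder C] [NoMaxOrder C] [DSpace S C] [OMin S C] [DGrp S C]

theorem limAt_iff_tendsto {X : Type*} [LinearOrder X] [TopologicalSpace X] [OrderTopology X]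
    {T : Type*} {F : Filter T} {f : T → X} {y : X} : LimAt F f y ↔ Tendsto f F (𝓝 y) :=
  tendsto_order.symm

theorem MonoidHom.mono3_of_dfn (θ : C →* C) (hθ : DFn S θ) :
    (∀ x, θ x = 1) ∨ StrictMono θ ∨ StrictAnti θ := by
  obtain ⟨a, h⟩ := hθ.mono3_top
  have key : ∀ x y, x < y → ∃ t, a < x * t ∧ a < y * t := fun x y hxy => by
    obtain ⟨z, hz⟩ := exists_gt a
    exact ⟨x⁻¹ * z, by rwa [mul_inv_cancel_left], hz.trans (by
      rw [← mul_assoc]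
      exact lt_mul_of_one_lt_left' z (by
        rw [mul_comm]
        exact lt_inv_mul_iff_mul_lt.2 (by rwa [mul_one])))⟩
  rcases h with h | h | h
  · left
    obtain ⟨z, hz⟩ := exists_gt a
    have h1 : ∀ x, 1 < x → θ x = 1 := fun x hx => by
      have := h z hz (z * x) (hz.trans (lt_mul_of_one_lt_right' z hx))
      rw [map_mul] at this
      exact left_eq_mul.1 this
    intro x
    rcases lt_trichotomy x 1 with h2 | rfl | h2
    · rw [← inv_eq_one, ← map_inv]
      exact h1 _ (one_lt_inv'.2 h2)
    · exact map_one θ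
    · exact h1 x h2
  · right; left
    intro x y hxy
    obtain ⟨t, h1, h2⟩ := key x y hxy
    have := h h1 h2 (mul_lt_mul_left hxy t)
    rw [map_mul, map_mul] at this
    exact lt_of_mul_lt_mul_right' this
  · right; right
    intro x y hxy
    obtain ⟨t, h1, h2⟩ := key x y hxy
    have := h h1 h2 (mul_lt_mul_left hxy t)
    rw [map_mul, map_mul] at this
    exact lt_of_mul_lt_mul_right' this

theorem MonoidHom.mabs_le_of_dfn (θ : C →* C) (hθ : DFn S θ) {x y : C} (h : |x|ₘ ≤ |y|ₘ) :
    |θ x|ₘ ≤ |θ y|ₘ := by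
  have e : ∀ z, |θ z|ₘ = |θ |z|ₘ|ₘ := fun z => by
    rcases mabs_choice z with h | h <;> rw [h]
    rw [map_inv, mabs_inv]
  rw [e x, e y]
  have hx := one_le_mabs x
  generalize |x|ₘ = x at h hx
  generalize |y|ₘ = y at h
  rcases θ.mono3_of_dfn hθ with h1 | h1 | h1
  · simp [h1]
  · have h2 := h1.monotone hx
    have h3 := h1.monotone h
    rw [map_one] at h2
    rwa [mabs_of_one_le h2, mabs_of_one_le (h2.trans h3)]
  · have h2 := h1.antitone hx
    have h3 := h1.antitone h
    rw [map_one] at h2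
    rw [mabs_of_le_one h2, mabs_of_le_one (h3.trans h2)]
    exact inv_le_inv_iff.2 h3

theorem MonoidHom.exists_mabs_lt_of_dfn (θ : C →* C) (hθ : DFn S θ) {η : C} (hη : 1 < η) :
    ∃ ε > 1, |θ ε|ₘ < η := by
  rcases θ.trivial_or_bijective_of_dfn hθ with h | h
  · exact ⟨η, hη, by simpa [h]⟩
  · obtain ⟨η', h1, h2⟩ := exists_between hη
    obtain ⟨ε, rfl⟩ := h.2 η'
    refine ⟨|ε|ₘ, one_lt_mabs.2 ?_, ?_⟩
    · rintro rfl
      rw [map_one] at h1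
      exact h1.false
    · rcases mabs_choice ε with h | h <;> rw [h]
      · rwa [mabs_of_one_lt h1]
      · rwa [map_inv, mabs_inv, mabs_of_one_lt h1]

end OrderedGroupHoms

section Action

variable {N : Type u} [LinearOrder N] [Nonempty N] {S : Struc N}
variable {Γ : Type v} [Group Γ] [LinearOrder Γ] [MulLeftStrictMono Γ] [MulRightStrictMono Γ]
  [DenselyOrdered Γ] [NoMinOrder Γ] [NoMaxOrder Γ] [DSpace S Γ] [OMin S Γ] [DGrp S Γ]
variable {C : Type w} [CommGroup C] [LinearOrder C] [IsOrderedMonoid C]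
  [DenselyOrdered C] [NoMinOrder C] [NoMaxOrder C] [DSpace S C] [OMin S C] [DGrp S C]
variable {B : Type*} [CommGroup B] [DSpace S B] [DGrp S B]

theorem DFn.comp_act {act : Γ →* MulAut B} (hact : DFn S (fun p : Γ × B => act p.1 p.2))
    {C : Type*} [DSpace S C] {π : B → C} (hπ : DFn S π) {Z : Type*} [DSpace S Z] {f : Z → Γ}
    {b : Z → B} (hf : DFn S f) (hb : DFn S b) : DFn S (fun z => π (act (f z) (b z))) :=
  hπ.comp (hact.comp (f := fun z => (f z, b z)) (by fun_prop))

/-- If finitely many translates of `π : B →* C` have the same joint kernel as all of them, then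
`π` is invariant under the action of a group orthogonal to `C`. -/
theorem MonoidHom.invariant_of_orthogonal (act : Γ →* MulAut B)
    (hact : DFn S (fun p : Γ × B => act p.1 p.2)) (π : B →* C) (hπ : DFn S π)
    (horth : ∀ f : Γ → C, DFn S f → ¬ Function.Bijective f)
    (hfin : ∃ T : Finset Γ, ∀ a, (∀ g ∈ T, π (act g a) = 1) → ∀ g, π (act g a) = 1)
    (x : Γ) (a : B) : π (act x a) = π a := by
  classical
  let _ : TopologicalSpace C := Preorder.topology C
  have : OrderTopology C := ⟨rfl⟩
  have hlim : ∀ {f : Γ → C}, DFn S f → ∃ c, Tendsto f atTop (𝓝 c) := fun {f} hf => by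
    obtain ⟨c, hc⟩ := DFn.exists_limAt_top horth hf
    exact ⟨c, limAt_iff_tendsto.1 hc⟩
  -- an irredundant finite set of translates
  obtain ⟨T, hT, hmin⟩ : ∃ T : Finset Γ,
      (∀ a, (∀ g ∈ T, π (act g a) = 1) → ∀ g, π (act g a) = 1) ∧
      ∀ i ∈ T, ∃ a, (∀ g ∈ T.erase i, π (act g a) = 1) ∧ π (act i a) ≠ 1 := by
    obtain ⟨T, hT, hmin⟩ := WellFounded.has_min (measure Finset.card).wf
      {T : Finset Γ | ∀ a, (∀ g ∈ T, π (act g a) = 1) → ∀ g, π (act g a) = 1} hfin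
    refine ⟨T, hT, fun i hi => ?_⟩
    by_contra! hc
    refine hmin (T.erase i) (fun a ha => hT a fun g hg => ?_) (Finset.card_erase_lt_of_mem hi)
    rcases eq_or_ne g i with rfl | h
    · exact hc a ha
    · exact ha g (Finset.mem_erase.2 ⟨h, hg⟩)
  have hsurj : ∀ i c, ∃ a, i ∈ T → π (act i a) = c ∧ ∀ g ∈ T, g ≠ i → π (act g a) = 1 := by
    intro i c
    by_cases hi : i ∈ T
    swap
    · exact ⟨1, fun h => absurd h hi⟩
    let K : Subgroup B := ⨅ g ∈ T.erase i, (π.comp (act g).toMonoidHom).ker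
    have hK : ∀ a, a ∈ K ↔ ∀ g ∈ T.erase i, π (act g a) = 1 := fun a => by
      simp only [K, Subgroup.mem_iInf, MonoidHom.mem_ker]
      rfl
    let H : Subgroup C := K.map (π.comp (act i).toMonoidHom)
    have hH : ∀ c, c ∈ H ↔ ∃ a, (∀ g ∈ T.erase i, π (act g a) = 1) ∧ π (act i a) = c := fun c => by
      simp only [H, Subgroup.mem_map, hK]
      rfl
    rcases H.eq_bot_or_eq_top_of_dfn (S := S) (by
      simp only [hH]
      have h1 : DFn S (fun p : C × B => ∀ g : (T.erase i : Finset Γ), π (act g p.2) = 1) :=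
        DFn.finite_all fun g => DFn.eq (DFn.comp_act hact hπ (by fun_prop) (by fun_prop)) (by fun_prop)
      have h2 : DFn S (fun p : C × B => π (act i p.2)) := DFn.comp_act hact hπ (by fun_prop) (by fun_prop)
      have h3 : DFn S (fun p : C × B => (∀ g ∈ T.erase i, π (act g p.2) = 1)) :=
        h1.congr fun p => by simp
      fun_prop) with h | h
    · obtain ⟨a, h1, h2⟩ := hmin i hi
      have := (hH _).2 ⟨a, h1, rfl⟩
      rw [h] at this
      exact absurd this h2
    · have := (hH c).1 (by
        rw [h]
        trivial)
      obtain ⟨a, h1, h2⟩ := this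
      exact ⟨a, fun _ => ⟨h2, fun g hg hgi => h1 g (Finset.mem_erase.2 ⟨hgi, hg⟩)⟩⟩
  choose e he using hsurj
  have hdec : ∀ (b : Γ → C), ∀ g ∈ T, π (act g (∏ i ∈ T, e i (b i))) = b g := fun b g hg => by
    rw [map_prod, map_prod, Finset.prod_eq_single g]
    · exact (he g (b g) hg).1
    · exact fun i hi hne => (he i (b i) hi).2 g hg hne.symm
    · exact fun h => absurd hg h
  have hker : ∀ a b, (∀ g ∈ T, π (act g a) = π (act g b)) → ∀ g, π (act g a) = π (act g b) :=
    fun a b h g => by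
      have := hT (a / b) (fun g hg => by simp [h g hg]) g
      simpa [div_eq_one] using this
  -- the coefficients of the action
  let θ : Γ → Γ → C → C := fun g i c => π (act g (e i c))
  have hθmul : ∀ g, ∀ i ∈ T, ∀ c d, θ g i (c * d) = θ g i c * θ g i d := fun g i hi c d => by
    show π (act g (e i (c * d))) = π (act g (e i c)) * π (act g (e i d))
    rw [← map_mul, ← map_mul]
    refine hker _ _ (fun j hj => ?_) g
    rw [map_mul, map_mul]
    rcases eq_or_ne j i with rfl | hne
    · rw [(he j _ hj).1, (he j _ hj).1, (he j _ hj).1]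
    · rw [(he i _ hi).2 j hj hne, (he i _ hi).2 j hj hne, (he i _ hi).2 j hj hne, one_mul]
  have hθdef : ∀ i ∈ T, DFn S (fun p : Γ × C => θ p.1 i p.2) := fun i hi => by
    refine DFn.of_graph_rel (R := fun (p : Γ × C) y => ∃ a : B,
      (π (act i a) = p.2 ∧ ∀ j : T, j.1 ≠ i → π (act j a) = 1) ∧ π (act p.1 a) = y) ?_ ?_
    · have h1 : DFn S (fun q : ((Γ × C) × C) × B => ∀ j : T, j.1 ≠ i → π (act j q.2) = 1) :=
        DFn.finite_all fun j => DFn.imp (by fun_prop)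
          (DFn.eq (DFn.comp_act hact hπ (by fun_prop) (by fun_prop)) (by fun_prop))
      have h2 : DFn S (fun q : ((Γ × C) × C) × B => π (act i q.2)) := DFn.comp_act hact hπ (by fun_prop) (by fun_prop)
      have h3 : DFn S (fun q : ((Γ × C) × C) × B => π (act q.1.1.1 q.2)) :=
        DFn.comp_act hact hπ (by fun_prop) (by fun_prop)
      fun_prop
    · intro p y
      constructor
      · rintro rfl
        exact ⟨e i p.2, ⟨(he i _ hi).1, fun j hj => (he i _ hi).2 j j.2 hj⟩, rfl⟩
      · rintro ⟨a, ⟨h1, h2⟩, rfl⟩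
        refine hker _ _ (fun j hj => ?_) p.1
        rcases eq_or_ne j i with rfl | hne
        · rw [h1, (he j _ hj).1]
        · rw [h2 ⟨j, hj⟩ hne, (he i _ hi).2 j hj hne]
  have hexp : ∀ g d, π (act g d) = ∏ i ∈ T, θ g i (π (act i d)) := fun g d => by
    have := hker d (∏ i ∈ T, e i (π (act i d))) (fun j hj => (hdec (fun i => π (act i d)) j hj).symm) g
    rw [this, map_prod, map_prod]
  -- limits of the coefficients
  have hΘ : ∀ i c, ∃ y, Tendsto (fun g => θ g i c) atTop (𝓝 y) := fun i c =>
    hlim (DFn.comp_act hact hπ (by fun_prop) (by fun_prop))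
  choose Θ hΘ using hΘ
  have hU := DUF.top (S := S) (X := Γ)
  have := hU.neBot
  have hΘdef : ∀ i ∈ T, DFn S (Θ i) := fun i hi =>
    DFn.of_graph_rel (R := fun c y => LimAt atTop (fun g => θ g i c) y)
      (hU.limAt_def (f := fun (z : C × C) g => θ g i z.1) (y := fun z => z.2)
        ((hθdef i hi).comp (f := fun p : (C × C) × Γ => (p.2, p.1.1)) (by fun_prop)) (by fun_prop))
      fun c y => by
        rw [limAt_iff_tendsto]
        exact ⟨fun h => h ▸ hΘ i c, fun h => tendsto_nhds_unique (hΘ i c) h⟩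
  have hΘmul : ∀ i ∈ T, ∀ c d, Θ i (c * d) = Θ i c * Θ i d := fun i hi c d =>
    tendsto_nhds_unique (hΘ i (c * d)) (by
      simpa only [hθmul _ i hi] using (hΘ i c).mul (hΘ i d))
  have hsmall : ∀ i ∈ T, ∀ d : Γ → C, Tendsto d atTop (𝓝 1) →
      Tendsto (fun g => θ g i (d g)) atTop (𝓝 1) := by
    intro i hi d hd
    have hmabs : ∀ {f : Γ → C}, Tendsto f atTop (𝓝 1) ↔ ∀ η > 1, ∀ᶠ g in atTop, |f g|ₘ < η := by
      intro f
      simp only [mabs_lt]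
      rw [← limAt_iff_tendsto]
      constructor
      · intro h η hη
        filter_upwards [h.1 η⁻¹ (inv_lt_one'.2 hη), h.2 η hη] with g h1 h2 using ⟨h1, h2⟩
      · refine fun h => ⟨fun b hb => ?_, fun b hb => (h b hb).mono fun g hg => hg.2⟩
        exact (h b⁻¹ (one_lt_inv'.2 hb)).mono fun g hg => by simpa using hg.1
    rw [hmabs] at hd ⊢
    intro η hη
    obtain ⟨ε, hε, h1⟩ := (MonoidHom.mk' (Θ i) (hΘmul i hi)).exists_mabs_lt_of_dfn (S := S)
      (hΘdef i hi) hη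
    have h2 : ∀ᶠ g in atTop, |θ g i ε|ₘ < η := by
      have h3 := mabs_lt.1 h1
      have h4 := limAt_iff_tendsto.2 (hΘ i ε)
      filter_upwards [h4.1 _ h3.1, h4.2 _ h3.2] with g h5 h6 using mabs_lt.2 ⟨h5, h6⟩
    filter_upwards [h2, hd ε hε] with g h3 h4
    have h5 : |d g|ₘ ≤ |ε|ₘ := by
      rw [mabs_of_one_lt hε]
      exact h4.le
    exact ((MonoidHom.mk' (θ g i) (hθmul g i hi)).mabs_le_of_dfn (S := S)
      ((hθdef i hi).comp (f := fun c : C => (g, c)) (by fun_prop)) h5).trans_lt h3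
  -- main limit
  have hβ : ∀ i, ∃ c, Tendsto (fun g => π (act i (act g⁻¹ a))) atTop (𝓝 c) := fun i =>
    hlim (DFn.comp_act hact hπ (by fun_prop) (hact.comp (f := fun g : Γ => (g⁻¹, a)) (by fun_prop)))
  choose b' hb' using hβ
  set β := ∏ i ∈ T, e i (b' i) with hβ
  have key : ∀ a', (∀ i ∈ T, Tendsto (fun g => π (act i (act g⁻¹ a'))) atTop (𝓝 (b' i))) →
      Tendsto (fun g => π (act g β)) atTop (𝓝 (π a')) := by
    intro a' ha'
    have h1 : Tendsto (fun g => π (act g (act g⁻¹ a' / β))) atTop (𝓝 1) := by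
      refine Tendsto.congr (fun g => (hexp g _).symm) ?_
      rw [← Finset.prod_const_one (s := T)]
      refine tendsto_finsetProd _ fun i hi => hsmall i hi _ ?_
      have := (ha' i hi).div_const (b' i)
      rw [div_self'] at this
      simpa only [map_div, hβ, hdec _ i hi] using this
    have h2 : ∀ g, π (act g (act g⁻¹ a' / β)) = π a' / π (act g β) := fun g => by
      rw [map_div, map_div, ← MulAut.mul_apply, ← map_mul, mul_inv_cancel, map_one]
      rfl
    have h3 := h1.const_div' (π a')
    simpa only [h2, div_div_cancel, div_one] using h3
  refine tendsto_nhds_unique (key _ fun i _ => ?_) (key a fun i _ => hb' i)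
  have htop : Tendsto (fun g => x⁻¹ * g) atTop atTop := by
    refine tendsto_atTop.2 fun c => ?_
    have := mulLeftMono_of_mulLeftStrictMono Γ
    filter_upwards [eventually_ge_atTop (x * c)] with g hg
    exact le_inv_mul_iff_mul_le.2 hg
  have := (hb' i).comp htop
  refine this.congr fun g => ?_
  simp only [Function.comp, mul_inv_rev, inv_inv, map_mul, MulAut.mul_apply]

end Action

section Chain

variable {N : Type u} [LinearOrder N] [Nonempty N]

/-- `K` is the last term of a finite chain of definable subgroups of `B` starting from the trivial
one, whose successive quotients are one-dimensional ordered groups not in definable bijection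
with `Γ`. -/
inductive OrthChain (S : Struc N) (Γ : Type v) [DSpace S Γ] {B : Type w} [CommGroup B]
    [DSpace S B] : Subgroup B → Prop
  | bot : OrthChain S Γ ⊥
  | step {K K' : Subgroup B} (hK : OrthChain S Γ K) (hle : K ≤ K')
      (hK' : DFn S (fun x => x ∈ K')) {C : Type u} [CommGroup C] [LinearOrder C]
      [IsOrderedMonoid C] [DenselyOrdered C] [NoMinOrder C] [NoMaxOrder C] [DSpace S C]
      [OMin S C] [DGrp S C] (π : B → C) (hπ : DFn S π)
      (hmul : ∀ x ∈ K', ∀ y ∈ K', π (x * y) = π x * π y)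
      (hker : ∀ x ∈ K', π x = 1 ↔ x ∈ K)
      (horth : ∀ f : Γ → C, DFn S f → ¬ Function.Bijective f) : OrthChain S Γ K'

variable {S : Struc N}
variable {Γ : Type v} [Group Γ] [LinearOrder Γ] [MulLeftStrictMono Γ] [MulRightStrictMono Γ]
  [DenselyOrdered Γ] [NoMinOrder Γ] [NoMaxOrder Γ] [DSpace S Γ] [OMin S Γ] [DGrp S Γ]
variable {B : Type w} [CommGroup B] [DSpace S B] [DGrp S B]

theorem DGrp.subgroup {B : Type*} [Group B] [DSpace S B] [DGrp S B] {K : Subgroup B}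
    (hK : DFn S (fun x => x ∈ K)) : DGrp S K where
  toDSet := DSet.subtype (p := fun x => x ∈ K) hK 1
  mul_def := DFn.subtypeMk (p := fun x => x ∈ K) (f := fun p : K × K => p.1.1 * p.2.1)
    (by fun_prop) fun p => K.mul_mem p.1.2 p.2.2
  inv_def := DFn.subtypeMk (p := fun x => x ∈ K) (f := fun p : K => p.1⁻¹)
    (by fun_prop) fun p => K.inv_mem p.2

/-- The restriction to a subgroup of a map that is multiplicative there. -/
def Subgroup.restrictHom {B C : Type*} [Group B] [Group C] (K : Subgroup B) (π : B → C)
    (hmul : ∀ x ∈ K, ∀ y ∈ K, π (x * y) = π x * π y) : K →* C :=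
  MonoidHom.mk' (fun x => π x) fun x y => hmul x x.2 y y.2

namespace OrthChain

theorem exists_rank {K : Subgroup B} (h : OrthChain S Γ K) :
    ∃ r : Subgroup B → ℕ, ∀ L L' : Subgroup B, L ≤ L' → L' ≤ K → DFn S (fun x => x ∈ L) →
      DFn S (fun x => x ∈ L') → r L ≤ r L' ∧ (r L = r L' → L = L') := by
  classical
  induction h with
  | bot =>
    refine ⟨fun _ => 0, fun L L' h1 h2 _ _ => ⟨le_rfl, fun _ => ?_⟩⟩
    rw [le_bot_iff.1 (h1.trans h2), le_bot_iff.1 h2]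
  | @step K K' hK hle hK' C _ _ _ _ _ _ _ _ _ π hπ hmul hker horth ih =>
    have hKd : DFn S (fun x => x ∈ K) := by
      have : DFn S (fun x => x ∈ K' ∧ π x = 1) := by fun_prop
      exact this.congr fun x => ⟨fun h => ⟨hle h, (hker x (hle h)).2 h⟩, fun h => (hker x h.1).1 h.2⟩
    obtain ⟨r, hr⟩ := ih
    refine ⟨fun L => r (L ⊓ K) + if L ≤ K then 0 else 1, fun L L' h1 h2 h3 h4 => ?_⟩
    have hinf : ∀ {L : Subgroup B}, DFn S (fun x => x ∈ L) → DFn S (fun x => x ∈ L ⊓ K) :=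
      fun {L} h => by
        simp only [Subgroup.mem_inf]
        fun_prop
    obtain ⟨h5, h6⟩ := hr (L ⊓ K) (L' ⊓ K) (inf_le_inf_right K h1) inf_le_right (hinf h3) (hinf h4)
    by_cases hL : L ≤ K
    · by_cases hL' : L' ≤ K
      · simp only [hL, hL', if_true, add_zero]
        refine ⟨h5, fun h => ?_⟩
        have := h6 h
        rwa [inf_eq_left.2 hL, inf_eq_left.2 hL'] at this
      · simp only [hL, hL', if_true, if_false, add_zero]
        exact ⟨by omega, fun h => by omega⟩
    · have hL' : ¬ L' ≤ K := fun h => hL (h1.trans h)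
      simp only [hL, hL', if_false, add_le_add_iff_right, add_left_inj]
      refine ⟨h5, fun h => le_antisymm h1 fun x hx => ?_⟩
      let H := (L.subgroupOf K').map (K'.restrictHom π hmul)
      have hH : ∀ c, c ∈ H ↔ ∃ y, (y ∈ K' ∧ y ∈ L) ∧ π y = c := fun c =>
        ⟨fun ⟨y, h1, h2⟩ => ⟨y, ⟨y.2, h1⟩, h2⟩, fun ⟨y, h1, h2⟩ => ⟨⟨y, h1.1⟩, h1.2, h2⟩⟩
      rcases H.eq_bot_or_eq_top_of_dfn (S := S) (by
        simp only [hH]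
        fun_prop) with h7 | h7
      · refine absurd (fun y hy => ?_) hL
        have hyK' := h2 (h1 hy)
        refine (hker y hyK').1 ?_
        have := (hH _).2 ⟨y, ⟨hyK', hy⟩, rfl⟩
        rwa [h7] at this
      · obtain ⟨y, ⟨hyK', hyL⟩, hy⟩ := (hH (π x)).1 (by
          rw [h7]
          trivial)
        have h8 : x * y⁻¹ ∈ K := by
          have hxy : x * y⁻¹ ∈ K' := K'.mul_mem (h2 hx) (K'.inv_mem hyK')
          refine (hker _ hxy).1 (mul_right_cancel (b := π y) ?_)
          rw [← hmul _ hxy _ hyK', inv_mul_cancel_right, one_mul, hy]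
        have h9 : x * y⁻¹ ∈ L ⊓ K := by
          rw [h6 h]
          exact ⟨L'.mul_mem hx (L'.inv_mem (h1 hyL)), h8⟩
        simpa using L.mul_mem h9.1 hyL

theorem hom_trivial {K : Subgroup B} (h : OrthChain S Γ K) (f : Γ →* B) (hf : DFn S f)
    (hK : ∀ x, f x ∈ K) (x : Γ) : f x = 1 := by
  induction h with
  | bot => exact hK x
  | @step K K' hK₁ hle hK' C _ _ _ _ _ _ _ _ _ π hπ hmul hker horth ih =>
    refine ih fun y => (hker _ (hK y)).1 ?_
    have hπf : DFn S (fun x => π (f x)) := by fun_prop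
    rcases (MonoidHom.mk' (fun x => π (f x)) fun x y => by
      rw [map_mul, hmul _ (hK x) _ (hK y)]).trivial_or_bijective_of_dfn hπf with h | h
    · exact h y
    · exact absurd h (horth _ hπf)

theorem act_trivial (act : Γ →* MulAut B) (hact : DFn S (fun p : Γ × B => act p.1 p.2))
    {K : Subgroup B} (h : OrthChain S Γ K) : ∀ L : Subgroup B, L ≤ K → DFn S (fun x => x ∈ L) →
      (∀ g, ∀ a ∈ L, act g a ∈ L) → ∀ g, ∀ a ∈ L, act g a = a := by
  induction h with
  | bot =>
    intro L hL _ _ g a ha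
    have : a = 1 := hL ha
    rw [this, map_one]
  | @step K K' hK hle hK' C _ _ _ _ _ _ _ _ _ π hπ hmul hker horth ih =>
    intro L hL hLd hinv
    have hr := (OrthChain.step hK hle hK' π hπ hmul hker horth).exists_rank
    obtain ⟨r, hr⟩ := hr
    let q : L →* C := L.restrictHom π fun x hx y hy => hmul x (hL hx) y (hL hy)
    let act' : Γ →* MulAut L :=
      { toFun := fun g =>
          { toFun := fun a => ⟨act g a, hinv g a a.2⟩
            invFun := fun a => ⟨act g⁻¹ a, hinv g⁻¹ a a.2⟩
            left_inv := fun a => Subtype.ext (by simp)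
            right_inv := fun a => Subtype.ext (by simp)
            map_mul' := fun a b => Subtype.ext (map_mul (act g) a.1 b.1) }
        map_one' := by
          ext a
          simp
        map_mul' := fun g h => by
          ext a
          simp }
    let M : Set Γ → Subgroup B := fun T =>
      { carrier := {a | a ∈ L ∧ ∀ g ∈ T, π (act g a) = 1}
        one_mem' := ⟨L.one_mem, fun g _ => by
          rw [map_one]
          exact map_one q⟩
        mul_mem' := fun {a b} ha hb => ⟨L.mul_mem ha.1 hb.1, fun g hg => by
          rw [map_mul, hmul _ (hL (hinv g a ha.1)) _ (hL (hinv g b hb.1)), ha.2 g hg, hb.2 g hg,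
            one_mul]⟩
        inv_mem' := fun {a} ha => ⟨L.inv_mem ha.1, fun g hg => by
          have h1 := map_inv q ⟨act g a, hinv g a ha.1⟩
          have h2 : q ⟨act g a, hinv g a ha.1⟩ = 1 := ha.2 g hg
          rw [h2, inv_one] at h1
          rw [map_inv]
          exact h1⟩ }
    have hM : ∀ {T a}, a ∈ M T ↔ a ∈ L ∧ ∀ g ∈ T, π (act g a) = 1 := Iff.rfl
    have hML : ∀ T, M T ≤ L := fun T a ha => ha.1
    have hMd : ∀ T : Finset Γ, DFn S (fun x => x ∈ M T) := fun T => by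
      have h1 : DFn S (fun a : B => ∀ g : T, π (act g a) = 1) :=
        DFn.finite_all fun g => DFn.eq (DFn.comp_act hact hπ (by fun_prop) (by fun_prop))
          (by fun_prop)
      have h2 : DFn S (fun a : B => ∀ g ∈ T, π (act g a) = 1) := h1.congr fun p => by simp
      exact hLd.and h2
    have hdL := DGrp.subgroup hLd
    have hinvπ : ∀ x, ∀ a ∈ L, π (act x a) = π a := fun x a ha => by
      refine MonoidHom.invariant_of_orthogonal (S := S) act' ?_ q ?_ horth ?_ x ⟨a, ha⟩
      · exact DFn.subtypeMk (p := fun x => x ∈ L) (f := fun p : Γ × L => act p.1 p.2.1)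
          (hact.comp (f := fun p : Γ × L => (p.1, p.2.1)) (by fun_prop)) fun p => hinv p.1 _ p.2.2
      · exact hπ.comp (f := fun a : L => a.1) (by fun_prop)
      · classical
        obtain ⟨T, -, hT⟩ := WellFounded.has_min (measure fun T : Finset Γ => r (M T)).wf
          Set.univ ⟨∅, trivial⟩
        refine ⟨T, fun a ha g => ?_⟩
        have h1 : M ↑(insert g T) ≤ M T := fun a ha => ⟨ha.1, fun g hg =>
          ha.2 g (Finset.mem_insert_of_mem hg)⟩
        obtain ⟨h2, h3⟩ := hr _ _ h1 ((hML _).trans hL) (hMd _) (hMd _)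
        have h4 := h3 (h2.antisymm (not_lt.1 (hT (insert g T) trivial)))
        have h5 : a.1 ∈ M T := ⟨a.2, ha⟩
        rw [← h4] at h5
        exact h5.2 g (Finset.mem_insert_self g T)
    have hMuniv : DFn S (fun x => x ∈ M univ) := by
      have h2 : DFn S (fun p : B × Γ => π (act p.2 p.1)) :=
        DFn.comp_act hact hπ (by fun_prop) (by fun_prop)
      have h1 : DFn S (fun a : B => ∀ g : Γ, π (act g a) = 1) := by fun_prop
      exact (hLd.and h1).congr fun a => by simp [hM]
    have hMinv : ∀ g, ∀ a ∈ M univ, act g a ∈ M univ := fun g a ha => ⟨hinv g a ha.1, fun h _ => by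
      rw [← MulAut.mul_apply, ← map_mul]
      exact ha.2 _ trivial⟩
    have hMK : M univ ≤ K := fun a ha => (hker a (hL ha.1)).1 (by simpa using ha.2 1 trivial)
    have htriv := ih (M univ) hMK hMuniv hMinv
    intro g a ha
    have hmem : ∀ x, act x a * a⁻¹ ∈ M univ := fun x =>
      ⟨L.mul_mem (hinv x a ha) (L.inv_mem ha), fun h _ => by
        have h1 : q ⟨act h (act x a), hinv h _ (hinv x a ha)⟩ = q ⟨act h a, hinv h a ha⟩ := by
          show π (act h (act x a)) = π (act h a)
          rw [← MulAut.mul_apply, ← map_mul, hinvπ _ a ha, hinvπ _ a ha]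
        have h2 := map_mul q ⟨act h (act x a), hinv h _ (hinv x a ha)⟩ ⟨act h a, hinv h a ha⟩⁻¹
        rw [map_inv, h1, mul_inv_cancel] at h2
        rw [map_mul, map_inv]
        exact h2⟩
    have h1 := hK.hom_trivial (MonoidHom.mk' (fun x => act x a * a⁻¹) fun x y => by
      have h2 := htriv x _ (hmem y)
      rw [map_mul, map_inv] at h2
      rw [mul_inv_eq_iff_eq_mul] at h2
      rw [map_mul, MulAut.mul_apply, h2]
      simp only [mul_assoc, mul_comm])
      (by
        have : DFn S (fun x => act x a) := hact.comp (f := fun x => (x, a)) (by fun_prop)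
        exact DFn.mul this (by fun_prop)) (fun x => hMK (hmem x)) g
    exact mul_inv_eq_one.1 h1

end OrthChain

end Chain

section Complement

variable {N : Type u} [LinearOrder N] [DenselyOrdered N] [NoMinOrder N] [NoMaxOrder N] [Nonempty N]
  {S : Struc N}
variable {Γ : Type v} [Group Γ] [LinearOrder Γ] [MulLeftStrictMono Γ] [MulRightStrictMono Γ]
  [DenselyOrdered Γ] [NoMinOrder Γ] [NoMaxOrder Γ] [DSpace S Γ] [OMin S Γ] [DGrp S Γ]
variable {B : Type w} [CommGroup B] [DSpace S B] [DGrp S B]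

/-- A central extension of `Γ` by the last term of an orthogonal chain has a definable
complement. -/
theorem OrthChain.exists_complement {E : Type*} [Group E] [DSpace S E] [DGrp S E] (ι : B →* E)
    (hι : DFn S ι) (hinj : Function.Injective ι) (hcent : ∀ a u, ι a * u = u * ι a)
    (j : E →* Γ) (hj : DFn S j) (hker : ∀ u, j u = 1 ↔ ∃ a, ι a = u)
    {K : Subgroup B} (h : OrthChain S Γ K) : ∀ W : Subgroup E, DFn S (fun u => u ∈ W) →
      (∀ x, ∃ w ∈ W, j w = x) → (∀ a, ι a ∈ W → a ∈ K) →
      ∃ W₀ : Subgroup E, DFn S (fun u => u ∈ W₀) ∧ (∀ x, ∃ w ∈ W₀, j w = x) ∧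
        ∀ a, ι a ∈ W₀ → a = 1 := by
  induction h with
  | bot => exact fun W h1 h2 h3 => ⟨W, h1, h2, h3⟩
  | @step K K' hK hle hK' C _ _ _ _ _ _ _ _ _ π hπ hmul hkerπ horth ih =>
    intro W hW hsurj hWK
    let q : K' →* C := K'.restrictHom π hmul
    have hinvπ : ∀ a ∈ K', π a⁻¹ = (π a)⁻¹ := fun a ha => map_inv q ⟨a, ha⟩
    let H := ((W.comap ι).subgroupOf K').map q
    have hH : ∀ c, c ∈ H ↔ ∃ y, (y ∈ K' ∧ ι y ∈ W) ∧ π y = c := fun c =>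
      ⟨fun ⟨y, h1, h2⟩ => ⟨y, ⟨y.2, h1⟩, h2⟩, fun ⟨y, h1, h2⟩ => ⟨⟨y, h1.1⟩, h1.2, h2⟩⟩
    have hWι : DFn S (fun a => ι a ∈ W) := hW.comp hι
    rcases H.eq_bot_or_eq_top_of_dfn (S := S) (by
      simp only [hH]
      fun_prop) with h7 | h7
    · refine ih W hW hsurj fun a ha => (hkerπ a (hWK a ha)).1 ?_
      have := (hH _).2 ⟨a, ⟨hWK a ha, ha⟩, rfl⟩
      rwa [h7] at this
    obtain ⟨s, hs, hs'⟩ := DFn.exists_choice_top (S := S) (R := fun (g : Γ) (u : E) => u ∈ W ∧ j u = g)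
      (by fun_prop) (Eventually.of_forall hsurj)
    obtain ⟨ρ, hρ, hρ'⟩ := DFn.exists_partial_choice (S := S) (R := fun (u : E) (a : B) => ι a = u)
      (by fun_prop) (fun u a b h1 h2 => hinj (h1.trans h2.symm))
    have hρι : ∀ a, ρ (ι a) = a := fun a => hinj (hρ' _ ⟨a, rfl⟩)
    let e : E → Γ → E := fun u z => u⁻¹ * s (j u * z) * (s z)⁻¹
    let f : E → Γ → C := fun u z => π (ρ (e u z))
    have := mulLeftMono_of_mulLeftStrictMono Γ
    have hshift : ∀ x : Γ, Tendsto (fun z => x * z) atTop atTop := fun x =>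
      (OrderIso.mulLeft x).tendsto_atTop
    have he : DFn S (fun p : E × Γ => e p.1 p.2) := by fun_prop
    have hf : DFn S (fun p : E × Γ => f p.1 p.2) := hπ.comp (hρ.comp he)
    have heW : ∀ u ∈ W, ∀ᶠ z in atTop, ρ (e u z) ∈ K' ∧ ι (ρ (e u z)) = e u z := fun u hu => by
      filter_upwards [hs', (hshift (j u)).eventually hs'] with z h1 h2
      have h3 : j (e u z) = 1 := by
        simp only [e, map_mul, map_inv, h1.2, h2.2]
        group
      obtain ⟨a, ha⟩ := (hker _).1 h3
      rw [← ha, hρι]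
      refine ⟨hWK a ?_, rfl⟩
      rw [ha]
      exact W.mul_mem (W.mul_mem (W.inv_mem hu) h2.1) (W.inv_mem h1.1)
    have hfmul : ∀ u ∈ W, ∀ v ∈ W, ∀ᶠ z in atTop, f u (j v * z) * f v z = f (u * v) z := by
      intro u hu v hv
      filter_upwards [(hshift (j v)).eventually (heW u hu), heW v hv] with z h1 h2
      have h3 : e u (j v * z) * e v z = e (u * v) z := by
        have : e u (j v * z) * v⁻¹ = v⁻¹ * e u (j v * z) := by
          rw [← h1.2, hcent]
        calc e u (j v * z) * e v z = e u (j v * z) * v⁻¹ * (s (j v * z) * (s z)⁻¹) := by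
              simp only [e, mul_assoc]
          _ = e (u * v) z := by
              rw [this]
              simp only [e, mul_assoc, map_mul, mul_inv_rev, inv_mul_cancel_left]
      have h4 : ρ (e (u * v) z) = ρ (e u (j v * z)) * ρ (e v z) := by
        rw [← h3, ← hρι (ρ (e u (j v * z)) * ρ (e v z)), map_mul, h1.2, h2.2]
      show π _ * π _ = π _
      rw [h4, hmul _ h1.1 _ h2.1]
    let _ : TopologicalSpace C := Preorder.topology C
    have : OrderTopology C := ⟨rfl⟩
    have hlim : ∀ u, ∃ c, Tendsto (f u) atTop (𝓝 c) := fun u => by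
      obtain ⟨c, hc⟩ := DFn.exists_limAt_top horth
        (hf.comp (f := fun z => (u, z)) (by fun_prop))
      exact ⟨c, limAt_iff_tendsto.1 hc⟩
    choose lam hlam using hlim
    have hlamul : ∀ u ∈ W, ∀ v ∈ W, lam (u * v) = lam u * lam v := fun u hu v hv =>
      tendsto_nhds_unique (hlam (u * v))
        ((((hlam u).comp (hshift (j v))).mul (hlam v)).congr' (hfmul u hu v hv))
    have hlamι : ∀ a, lam (ι a) = π a⁻¹ := fun a => by
      refine tendsto_nhds_unique (hlam (ι a)) (tendsto_const_nhds.congr fun z => ?_)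
      have : e (ι a) z = ι a⁻¹ := by
        simp only [e, (hker (ι a)).2 ⟨a, rfl⟩, one_mul, mul_inv_cancel_right, map_inv]
      show _ = π (ρ _)
      rw [this, hρι]
    let l : W →* C := W.restrictHom lam hlamul
    have hmem : ∀ u, u ∈ l.ker.map W.subtype ↔ u ∈ W ∧ lam u = 1 := fun u =>
      ⟨fun ⟨w, h1, h2⟩ => h2 ▸ ⟨w.2, h1⟩, fun ⟨h1, h2⟩ => ⟨⟨u, h1⟩, h2, rfl⟩⟩
    refine ih (l.ker.map W.subtype) ?_ ?_ ?_
    · refine DFn.congr (hW.and (DUF.top.limAt_def hf (DFn.const (1 : C)))) fun u => ?_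
      rw [hmem, limAt_iff_tendsto]
      exact and_congr_right fun _ => ⟨fun h => h ▸ hlam u, fun h => tendsto_nhds_unique (hlam u) h⟩
    · intro x
      obtain ⟨w, hw, hwx⟩ := hsurj x
      obtain ⟨a, ⟨ha1, ha2⟩, ha⟩ := (hH (lam w)).1 (by
        rw [h7]
        trivial)
      refine ⟨w * ι a, (hmem _).2 ⟨W.mul_mem hw ha2, ?_⟩, ?_⟩
      · rw [hlamul _ hw _ ha2, hlamι, hinvπ a ha1, ha, mul_inv_cancel]
      · rw [map_mul, hwx, (hker (ι a)).2 ⟨a, rfl⟩, mul_one]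
    · intro a ha
      obtain ⟨h1, h2⟩ := (hmem _).1 ha
      have h3 := hWK a h1
      rw [hlamι, hinvπ a h3, inv_eq_one] at h2
      exact (hkerπ a h3).1 h2

end Complement

section Projections

variable {N : Type u} [LinearOrder N] [Nonempty N] {S : Struc N} {Γ : Type v} [DSpace S Γ]
variable {B : Type w} [CommGroup B] [DSpace S B] [DGrp S B]

theorem OrthChain.inf_comap {D : Subgroup B} (hD : DFn S (fun x => x ∈ D)) {q : B →* B}
    (hq : DFn S q) (h₀ : OrthChain S Γ (D ⊓ q.ker)) {K : Subgroup B} (h : OrthChain S Γ K) :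
    OrthChain S Γ (D ⊓ K.comap q) := by
  induction h with
  | bot => exact h₀
  | @step K K' hK hle hK' C _ _ _ _ _ _ _ _ _ π hπ hmul hker horth ih =>
    refine ih.step (inf_le_inf_left D (Subgroup.comap_mono hle))
      (hD.and (hK'.comp hq)) (fun x => π (q x)) (hπ.comp hq) (fun x hx y hy => ?_)
      (fun x hx => ?_) horth
    · rw [map_mul, hmul _ hx.2 _ hy.2]
    · exact (hker _ hx.2).trans ⟨fun h => ⟨hx.1, h⟩, fun h => h.2⟩

/-- A group with finitely many jointly injective projections to subgroups with orthogonal chains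
has an orthogonal chain. -/
theorem OrthChain.top_of_projections {ι : Type*} [Finite ι] (P : ι → Subgroup B) (q : ι → B →* B)
    (hq : ∀ i, DFn S (q i)) (hqP : ∀ i a, q i a ∈ P i) (hq1 : ∀ a, (∀ i, q i a = 1) → a = 1)
    (hP : ∀ i, OrthChain S Γ (P i)) : OrthChain S Γ (⊤ : Subgroup B) := by
  classical
  have := Fintype.ofFinite ι
  let D : Finset ι → Subgroup B := fun s => ⨅ i : {i // i ∉ s}, (q i).ker
  have hD : ∀ {s a}, a ∈ D s ↔ ∀ i ∉ s, q i a = 1 := fun {s a} => by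
    simp [D, Subgroup.mem_iInf]
  have key : ∀ s, OrthChain S Γ (D s) := fun s => by
    induction s using Finset.induction_on with
    | empty =>
      have : D ∅ = ⊥ := (Subgroup.eq_bot_iff_forall _).2 fun a ha =>
        hq1 a fun i => hD.1 ha i (Finset.notMem_empty i)
      rw [this]
      exact OrthChain.bot
    | insert i s hi ih =>
      have h1 : DFn S (fun a => a ∈ D (insert i s)) := by
        refine DFn.congr (P := fun a => ∀ k : {k // k ∉ insert i s}, q k a = 1)
          (DFn.finite_all fun k => DFn.eq (hq k) (DFn.const 1)) fun a => ?_
        rw [hD, Subtype.forall]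
      have h2 : D (insert i s) ⊓ (q i).ker = D s := by
        ext a
        rw [Subgroup.mem_inf, hD, hD, MonoidHom.mem_ker]
        constructor
        · rintro ⟨h1, h2⟩ k hk
          by_cases hki : k = i
          · rwa [hki]
          · exact h1 k (by simp [hki, hk])
        · exact fun h => ⟨fun k hk => h k fun hks => hk (Finset.mem_insert_of_mem hks), h i hi⟩
      have h3 : D (insert i s) ⊓ (P i).comap (q i) = D (insert i s) :=
        inf_eq_left.2 fun a _ => hqP i a
      rw [← h3]
      exact OrthChain.inf_comap h1 (hq i) (by rwa [h2]) (hP i)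
  have : D Finset.univ = ⊤ := eq_top_iff.2 fun a _ => hD.2 fun i hi => absurd (Finset.mem_univ i) hi
  rw [← this]
  exact key _

end Projections

section

variable {N : Type u} [LinearOrder N] [TopologicalSpace N] {S : Struc N}

namespace DefGroup

variable {m n : ℕ} {G : DefGroup S m} {H : DefGroup S n}

/-- The group of elements of an abelian definable group. -/
@[reducible] def commGroup (hG : G.IsAbelian) : CommGroup G.Elt :=
  { instGroupElt with mul_comm := fun x y => Subtype.ext (hG x.1 x.2 y.1 y.2) }

open Classical in
/-- The extension of a map between groups of elements to the ambient spaces. -/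
noncomputable def extend (f : G.Elt → H.Elt) (x : Fin m → N) : Fin n → N :=
  if h : x ∈ G.carrier then (f ⟨x, h⟩).1 else H.one

theorem extend_val (f : G.Elt → H.Elt) (x : G.Elt) : extend f x.1 = (f x).1 := dif_pos x.2

variable [Nonempty N]

theorem defFunOn_extend {f : G.Elt → H.Elt} (hf : DFn S f) : S.DefFunOn G.carrier (extend f) := by
  rw [Struc.defFunOn_iff_dfn]
  refine DFn.congr (P := fun p : (Fin m → N) × (Fin n → N) => ∃ x : G.Elt, x.1 = p.1 ∧ (f x).1 = p.2)
    ?_ fun p => ?_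
  · have h : DFn S (fun q : ((Fin m → N) × (Fin n → N)) × G.Elt => (f q.2).1) :=
      dfn_val (hf.comp (f := fun q : ((Fin m → N) × (Fin n → N)) × G.Elt => q.2) (by fun_prop))
    exact DFn.ex (P := fun (p : (Fin m → N) × (Fin n → N)) (x : G.Elt) => x.1 = p.1 ∧ (f x).1 = p.2)
      (by fun_prop)
  · constructor
    · rintro ⟨h, e⟩
      exact ⟨⟨p.1, h⟩, rfl, (extend_val f _).symm.trans e⟩
    · rintro ⟨x, h1, h2⟩
      rw [← h1, extend_val]
      exact ⟨x.2, h2⟩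

theorem isDefHom_extend {f : G.Elt →* H.Elt} (hf : DFn S f) : IsDefHom G H (extend f) := by
  refine ⟨fun x hx => ?_, defFunOn_extend hf, fun x hx y hy => ?_⟩
  · rw [extend_val f ⟨x, hx⟩]
    exact (f _).2
  · rw [extend_val f ⟨x, hx⟩, extend_val f ⟨y, hy⟩]
    exact (extend_val f (⟨x, hx⟩ * ⟨y, hy⟩ : G.Elt)).trans
      (congrArg Subtype.val (map_mul f ⟨x, hx⟩ ⟨y, hy⟩))

/-- The homomorphism between groups of elements given by a definable homomorphism. -/
def IsDefHom.hom {f : (Fin m → N) → Fin n → N} (hf : IsDefHom G H f) : G.Elt →* H.Elt :=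
  MonoidHom.mk' (fun x => ⟨f x.1, hf.1 x.1 x.2⟩) fun x y => Subtype.ext (hf.2.2 x.1 x.2 y.1 y.2)

theorem IsDefHom.dfn_hom {f : (Fin m → N) → Fin n → N} (hf : IsDefHom G H f) :
    DFn S (IsDefHom.hom hf) := by
  refine DFn.of_graph (((Struc.defFunOn_iff_dfn.1 hf.2.1).comp
    (f := fun p : G.Elt × H.Elt => (p.1.1, p.2.1)) (by fun_prop)).congr fun p => ?_)
  exact ⟨fun h => ⟨p.1.2, congrArg Subtype.val h⟩, fun h => Subtype.ext h.2⟩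

theorem not_bijective_of_noDefBijection (h : NoDefBijection S G.carrier H.carrier)
    (f : G.Elt → H.Elt) (hf : DFn S f) : ¬ Function.Bijective f := fun hb => by
  refine h ⟨extend f, defFunOn_extend hf, fun x hx => ?_, fun x hx y hy e => ?_, ?_⟩
  · rw [extend_val f ⟨x, hx⟩]
    exact (f _).2
  · rw [extend_val f ⟨x, hx⟩, extend_val f ⟨y, hy⟩] at e
    exact congrArg Subtype.val (hb.1 (Subtype.ext e))
  · ext y
    constructor
    · rintro ⟨x, hx, rfl⟩
      rw [extend_val f ⟨x, hx⟩]
      exact (f _).2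
    · intro hy
      obtain ⟨x, hx⟩ := hb.2 ⟨y, hy⟩
      exact ⟨x.1, x.2, (extend_val f x).trans (congrArg Subtype.val hx)⟩

end DefGroup

end

section

variable {N : Type u} [LinearOrder N] [DenselyOrdered N] [NoMinOrder N] [NoMaxOrder N] [Nonempty N]
  [TopologicalSpace N] [OrderTopology N] {S : Struc N}

namespace DefGroup

variable {m : ℕ} {A : DefGroup S m}

theorem commGroup_listProd (hA : A.IsAbelian) (L : List A.Elt) :
    A.listProd (L.map fun x : A.Elt => x.1) = (letI := commGroup hA; L.prod).1 := by
  induction L with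
  | nil => rfl
  | cons x L ih =>
    rw [List.map_cons, listProd, ih]
    rfl

theorem orthChain_step {mG : ℕ} {G : DefGroup S mG} (hA : A.IsAbelian) {K K' : Set (Fin m → N)}
    (hK : A.IsDefSubgroup K) (hK' : A.IsDefSubgroup K') (hle : K ⊆ K') {C : DefGroup S 1}
    {π : (Fin m → N) → Fin 1 → N} (hπ : IsQuotMap A K' K C π) (hdim : odim C.carrier = 1)
    (hconn : C.DefinablyConnected) (htf : C.TorsionFree)
    (hnobij : NoDefBijection S G.carrier C.carrier)
    (h : letI := commGroup hA; OrthChain S G.Elt hK.subgroup) :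
    letI := commGroup hA; OrthChain S G.Elt hK'.subgroup := by
  classical
  have hC : C.IsAbelian := by
    intro x hx y hy
    rw [← hπ.2.2.2.1] at hx hy
    obtain ⟨a, ha, rfl⟩ := hx
    obtain ⟨b, hb, rfl⟩ := hy
    rw [← hπ.2.2.1 a ha b hb, ← hπ.2.2.1 b hb a ha, hA a (hK'.1 ha) b (hK'.1 hb)]
  obtain ⟨o, i1, i2, i3, i4, i5, i6⟩ := exists_ordered_group hdim hconn htf
  let _ := commGroup hC
  let _ := commGroup hA
  have := mulLeftMono_of_mulLeftStrictMono C.Elt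
  have : IsOrderedMonoid C.Elt :=
    ⟨fun a b hab c => by
      rw [mul_comm a, mul_comm b]
      exact mul_le_mul_right hab c, fun a b hab c => mul_le_mul_right hab c⟩
  let f : A.Elt → C.Elt := fun x => if h : x.1 ∈ K' then ⟨π x.1, hπ.1 x.1 h⟩ else 1
  have hf : ∀ x : A.Elt, ∀ h : x.1 ∈ K', f x = ⟨π x.1, hπ.1 x.1 h⟩ := fun x h => dif_pos h
  refine OrthChain.step h (C := C.Elt) (fun x hx => hle hx) hK'.dfn f ?_ ?_ ?_
    (not_bijective_of_noDefBijection hnobij)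
  · have h1 : DFn S (fun p : A.Elt × C.Elt => p.1.1 ∈ K' ∧ π p.1.1 = p.2.1) :=
      (Struc.defFunOn_iff_dfn.1 hπ.2.1).comp (f := fun p : A.Elt × C.Elt => (p.1.1, p.2.1))
        (by fun_prop)
    have h2 : DFn S (fun p : A.Elt × C.Elt => p.1.1 ∈ K') :=
      hK'.dfn.comp (f := fun p : A.Elt × C.Elt => p.1) (by fun_prop)
    have h3 : DFn S (fun p : A.Elt × C.Elt => 1 = p.2) := by fun_prop
    refine DFn.of_graph ((h1.or (h2.not.and h3)).congr fun p => ?_)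
    by_cases h : p.1.1 ∈ K'
    · rw [hf _ h]
      simp only [h, true_and, not_true, false_and, or_false]
      exact ⟨fun h => congrArg Subtype.val h, fun h => Subtype.ext h⟩
    · simp [f, h]
  · intro x hx y hy
    rw [hf _ hx, hf _ hy, hf _ (hK'.subgroup.mul_mem hx hy)]
    exact Subtype.ext (hπ.2.2.1 x.1 hx y.1 hy)
  · intro x hx
    rw [hf _ hx]
    exact Iff.trans ⟨fun h => congrArg Subtype.val h, fun h => Subtype.ext h⟩ (hπ.2.2.2.2 x.1 hx)

theorem orthChain_of_chain {mG : ℕ} {G : DefGroup S mG} (hA : A.IsAbelian) {Q : Set (Fin m → N)}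
    (hQ : A.IsDefSubgroup Q) {I : Set N} {n : ℕ} (ch : Fin (n + 1) → Set (Fin m → N))
    (h0 : ch 0 = {A.one}) (hlast : ch (Fin.last n) = Q) (hsub : ∀ j, A.IsDefSubgroup (ch j))
    (hle : ∀ j : Fin n, ch j.castSucc ⊆ ch j.succ)
    (hquot : ∀ j : Fin n, ∃ (C : DefGroup S 1) (π : (Fin m → N) → (Fin 1 → N)),
      IsQuotMap A (ch j.succ) (ch j.castSucc) C π ∧ C.carrier = {x : Fin 1 → N | x 0 ∈ I} ∧
        odim C.carrier = 1 ∧ C.DefinablyConnected ∧ C.TorsionFree)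
    (hnobij : NoDefBijection S G.carrier {x : Fin 1 → N | x 0 ∈ I}) :
    letI := commGroup hA; OrthChain S G.Elt hQ.subgroup := by
  let _ := commGroup hA
  have key : ∀ j, OrthChain S G.Elt (hsub j).subgroup := fun j => by
    induction j using Fin.induction with
    | zero =>
      have : (hsub 0).subgroup = ⊥ := (Subgroup.eq_bot_iff_forall _).2 fun x hx => by
        rw [IsDefSubgroup.mem_subgroup, h0] at hx
        exact Subtype.ext hx
      rw [this]
      exact OrthChain.bot
    | succ j ih =>
      obtain ⟨C, π, h1, h2, h3, h4, h5⟩ := hquot j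
      exact orthChain_step hA (hsub _) (hsub _) (hle j) h1 h3 h4 h5 (by rwa [h2]) ih
  have := key (Fin.last n)
  have e : (hsub (Fin.last n)).subgroup = hQ.subgroup := by
    ext x
    rw [IsDefSubgroup.mem_subgroup, IsDefSubgroup.mem_subgroup, hlast]
  rwa [e] at this

theorem orthChain_top {mG : ℕ} {G : DefGroup S mG} (hA : A.IsAbelian)
    (parts : List (Set (Fin m → N))) (hdp : IsInternalDPList A A.carrier parts)
    (hparts : ∀ i (h : A.IsDefSubgroup (parts.get i)),
      letI := commGroup hA; OrthChain S G.Elt h.subgroup) :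
    letI := commGroup hA; OrthChain S G.Elt (⊤ : Subgroup A.Elt) := by
  obtain ⟨hsub, -, hex, huniq⟩ := hdp
  have hsub : ∀ i, A.IsDefSubgroup (parts.get i) := fun i => hsub _ (List.get_mem _ _)
  let _ := commGroup hA
  have hprod : ∀ F : Fin parts.length → A.Elt,
      A.listProd (List.ofFn fun i => (F i).1) = (∏ i, F i : A.Elt).1 := fun F => by
    rw [← List.prod_ofFn]
    refine Eq.trans ?_ (commGroup_listProd hA (List.ofFn F))
    rw [List.map_ofFn]
    rfl
  have hex' : ∀ a : A.Elt, ∃ F : Fin parts.length → A.Elt, (∀ i, F i ∈ (hsub i).subgroup) ∧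
      a = ∏ i, F i := fun a => by
    obtain ⟨f, h1, h2⟩ := (hex a.1).1 a.2
    exact ⟨fun i => ⟨f i, (hsub i).1 (h1 i)⟩, h1,
      Subtype.ext (h2.trans (hprod fun i => ⟨f i, (hsub i).1 (h1 i)⟩))⟩
  have huniq' : ∀ F F' : Fin parts.length → A.Elt, (∀ i, F i ∈ (hsub i).subgroup) →
      (∀ i, F' i ∈ (hsub i).subgroup) → ∏ i, F i = ∏ i, F' i → F = F' := fun F F' h1 h2 h => by
    have := huniq (fun i => (F i).1) (fun i => (F' i).1) h1 h2
      ((hprod F).trans ((congrArg Subtype.val h).trans (hprod F').symm))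
    exact funext fun i => Subtype.ext (congrFun this i)
  choose q hq hqprod using hex'
  have hqeq : ∀ a F, (∀ i, F i ∈ (hsub i).subgroup) → a = ∏ i, F i → q a = F := fun a F h1 h2 =>
    huniq' _ _ (hq a) h1 ((hqprod a).symm.trans h2)
  have hqmul : ∀ a b, q (a * b) = fun i => q a i * q b i := fun a b =>
    hqeq _ _ (fun i => (hsub i).subgroup.mul_mem (hq a i) (hq b i)) (by
      rw [Finset.prod_mul_distrib, ← hqprod a, ← hqprod b])
  refine OrthChain.top_of_projections (fun i => (hsub i).subgroup)
    (fun i => MonoidHom.mk' (fun a => q a i) fun a b => congrFun (hqmul a b) i) (fun i => ?_)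
    (fun i a => hq a i) (fun a ha => ?_) (fun i => hparts i (hsub i))
  · have hprod_dfn : ∀ s : Finset (Fin parts.length),
        DFn S (fun F : Fin parts.length → A.Elt => ∏ i ∈ s, F i) := fun s => by
      classical
      induction s using Finset.induction_on with
      | empty => simpa using DFn.const _
      | insert i s hi ih =>
        simp only [Finset.prod_insert hi]
        exact DFn.mul (DFn.apply i) ih
    have h1 : ∀ i, DFn S (fun p : A.Elt × (Fin parts.length → A.Elt) =>
        p.2 i ∈ (hsub i).subgroup) := fun i => (hsub i).dfn.comp
      (f := fun p : A.Elt × (Fin parts.length → A.Elt) => p.2 i) (by fun_prop)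
    have hqd : DFn S q := DFn.of_graph_rel (R := fun a F => (∀ i, F i ∈ (hsub i).subgroup) ∧
        a = ∏ i, F i)
      (DFn.and (DFn.finite_all h1) (DFn.eq (by fun_prop)
        ((hprod_dfn Finset.univ).comp (f := fun p : A.Elt × (Fin parts.length → A.Elt) => p.2)
          (by fun_prop))))
      fun a F => ⟨fun h => h ▸ ⟨hq a, hqprod a⟩, fun h => hqeq a F h.1 h.2⟩
    exact (DFn.apply i).comp hqd
  · rw [hqprod a]
    exact Finset.prod_eq_one fun i _ => ha i

end DefGroup

end

section

variable {N : Type u} [LinearOrder N] [TopologicalSpace N] [Nonempty N] {S : Struc N}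

/-- The action of a definable module on the group of elements. -/
def DefModule.hom {mG mA : ℕ} {G : DefGroup S mG} {A : DefGroup S mA} (γ : DefModule G A) :
    G.Elt →* MulAut A.Elt :=
  have hinv : ∀ (g : G.Elt) (a : A.Elt), γ.act (g⁻¹ : G.Elt).1 (γ.act g.1 a.1) = a.1 := fun g a => by
    rw [← γ.act_mul (g⁻¹ : G.Elt).2 g.2 a.2]
    have : G.mul (g⁻¹ : G.Elt).1 g.1 = G.one := congrArg Subtype.val (inv_mul_cancel g)
    rw [this, γ.act_one a.2]
  { toFun := fun g =>
      { toFun := fun a => ⟨γ.act g.1 a.1, γ.act_mem g.2 a.2⟩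
        invFun := fun a => ⟨γ.act (g⁻¹ : G.Elt).1 a.1, γ.act_mem (g⁻¹ : G.Elt).2 a.2⟩
        left_inv := fun a => Subtype.ext (hinv g a)
        right_inv := fun a => Subtype.ext (by
          have := hinv g⁻¹ a
          rwa [inv_inv] at this)
        map_mul' := fun a b => Subtype.ext (γ.act_hom g.2 a.2 b.2) }
    map_one' := MulEquiv.ext fun a => Subtype.ext (γ.act_one a.2)
    map_mul' := fun g h => MulEquiv.ext fun a => Subtype.ext (γ.act_mul g.2 h.2 a.2) }

theorem DefModule.dfn_hom {mG mA : ℕ} {G : DefGroup S mG} {A : DefGroup S mA}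
    (γ : DefModule G A) : DFn S (fun p : G.Elt × A.Elt => γ.hom p.1 p.2) := by
  refine DFn.of_graph (((Struc.defFun2_iff_dfn.1 γ.act_def).comp
    (f := fun p : (G.Elt × A.Elt) × A.Elt => ((p.1.1.1, p.1.2.1), p.2.1))
      (by fun_prop)).congr fun p => ?_)
  exact ⟨fun h => ⟨p.1.1.2, p.1.2.2, congrArg Subtype.val h⟩, fun h => Subtype.ext h.2.2⟩

end

end Orthogonality

/-- let `G` be a one-dimensional definably connected torsion-free
definable group, and let `A = A₁ × ⋯ × A_l` be a definable `G`-module where each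
`A_i` has a chain of definable subgroups whose successive quotients are
one-dimensional definably connected torsion-free definable groups with domain
`I_i ⊆ N`, and suppose there is no definable bijection between `G` and any `I_i`.
Then the action of `G` on `A` is trivial and every compatible definable extension
of `G` by `A` splits. -/
theorem stmt_7 {N : Type u} [LinearOrder N] [DenselyOrdered N] [NoMinOrder N]
    [NoMaxOrder N] [Nonempty N] [TopologicalSpace N] [OrderTopology N]
    (S : Struc N) {mG mA : ℕ} (G : DefGroup S mG) (A : DefGroup S mA)
    (γ : DefModule G A)
    (hdim : odim G.carrier = 1) (hconn : G.DefinablyConnected)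
    (htf : G.TorsionFree)
    (l : ℕ) (P : Fin l → Set (Fin mA → N)) (I : Fin l → Set N)
    (hdp : IsInternalDPList A A.carrier (List.ofFn P))
    (hchain : ∀ i : Fin l, ∃ (n : ℕ) (ch : Fin (n + 1) → Set (Fin mA → N)),
      ch 0 = {A.one} ∧ ch (Fin.last n) = P i ∧
      (∀ j, A.IsDefSubgroup (ch j)) ∧
      (∀ j : Fin n, ch j.castSucc ⊆ ch j.succ) ∧
      ∀ j : Fin n, ∃ (C : DefGroup S 1) (π : (Fin mA → N) → (Fin 1 → N)),
        IsQuotMap A (ch j.succ) (ch j.castSucc) C π ∧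
        C.carrier = {x : Fin 1 → N | x 0 ∈ I i} ∧
        odim C.carrier = 1 ∧ C.DefinablyConnected ∧ C.TorsionFree)
    (hnobij : ∀ i : Fin l,
      NoDefBijection S G.carrier {x : Fin 1 → N | x 0 ∈ I i}) :
    γ.IsTrivial ∧
    ∀ (mU : ℕ) (U : DefGroup S mU) (i : (Fin mA → N) → (Fin mU → N))
      (j : (Fin mU → N) → (Fin mG → N)),
      IsDefExtension A U G i j → ExtCompatible γ U i j →
      ∃ r : (Fin mU → N) → (Fin mA → N),
        IsDefHom U A r ∧ ∀ a ∈ A.carrier, r (i a) = a := by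
  obtain ⟨o, i1, i2, i3, i4, i5, i6⟩ := DefGroup.exists_ordered_group hdim hconn htf
  have hch := DefGroup.orthChain_top (G := G) γ.abelian (List.ofFn P) hdp fun k h => by
    obtain ⟨n, ch, h1, h2, h3, h4, h5⟩ := hchain (Fin.cast (List.length_ofFn) k)
    exact DefGroup.orthChain_of_chain γ.abelian h ch h1 (h2.trans (List.get_ofFn P k).symm) h3 h4 h5 (hnobij _)
  let _ := DefGroup.commGroup γ.abelian
  have htriv : ∀ (g : G.Elt) (a : A.Elt), γ.hom g a = a := fun g a =>
    hch.act_trivial γ.hom γ.dfn_hom ⊤ le_rfl (DFn.const True) (fun _ _ _ => trivial) g a trivial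
  have htriv' : γ.IsTrivial := fun x hx a ha => congrArg Subtype.val (htriv ⟨x, hx⟩ ⟨a, ha⟩)
  refine ⟨htriv', fun mU U i j ⟨hi, hj, hinj, hsurj, hker⟩ hcomp => ?_⟩
  let ι : A.Elt →* U.Elt := DefGroup.IsDefHom.hom hi
  let p : U.Elt →* G.Elt := DefGroup.IsDefHom.hom hj
  have hι : DFn S ι := DefGroup.IsDefHom.dfn_hom hi
  have hp : DFn S p := DefGroup.IsDefHom.dfn_hom hj
  have hιinj : Function.Injective ι := fun a b h =>
    Subtype.ext (hinj a.2 b.2 (congrArg Subtype.val h))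
  have hcent : ∀ a u, ι a * u = u * ι a := fun a u => by
    have h1 : ι a = u * ι a * u⁻¹ := Subtype.ext (by
      have h2 := hcomp u.1 u.2 a.1 a.2
      rw [htriv' _ (hj.1 u.1 u.2) a.1 a.2] at h2
      exact h2)
    rw [h1, inv_mul_cancel_right, ← h1]
  have hpker : ∀ u, p u = 1 ↔ ∃ a, ι a = u := fun u => by
    refine Iff.trans ⟨fun h => congrArg Subtype.val h, fun h => Subtype.ext h⟩
      ((hker u.1 u.2).trans ⟨?_, ?_⟩)
    · rintro ⟨a, ha, e⟩
      exact ⟨⟨a, ha⟩, Subtype.ext e.symm⟩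
    · rintro ⟨a, rfl⟩
      exact ⟨a.1, a.2, rfl⟩
  have hpsurj : ∀ x, ∃ u, p u = x := fun x => by
    obtain ⟨u, hu, e⟩ := hsurj.ge x.2
    exact ⟨⟨u, hu⟩, Subtype.ext e⟩
  obtain ⟨W, hW, hWsurj, hWι⟩ := hch.exists_complement ι hι hιinj hcent p hp hpker ⊤
    (DFn.const True) (fun x => (hpsurj x).imp fun u hu => ⟨trivial, hu⟩) (fun _ _ => trivial)
  have huniq : ∀ u a b, u * (ι a)⁻¹ ∈ W → u * (ι b)⁻¹ ∈ W → a = b := fun u a b h1 h2 => by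
    have h3 := W.mul_mem (W.inv_mem h2) h1
    rw [mul_inv_rev, inv_inv, mul_assoc, inv_mul_cancel_left, ← map_inv, ← map_mul] at h3
    exact (mul_inv_eq_one.1 (hWι _ h3)).symm
  have hex : ∀ u, ∃ a, u * (ι a)⁻¹ ∈ W := fun u => by
    obtain ⟨w, hw, e⟩ := hWsurj (p u)
    obtain ⟨a, ha⟩ := (hpker (w⁻¹ * u)).1 (by rw [map_mul, map_inv, e, inv_mul_cancel])
    exact ⟨a, by rwa [ha, mul_inv_rev, inv_inv, mul_inv_cancel_left]⟩
  choose r hr using hex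
  let r' : U.Elt →* A.Elt := MonoidHom.mk' r fun u v => huniq _ _ _ (hr _) (by
    have h := W.mul_mem (hr u) (hr v)
    have e : u * (ι (r u))⁻¹ * (v * (ι (r v))⁻¹) = u * v * (ι (r u * r v))⁻¹ := by
      rw [map_mul, mul_inv_rev, mul_assoc u, ← mul_assoc _ v, ← map_inv, hcent, ← map_inv, hcent]
      simp only [mul_assoc]
    rwa [e] at h)
  have hr' : DFn S r' := DFn.of_graph_rel (R := fun u a => u * (ι a)⁻¹ ∈ W)
    (hW.comp (f := fun q : U.Elt × A.Elt => q.1 * (ι q.2)⁻¹) (by fun_prop))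
    fun u a => ⟨fun h => h ▸ hr u, fun h => huniq u _ _ (hr u) h⟩
  refine ⟨DefGroup.extend r', DefGroup.isDefHom_extend hr', fun a ha => ?_⟩
  refine (DefGroup.extend_val r' (ι ⟨a, ha⟩)).trans (congrArg Subtype.val (?_ : r _ = ⟨a, ha⟩))
  exact huniq _ _ _ (hr _) (by
    rw [mul_inv_cancel]
    exact W.one_mem)
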